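/- Let d ≥ 1, 2 ≤ p ≤ ∞, and let A = (A₁,A₂), B = (B₁,B₂) be pairs with A₁,A₂,B₁,B₂ > 0. There exists a constant C such that ‖f‖_p ‖f̂‖_{p′} ≤ C ‖ x^A f ‖_p ‖ ξ^B f̂ ‖_{p′} for all Schwartz functions f on ℝ^d if and only if B₂ ≥ A₁, A₂ ≥ B₁, A₂ > d(1/2 − 1/p), and one of the following holds: (1) A₁ < d(1/2 − 1/p) and B₂² ≥ d(1/2 − 1/p)·A₁; (2) A₁ > d(1/2 − 1/p); (3) A₁ = d(1/2 − 1/p) < B₂. -/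

import Mathlib

open MeasureTheory
open scoped ENNReal FourierTransform

/-- The broken power weight `x^A`: `|x|^{A₁}` for `|x| < 1`, `|x|^{A₂}` for `|x| ≥ 1`. -/
noncomputable def brokenWeight {d : ℕ} (A : ℝ × ℝ) (x : EuclideanSpace ℝ (Fin d)) : ℝ :=
  if ‖x‖ < 1 then ‖x‖ ^ A.1 else ‖x‖ ^ A.2

section HausdorffYoung

variable {V : Type*} [NormedAddCommGroup V] [InnerProductSpace ℝ V] [MeasurableSpace V]
  [BorelSpace V] [FiniteDimensional ℝ V]

/-- Plancherel's theorem for Schwartz functions, in terms of `eLpNorm`. -/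
lemma eLpNorm_two_fourier (f : SchwartzMap V ℂ) :
    eLpNorm (𝓕 (⇑f)) 2 volume = eLpNorm (⇑f) 2 volume := by
  have h := SchwartzMap.norm_fourier_toL2_eq f
  rw [SchwartzMap.norm_toLp, SchwartzMap.norm_toLp] at h
  have h1 := ((𝓕 f : SchwartzMap V ℂ).memLp 2 volume).eLpNorm_ne_top
  have h2 := (f.memLp 2 volume).eLpNorm_ne_top
  exact (ENNReal.toReal_eq_toReal_iff' h1 h2).1 h

lemma eLpNorm_fourierInv (f : SchwartzMap V ℂ) (p : ℝ≥0∞) :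
    eLpNorm (⇑(𝓕⁻ f : SchwartzMap V ℂ)) p volume = eLpNorm (𝓕 (⇑f)) p volume := by
  have h : (⇑(𝓕⁻ f : SchwartzMap V ℂ)) = (⇑(𝓕 f : SchwartzMap V ℂ)) ∘ Neg.neg := by
    ext x
    rw [SchwartzMap.fourierInv_coe, Real.fourierInv_eq_fourier_neg]
    rfl
  rw [h]
  exact eLpNorm_comp_measurePreserving (𝓕 f : SchwartzMap V ℂ).continuous.aestronglyMeasurable
    (Measure.measurePreserving_neg _)

lemma enorm_fourier_apply_le (f : SchwartzMap V ℂ) (x : V) :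
    ‖𝓕 (⇑f) x‖ₑ ≤ ∫⁻ y, ‖f y‖ₑ := by
  rw [Real.fourier_eq]
  refine (enorm_integral_le_lintegral_enorm _).trans (le_of_eq ?_)
  congr with y
  simp [← ofReal_norm]

end HausdorffYoung

section Truncation

/-- Smooth truncation of a Schwartz function at height `t`. -/
lemma exists_schwartz_truncation {V : Type*} [NormedAddCommGroup V] [InnerProductSpace ℝ V]
    [FiniteDimensional ℝ V] (u : SchwartzMap V ℂ) {t : ℝ} (ht : 0 < t) :
    ∃ v w : SchwartzMap V ℂ, u = v + w ∧
      (∀ x, ‖v x‖ ≤ ‖u x‖ ∧ (‖u x‖ < t → v x = 0)) ∧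
      (∀ x, ‖w x‖ ≤ ‖u x‖ ∧ (2 * t < ‖u x‖ → w x = 0)) := by
  set η : V → ℝ := fun x => Real.smoothTransition (‖u x‖ ^ 2 / t ^ 2 - 1) with hη
  have hη_smooth : ContDiff ℝ ((⊤ : ℕ∞) : WithTop ℕ∞) η := by
    apply Real.smoothTransition.contDiff.comp
    exact ((u.smooth'.norm_sq ℝ).div_const _).sub contDiff_const
  have hη0 : ∀ x, 0 ≤ η x := fun x => Real.smoothTransition.nonneg _
  have hη1 : ∀ x, η x ≤ 1 := fun x => Real.smoothTransition.le_one _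
  have hη_zero : ∀ x, ‖u x‖ ≤ t → η x = 0 := by
    intro x hx
    apply Real.smoothTransition.zero_of_nonpos
    rw [sub_nonpos, div_le_one (by positivity)]
    gcongr
  have hη_one : ∀ x, 2 * t < ‖u x‖ → η x = 1 := by
    intro x hx
    apply Real.smoothTransition.one_of_one_le
    rw [le_sub_iff_add_le, le_div_iff₀ (by positivity)]
    nlinarith
  have hcs : HasCompactSupport (fun x => (η x : ℂ) * u x) := by
    have hev : ∀ᶠ x in Filter.cocompact V, ‖u x‖ < t := by
      have := (u.tendsto_cocompact).norm
      rw [norm_zero] at this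
      exact this.eventually_lt_const ht
    rw [Filter.Eventually, Filter.mem_cocompact] at hev
    obtain ⟨K, hK, hKs⟩ := hev
    refine HasCompactSupport.intro hK fun x hx => ?_
    have : ‖u x‖ < t := hKs hx
    simp [hη_zero x this.le]
  have hsm : ContDiff ℝ ((⊤ : ℕ∞) : WithTop ℕ∞) (fun x => (η x : ℂ) * u x) :=
    (Complex.ofRealCLM.contDiff.comp hη_smooth).mul u.smooth'
  set v := hcs.toSchwartzMap hsm with hv
  have hvx : ∀ x, v x = (η x : ℂ) * u x := fun x => rfl
  refine ⟨v, u - v, by abel, fun x => ⟨?_, ?_⟩, fun x => ⟨?_, ?_⟩⟩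
  · rw [hvx, norm_mul, Complex.norm_real, Real.norm_of_nonneg (hη0 x)]
    exact mul_le_of_le_one_left (norm_nonneg _) (hη1 x)
  · intro h
    simp [hvx, hη_zero x h.le]
  · have : (u - v) x = ((1 - η x : ℝ) : ℂ) * u x := by
      rw [sub_apply, hvx]; push_cast; ring
    rw [this, norm_mul, Complex.norm_real, Real.norm_of_nonneg (by linarith [hη1 x])]
    exact mul_le_of_le_one_left (norm_nonneg _) (by linarith [hη0 x])
  · intro h
    rw [sub_apply, hvx, hη_one x h]; simp

end Truncation

section HausdorffYoung

lemma eLpNorm_ofReal_rpow {α F : Type*} [MeasurableSpace α] {μ : Measure α}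
    [NormedAddCommGroup F] (g : α → F) {P : ℝ} (hP : 0 < P) :
    (eLpNorm g (ENNReal.ofReal P) μ) ^ P = ∫⁻ x, ENNReal.ofReal (‖g x‖ ^ P) ∂μ := by
  rw [eLpNorm_eq_lintegral_rpow_enorm_toReal (by simpa using hP) (by simp),
    ENNReal.toReal_ofReal hP.le, ← ENNReal.rpow_mul, one_div, inv_mul_cancel₀ hP.ne',
    ENNReal.rpow_one]
  congr with x
  rw [← ENNReal.ofReal_rpow_of_nonneg (norm_nonneg _) hP.le, ofReal_norm]

variable {V : Type*} [NormedAddCommGroup V] [InnerProductSpace ℝ V] [MeasurableSpace V]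
  [BorelSpace V] [FiniteDimensional ℝ V]

lemma meas_fourier_ge_le {P Q : ℝ} (hPQ : P.HolderConjugate Q) (u : SchwartzMap V ℂ)
    (hu : ∫⁻ x, ENNReal.ofReal (‖u x‖ ^ Q) ≤ 1) {l : ℝ} (hl : 0 < l) :
    volume {x | l ≤ ‖𝓕 (⇑u) x‖} ≤ ENNReal.ofReal (4 / l ^ 2) *
      ∫⁻ x, {x | ‖u x‖ ≤ 2 * (4 / l) ^ (P - 1)}.indicator
        (fun x => ENNReal.ofReal (‖u x‖ ^ (2 : ℝ))) x := by
  set t : ℝ := (4 / l) ^ (P - 1) with ht_def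
  have ht : 0 < t := by positivity
  obtain ⟨v, w, huvw, hv, hw⟩ := exists_schwartz_truncation u ht
  have hQ := hPQ.symm.pos
  have hexp : (P - 1) * (1 - Q) = -1 := by
    have := hPQ.mul_eq_add
    nlinarith
  have hv1 : ∫⁻ x, ‖v x‖ₑ ≤ ENNReal.ofReal (l / 4) := by
    calc ∫⁻ x, ‖v x‖ₑ ≤ ∫⁻ x, ENNReal.ofReal (l / 4) * ENNReal.ofReal (‖u x‖ ^ Q) := by
          refine lintegral_mono fun x => ?_
          rw [← ofReal_norm, ← ENNReal.ofReal_mul (by positivity)]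
          apply ENNReal.ofReal_le_ofReal
          rcases lt_or_ge ‖u x‖ t with h | h
          · rw [(hv x).2 h, norm_zero]; positivity
          · have hpos : 0 < ‖u x‖ := ht.trans_le h
            have h1 : ‖u x‖ = ‖u x‖ ^ (1 - Q) * ‖u x‖ ^ Q := by
              rw [← Real.rpow_add hpos]; simp
            have h2 : ‖u x‖ ^ (1 - Q) ≤ l / 4 := by
              calc ‖u x‖ ^ (1 - Q) ≤ t ^ (1 - Q) :=
                    Real.rpow_le_rpow_of_nonpos ht h (by linarith [hPQ.symm.lt])
                _ = l / 4 := by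
                    rw [ht_def, ← Real.rpow_mul (by positivity), hexp, Real.rpow_neg_one, inv_div]
            calc ‖v x‖ ≤ ‖u x‖ := (hv x).1
              _ = _ := h1
              _ ≤ _ := by gcongr
      _ = ENNReal.ofReal (l / 4) * ∫⁻ x, ENNReal.ofReal (‖u x‖ ^ Q) :=
          lintegral_const_mul' _ _ ENNReal.ofReal_ne_top
      _ ≤ ENNReal.ofReal (l / 4) := mul_le_of_le_one_right' hu
  have hsub : {x | l ≤ ‖𝓕 (⇑u) x‖} ⊆
      {x | ENNReal.ofReal ((l / 2) ^ (2 : ℝ)) ≤ ENNReal.ofReal (‖𝓕 (⇑w) x‖ ^ (2 : ℝ))} := by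
    intro x hx
    have h1 : 𝓕 (⇑u) x = 𝓕 (⇑v) x + 𝓕 (⇑w) x := by
      have : (𝓕 u : SchwartzMap V ℂ) = 𝓕 v + 𝓕 w := by rw [huvw, FourierTransform.fourier_add]
      exact congrArg (fun g : SchwartzMap V ℂ => g x) this
    have h2 : ‖𝓕 (⇑v) x‖ ≤ l / 4 := by
      have := (enorm_fourier_apply_le v x).trans hv1
      rw [← ofReal_norm] at this
      exact (ENNReal.ofReal_le_ofReal_iff (by positivity)).1 this
    have h3 : ‖𝓕 (⇑u) x‖ ≤ ‖𝓕 (⇑v) x‖ + ‖𝓕 (⇑w) x‖ := h1 ▸ norm_add_le _ _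
    have h4 : l ≤ ‖𝓕 (⇑u) x‖ := hx
    apply ENNReal.ofReal_le_ofReal
    apply Real.rpow_le_rpow (by positivity) (by linarith) (by norm_num)
  have hpl : ∫⁻ x, ENNReal.ofReal (‖𝓕 (⇑w) x‖ ^ (2 : ℝ)) =
      ∫⁻ x, ENNReal.ofReal (‖w x‖ ^ (2 : ℝ)) := by
    rw [← eLpNorm_ofReal_rpow _ two_pos, ← eLpNorm_ofReal_rpow _ two_pos]
    simp [eLpNorm_two_fourier w]
  have hmeas : Measurable fun x => ENNReal.ofReal (‖𝓕 (⇑w) x‖ ^ (2 : ℝ)) := by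
    have := (𝓕 w : SchwartzMap V ℂ).continuous
    rw [SchwartzMap.fourier_coe] at this
    have h := this.measurable
    fun_prop
  have hcheb := mul_meas_ge_le_lintegral (μ := (volume : Measure V)) hmeas
    (ENNReal.ofReal ((l / 2) ^ (2 : ℝ)))
  calc volume {x | l ≤ ‖𝓕 (⇑u) x‖} ≤ _ := measure_mono hsub
    _ = ENNReal.ofReal (4 / l ^ 2) * (ENNReal.ofReal ((l / 2) ^ (2 : ℝ)) * volume {x |
          ENNReal.ofReal ((l / 2) ^ (2 : ℝ)) ≤ ENNReal.ofReal (‖𝓕 (⇑w) x‖ ^ (2 : ℝ))}) := by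
        rw [← mul_assoc, ← ENNReal.ofReal_mul (by positivity)]
        have : 4 / l ^ 2 * (l / 2) ^ (2 : ℝ) = 1 := by
          rw [Real.rpow_two]; field_simp; norm_num
        rw [this, ENNReal.ofReal_one, one_mul]
    _ ≤ ENNReal.ofReal (4 / l ^ 2) * ∫⁻ x, ENNReal.ofReal (‖w x‖ ^ (2 : ℝ)) := by
        gcongr
        exact hcheb.trans hpl.le
    _ ≤ _ := by
        gcongr with x
        by_cases hx : ‖u x‖ ≤ 2 * t
        · rw [Set.indicator_of_mem (by exact hx)]
          apply ENNReal.ofReal_le_ofReal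
          exact Real.rpow_le_rpow (norm_nonneg _) (hw x).1 (by norm_num)
        · rw [(hw x).2 (not_le.1 hx)]; simp

lemma lintegral_fourier_rpow_le {P Q : ℝ} (hPQ : P.HolderConjugate Q) (hP : 2 < P) :
    ∃ C : ℝ≥0∞, C ≠ ⊤ ∧ ∀ u : SchwartzMap V ℂ, ∫⁻ x, ENNReal.ofReal (‖u x‖ ^ Q) ≤ 1 →
      ∫⁻ x, ENNReal.ofReal (‖𝓕 (⇑u) x‖ ^ P) ≤ C := by
  have hQ := hPQ.symm.pos
  have hQ1 := hPQ.symm.lt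
  refine ⟨ENNReal.ofReal P * ENNReal.ofReal (4 * ((4 * 2 ^ (Q - 1)) ^ (P - 2) / (P - 2))),
    by finiteness, fun u hu => ?_⟩
  have hcont : Continuous (𝓕 (⇑u)) := (𝓕 u : SchwartzMap V ℂ).continuous
  rw [lintegral_rpow_eq_lintegral_meas_le_mul volume (Filter.Eventually.of_forall
    fun x => norm_nonneg _) hcont.norm.aemeasurable (by linarith)]
  gcongr
  set K : ℝ → V → ℝ≥0∞ := fun l x => ENNReal.ofReal (4 * l ^ (P - 3)) *
    {y : ℝ × V | ‖u y.2‖ ≤ 2 * (4 / y.1) ^ (P - 1)}.indicator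
        (fun y => ENNReal.ofReal (‖u y.2‖ ^ (2 : ℝ))) (l, x) with hK
  have hum : Measurable u := u.continuous.measurable
  have hKm : Measurable (Function.uncurry K) := by
    apply Measurable.mul
    · fun_prop
    · apply Measurable.indicator
      · fun_prop
      · apply measurableSet_le <;> fun_prop
  calc ∫⁻ l in Set.Ioi 0, volume {a | l ≤ ‖𝓕 (⇑u) a‖} * ENNReal.ofReal (l ^ (P - 1))
      ≤ ∫⁻ l in Set.Ioi 0, ∫⁻ x, K l x := by
        refine setLIntegral_mono' measurableSet_Ioi fun l hl => ?_
        have hl : 0 < l := hl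
        calc _ ≤ (ENNReal.ofReal (4 / l ^ 2) * ∫⁻ x, {x | ‖u x‖ ≤ 2 * (4 / l) ^ (P - 1)}.indicator
                  (fun x => ENNReal.ofReal (‖u x‖ ^ (2 : ℝ))) x) * ENNReal.ofReal (l ^ (P - 1)) := by
                gcongr; exact meas_fourier_ge_le hPQ u hu hl
          _ = ENNReal.ofReal (4 * l ^ (P - 3)) *
                ∫⁻ x, {x | ‖u x‖ ≤ 2 * (4 / l) ^ (P - 1)}.indicator
                  (fun x => ENNReal.ofReal (‖u x‖ ^ (2 : ℝ))) x := by
                rw [mul_right_comm, ← ENNReal.ofReal_mul (by positivity)]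
                congr 2
                rw [show P - 3 = (P - 1) - 2 by ring, Real.rpow_sub hl (P - 1) 2, Real.rpow_two]
                ring
          _ = ∫⁻ x, K l x := by
                rw [← lintegral_const_mul' _ _ ENNReal.ofReal_ne_top]
                rfl
    _ = ∫⁻ x, ∫⁻ l in Set.Ioi 0, K l x := lintegral_lintegral_swap hKm.aemeasurable
    _ ≤ ∫⁻ x, ENNReal.ofReal (4 * ((4 * 2 ^ (Q - 1)) ^ (P - 2) / (P - 2))) *
          ENNReal.ofReal (‖u x‖ ^ Q) := by
        refine lintegral_mono fun x => ?_
        rcases eq_or_ne (u x) 0 with h0 | h0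
        · have : ∀ l, K l x = 0 := by
            intro l
            simp only [hK]
            rw [Set.indicator_apply]
            simp only [h0]
            simp
          simp [this]
        have hpos : 0 < ‖u x‖ := norm_pos_iff.2 h0
        set L : ℝ := 4 * (2 / ‖u x‖) ^ (Q - 1) with hL
        have hLpos : 0 < L := by positivity
        have hPQ1 : (P - 1) * (Q - 1) = 1 := by
          have := hPQ.mul_eq_add
          linarith
        have hKle : ∀ l ∈ Set.Ioi (0 : ℝ), K l x ≤ (Set.Ioc 0 L).indicator
            (fun l => ENNReal.ofReal (4 * ‖u x‖ ^ (2 : ℝ) * l ^ (P - 3))) l := by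
          intro l hl
          have hl : 0 < l := hl
          by_cases h : ‖u x‖ ≤ 2 * (4 / l) ^ (P - 1)
          · have hlL : l ≤ L := by
              have h1 : ‖u x‖ ^ (Q - 1) ≤ (2 * (4 / l) ^ (P - 1)) ^ (Q - 1) :=
                Real.rpow_le_rpow hpos.le h (by linarith)
              rw [Real.mul_rpow (by positivity) (by positivity), ← Real.rpow_mul (by positivity),
                hPQ1, Real.rpow_one] at h1
              rw [hL, Real.div_rpow (by positivity) (by positivity), ← mul_div_assoc,
                le_div_iff₀ (by positivity)]
              rw [← mul_div_assoc, le_div_iff₀ hl] at h1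
              linarith
            rw [Set.indicator_of_mem (Set.mem_Ioc.2 ⟨hl, hlL⟩)]
            simp only [hK]
            rw [Set.indicator_of_mem (by exact h), ← ENNReal.ofReal_mul (by positivity)]
            apply ENNReal.ofReal_le_ofReal
            apply le_of_eq; ring
          · simp only [hK]
            rw [Set.indicator_of_notMem (by exact h)]
            simp
        calc ∫⁻ l in Set.Ioi 0, K l x
          _ ≤ ∫⁻ l in Set.Ioi 0, (Set.Ioc 0 L).indicator
            (fun l => ENNReal.ofReal (4 * ‖u x‖ ^ (2 : ℝ) * l ^ (P - 3))) l :=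
              setLIntegral_mono' measurableSet_Ioi hKle
          _ ≤ ∫⁻ l, (Set.Ioc 0 L).indicator
            (fun l => ENNReal.ofReal (4 * ‖u x‖ ^ (2 : ℝ) * l ^ (P - 3))) l :=
              setLIntegral_le_lintegral _ _
          _ = ∫⁻ l in Set.Ioc 0 L, ENNReal.ofReal (4 * ‖u x‖ ^ (2 : ℝ) * l ^ (P - 3)) :=
              lintegral_indicator measurableSet_Ioc _
          _ = ENNReal.ofReal (∫ l in Set.Ioc 0 L, 4 * ‖u x‖ ^ (2 : ℝ) * l ^ (P - 3)) := by
              rw [ofReal_integral_eq_lintegral_ofReal]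
              · apply Integrable.const_mul
                exact (intervalIntegral.intervalIntegrable_rpow' (a := 0) (b := L)
                  (by linarith : -1 < P - 3)).1
              · filter_upwards [self_mem_ae_restrict measurableSet_Ioc] with l hl
                have := hl.1
                simp only [Pi.zero_apply]
                positivity
          _ = ENNReal.ofReal (4 * ((4 * 2 ^ (Q - 1)) ^ (P - 2) / (P - 2)) * ‖u x‖ ^ Q) := by
              congr 1
              rw [integral_const_mul, ← intervalIntegral.integral_of_le hLpos.le,
                integral_rpow (Or.inl (by linarith)), show P - 3 + 1 = P - 2 by ring,
                Real.zero_rpow (by linarith), sub_zero, hL,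
                Real.div_rpow (by positivity) (by positivity), ← mul_div_assoc (4 : ℝ),
                Real.div_rpow (by positivity) (by positivity),
                ← Real.rpow_mul (norm_nonneg _)]
              have : ‖u x‖ ^ (2 : ℝ) = ‖u x‖ ^ ((Q - 1) * (P - 2)) * ‖u x‖ ^ Q := by
                rw [← Real.rpow_add hpos]
                congr 1
                linarith
              rw [this]
              field_simp
          _ = _ := by rw [ENNReal.ofReal_mul (by have : 0 < P - 2 := by linarith
                                                 positivity)]
    _ = ENNReal.ofReal (4 * ((4 * 2 ^ (Q - 1)) ^ (P - 2) / (P - 2))) *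
          ∫⁻ x, ENNReal.ofReal (‖u x‖ ^ Q) := lintegral_const_mul' _ _ ENNReal.ofReal_ne_top
    _ ≤ _ := mul_le_of_le_one_right' hu

end HausdorffYoung

section HausdorffYoung

variable {V : Type*} [NormedAddCommGroup V] [InnerProductSpace ℝ V] [MeasurableSpace V]
  [BorelSpace V] [FiniteDimensional ℝ V]

lemma schwartz_eq_zero_of_eLpNorm_eq_zero {f : SchwartzMap V ℂ} {p : ℝ≥0∞} (hp : p ≠ 0)
    (h : eLpNorm (⇑f) p volume = 0) : f = 0 := by
  rw [eLpNorm_eq_zero_iff f.continuous.aestronglyMeasurable hp] at h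
  have := (Continuous.ae_eq_iff_eq volume f.continuous continuous_const).1 h
  ext x
  exact congrFun this x

lemma exists_hausdorffYoung_aux {P Q : ℝ} (hPQ : P.HolderConjugate Q) (hP : 2 < P) :
    ∃ C : ℝ≥0∞, C ≠ ⊤ ∧ ∀ u : SchwartzMap V ℂ,
      eLpNorm (𝓕 (⇑u)) (ENNReal.ofReal P) volume ≤
        C * eLpNorm (⇑u) (ENNReal.ofReal Q) volume := by
  obtain ⟨C, hC, h⟩ := lintegral_fourier_rpow_le (V := V) hPQ hP
  have hQ := hPQ.symm.pos
  have hP0 := hPQ.pos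
  refine ⟨C ^ P⁻¹, by finiteness, fun u => ?_⟩
  rcases eq_or_ne (eLpNorm (⇑u) (ENNReal.ofReal Q) volume) 0 with h0 | h0
  · have : u = 0 := schwartz_eq_zero_of_eLpNorm_eq_zero (by simpa using hQ) h0
    have h1 : 𝓕 (⇑u) = 0 := by
      have : (𝓕 u : SchwartzMap V ℂ) = 0 := by rw [this, FourierTransform.fourier_zero]
      exact congrArg (fun g : SchwartzMap V ℂ => (⇑g : V → ℂ)) this
    simp [h1]
  have htop : eLpNorm (⇑u) (ENNReal.ofReal Q) volume ≠ ⊤ := (u.memLp _ _).eLpNorm_ne_top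
  set N := eLpNorm (⇑u) (ENNReal.ofReal Q) volume with hN
  have hNr : 0 < N.toReal := ENNReal.toReal_pos h0 htop
  set c : ℂ := ((N.toReal⁻¹ : ℝ) : ℂ) with hc
  have hce : ‖c‖ₑ = N⁻¹ := by
    rw [hc, ← ofReal_norm, Complex.norm_real, Real.norm_of_nonneg (by positivity),
      ENNReal.ofReal_inv_of_pos hNr, ENNReal.ofReal_toReal htop]
  have h1 : eLpNorm (⇑(c • u)) (ENNReal.ofReal Q) volume = 1 := by
    have : (⇑(c • u) : V → ℂ) = c • (⇑u) := rfl
    rw [this, eLpNorm_const_smul, hce, ← hN, ENNReal.inv_mul_cancel h0 htop]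
  have h2 := h (c • u) (by rw [← eLpNorm_ofReal_rpow _ hQ, h1, ENNReal.one_rpow])
  rw [← eLpNorm_ofReal_rpow _ hP0] at h2
  have h3 : 𝓕 (⇑(c • u)) = c • 𝓕 (⇑u) := by
    have : (𝓕 (c • u) : SchwartzMap V ℂ) = c • 𝓕 u := FourierTransform.fourier_smul _ _
    exact congrArg (fun g : SchwartzMap V ℂ => (⇑g : V → ℂ)) this
  rw [h3, eLpNorm_const_smul, hce, ← ENNReal.le_rpow_inv_iff hP0] at h2
  rwa [← ENNReal.div_eq_inv_mul, ENNReal.div_le_iff h0 htop] at h2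

lemma exponent_cases {p p' : ℝ≥0∞} (hp : 2 ≤ p) (hconj : 1 / p + 1 / p' = 1) :
    (p = ⊤ ∧ p' = 1) ∨ (p = 2 ∧ p' = 2) ∨ ∃ P Q : ℝ, P.HolderConjugate Q ∧ 2 < P ∧
      p = ENNReal.ofReal P ∧ p' = ENNReal.ofReal Q := by
  have key : ∀ q : ℝ≥0∞, 1 / p + 1 / q = 1 → p' = q := by
    intro q hq
    have hconj := hconj.trans hq.symm
    have hfin : 1 / p ≠ ⊤ := by
      simp only [one_div, ne_eq, ENNReal.inv_eq_top]
      rintro rfl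
      simp at hp
    have := (ENNReal.add_right_inj hfin).1 hconj
    simpa using this
  rcases eq_or_ne p ⊤ with h | h
  · left
    refine ⟨h, key _ ?_⟩
    simp [h]
  rcases eq_or_lt_of_le hp with h2 | h2
  · right; left
    refine ⟨h2.symm, key _ ?_⟩
    rw [← h2, one_div, ENNReal.inv_two_add_inv_two]
  · right; right
    have hP : 2 < p.toReal := by
      rw [← ENNReal.toReal_ofNat 2]
      exact (ENNReal.toReal_lt_toReal (by simp) h).2 h2
    have hc : p.toReal.HolderConjugate (p.toReal.conjExponent) :=
      Real.HolderConjugate.conjExponent (by linarith)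
    refine ⟨p.toReal, p.toReal.conjExponent, hc, hP, (ENNReal.ofReal_toReal h).symm, key _ ?_⟩
    have := hc.inv_add_inv_eq_one
    nth_rewrite 1 [← ENNReal.ofReal_toReal h]
    rw [one_div, one_div, ← ENNReal.ofReal_inv_of_pos hc.pos, ← ENNReal.ofReal_inv_of_pos hc.symm.pos,
      ← ENNReal.ofReal_add (inv_nonneg.2 hc.pos.le) (inv_nonneg.2 hc.symm.pos.le), this,
      ENNReal.ofReal_one]

/-- The Hausdorff–Young inequality (up to a constant) for Schwartz functions. -/
theorem exists_hausdorffYoung {p p' : ℝ≥0∞} (hp : 2 ≤ p) (hconj : 1 / p + 1 / p' = 1) :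
    ∃ C : ℝ≥0∞, C ≠ ⊤ ∧ ∀ f : SchwartzMap V ℂ,
      eLpNorm (⇑f) p volume ≤ C * eLpNorm (𝓕 (⇑f)) p' volume := by
  suffices h : ∃ C : ℝ≥0∞, C ≠ ⊤ ∧ ∀ u : SchwartzMap V ℂ,
      eLpNorm (𝓕 (⇑u)) p volume ≤ C * eLpNorm (⇑u) p' volume by
    obtain ⟨C, hC, h⟩ := h
    refine ⟨C, hC, fun f => ?_⟩
    have h1 := h (𝓕⁻ f)
    have h2 : 𝓕 (⇑(𝓕⁻ f : SchwartzMap V ℂ)) = f := by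
      have : (𝓕 (𝓕⁻ f : SchwartzMap V ℂ) : SchwartzMap V ℂ) = f :=
        FourierTransform.fourier_fourierInv_eq f
      exact congrArg (fun g : SchwartzMap V ℂ => (⇑g : V → ℂ)) this
    rwa [h2, eLpNorm_fourierInv] at h1
  rcases exponent_cases hp hconj with ⟨rfl, rfl⟩ | ⟨rfl, rfl⟩ | ⟨P, Q, hPQ, hP, rfl, rfl⟩
  · refine ⟨1, by simp, fun u => ?_⟩
    rw [one_mul, eLpNorm_exponent_top, eLpNorm_one_eq_lintegral_enorm]
    exact eLpNormEssSup_le_of_ae_enorm_bound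
      (Filter.Eventually.of_forall fun x => enorm_fourier_apply_le u x)
  · exact ⟨1, by simp, fun u => by rw [one_mul, eLpNorm_two_fourier]⟩
  · exact exists_hausdorffYoung_aux hPQ hP

end HausdorffYoung

section LowFrequency

variable {d : ℕ}

lemma eLpNorm_comp_smul {E : Type*} [NormedAddCommGroup E] (g : EuclideanSpace ℝ (Fin d) → E)
    (p : ℝ≥0∞) {r : ℝ} (hr : 0 < r) :
    eLpNorm (fun x => g (r • x)) p volume =
      ENNReal.ofReal (r ^ (-((d : ℝ) * (1 / p).toReal))) * eLpNorm g p volume := by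
  have hemb : MeasurableEmbedding (fun x : EuclideanSpace ℝ (Fin d) => r • x) :=
    (Homeomorph.smulOfNeZero r hr.ne').measurableEmbedding
  have h1 := hemb.eLpNorm_map_measure (g := g) (p := p) (μ := volume)
  have h2 : Measure.map (fun x : EuclideanSpace ℝ (Fin d) => r • x) volume =
      ENNReal.ofReal ((r ^ d)⁻¹) • volume := by
    have := Measure.map_addHaar_smul (volume : Measure (EuclideanSpace ℝ (Fin d))) hr.ne'
    rw [finrank_euclideanSpace_fin, abs_of_pos (by positivity)] at this
    exact this
  have h3 : ENNReal.ofReal ((r ^ d)⁻¹) ≠ 0 := by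
    simp only [ne_eq, ENNReal.ofReal_eq_zero, not_le]; positivity
  rw [h2, eLpNorm_smul_measure_of_ne_zero h3] at h1
  rw [show (fun x => g (r • x)) = g ∘ (fun x => r • x) from rfl, ← h1, smul_eq_mul]
  congr 1
  rw [ENNReal.ofReal_rpow_of_pos (by positivity)]
  congr 1
  rw [Real.rpow_neg hr.le, Real.rpow_mul hr.le, Real.rpow_natCast, Real.inv_rpow (by positivity)]

lemma exists_dilation (f : SchwartzMap (EuclideanSpace ℝ (Fin d)) ℂ) {r : ℝ} (hr : 0 < r) :
    ∃ g : SchwartzMap (EuclideanSpace ℝ (Fin d)) ℂ, (∀ x, g x = f (r⁻¹ • x)) ∧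
      ∀ ξ, 𝓕 (⇑g) ξ = (r ^ d : ℝ) • 𝓕 (⇑f) (r • ξ) := by
  refine ⟨SchwartzMap.compCLMOfContinuousLinearEquiv ℂ
    (ContinuousLinearEquiv.smulLeft (Units.mk0 r⁻¹ (inv_ne_zero hr.ne'))) f, fun x => rfl, fun ξ => ?_⟩
  rw [Real.fourier_eq, Real.fourier_eq]
  have := Measure.integral_comp_inv_smul_of_nonneg (volume : Measure (EuclideanSpace ℝ (Fin d)))
    (fun v => Real.fourierChar (-inner ℝ v (r • ξ)) • f v) hr.le
  rw [finrank_euclideanSpace_fin] at this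
  rw [← this]
  congr with v
  rw [inner_smul_left, inner_smul_right]
  simp only [conj_trivial]
  rw [← mul_assoc, inv_mul_cancel₀ hr.ne', one_mul]
  rfl

lemma enorm_convolution_apply_le {p p' : ℝ≥0∞} (hconj : 1 / p + 1 / p' = 1)
    (f g : SchwartzMap (EuclideanSpace ℝ (Fin d)) ℂ) {s : Set (EuclideanSpace ℝ (Fin d))}
    (hs : MeasurableSet s) {M : ℝ≥0∞} (hM : ∀ x, ‖g x‖ₑ ≤ M) (x : EuclideanSpace ℝ (Fin d)) :
    ‖SchwartzMap.convolution (ContinuousLinearMap.mul ℂ ℂ) f g x‖ₑ ≤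
      eLpNorm (⇑f) p volume * (M * volume s ^ (1 / p').toReal) +
        eLpNorm (⇑f) p (volume.restrict sᶜ) * eLpNorm (⇑g) p' volume := by
  have hpp : ENNReal.HolderTriple p p' 1 := ⟨by simpa using hconj⟩
  have hgm : Continuous fun t => g (x - t) := g.continuous.comp (by fun_prop)
  have key : ∀ μ : Measure (EuclideanSpace ℝ (Fin d)),
      ∫⁻ t, ‖f t * g (x - t)‖ₑ ∂μ ≤ eLpNorm (⇑f) p μ * eLpNorm (fun t => g (x - t)) p' μ := by
    intro μ
    rw [← eLpNorm_one_eq_lintegral_enorm]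
    exact eLpNorm_smul_le_mul_eLpNorm (φ := ⇑f) (f := fun t => g (x - t))
      hgm.aestronglyMeasurable f.continuous.aestronglyMeasurable
  rw [SchwartzMap.convolution_apply]
  calc _ ≤ ∫⁻ t, ‖f t * g (x - t)‖ₑ := enorm_integral_le_lintegral_enorm _
    _ = (∫⁻ t in s, ‖f t * g (x - t)‖ₑ) + ∫⁻ t in sᶜ, ‖f t * g (x - t)‖ₑ :=
        (lintegral_add_compl _ hs).symm
    _ ≤ _ := by
      gcongr
      · refine (key _).trans ?_
        gcongr
        · exact Measure.restrict_le_self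
        · refine (eLpNorm_le_of_ae_enorm_bound (C := M)
            (Filter.Eventually.of_forall fun t => hM _)).trans ?_
          simp [one_div]
      · refine (key _).trans ?_
        gcongr
        refine (eLpNorm_restrict_le _ _ _ _).trans ?_
        exact (eLpNorm_comp_measurePreserving (f := fun t => x - t) (μ := volume)
          g.continuous.aestronglyMeasurable (Measure.measurePreserving_sub_left volume x)).le

end LowFrequency

section Annihilation

variable {d : ℕ}

lemma eLpNorm_le_restrict_add_compl {α E : Type*} [MeasurableSpace α] {μ : Measure α}
    [NormedAddCommGroup E] {f : α → E} (hf : AEStronglyMeasurable f μ) {p : ℝ≥0∞} (hp : 1 ≤ p)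
    {s : Set α} (hs : MeasurableSet s) :
    eLpNorm f p μ ≤ eLpNorm f p (μ.restrict s) + eLpNorm f p (μ.restrict sᶜ) := by
  rw [← eLpNorm_indicator_eq_eLpNorm_restrict hs, ← eLpNorm_indicator_eq_eLpNorm_restrict hs.compl]
  conv_lhs => rw [← Set.indicator_self_add_compl s f]
  exact eLpNorm_add_le (hf.indicator hs) (hf.indicator hs.compl) hp

lemma volume_ball_eq {r : ℝ} (hr : 0 < r) (x : EuclideanSpace ℝ (Fin d)) :
    volume (Metric.ball x r) =
      ENNReal.ofReal r ^ (d : ℝ) * volume (Metric.ball (0 : EuclideanSpace ℝ (Fin d)) 1) := by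
  rw [Measure.addHaar_ball_of_pos _ _ hr, finrank_euclideanSpace_fin, ENNReal.ofReal_pow hr.le,
    ENNReal.rpow_natCast]

lemma exists_lowFrequency_kernel :
    ∃ φ : SchwartzMap (EuclideanSpace ℝ (Fin d)) ℂ,
      (∀ ξ, ‖ξ‖ < 1 → 𝓕 (⇑φ) ξ = 1) ∧ ∀ ξ, ‖1 - 𝓕 (⇑φ) ξ‖ ≤ 1 := by
  let b : ContDiffBump (0 : EuclideanSpace ℝ (Fin d)) := ⟨1, 2, one_pos, one_lt_two⟩
  have hb : ContDiff ℝ ((⊤ : ℕ∞) : WithTop ℕ∞) (fun x => ((b x : ℝ) : ℂ)) :=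
    Complex.ofRealCLM.contDiff.comp b.contDiff
  have hc : HasCompactSupport (fun x => ((b x : ℝ) : ℂ)) :=
    b.hasCompactSupport.comp_left (g := fun t : ℝ => (t : ℂ)) Complex.ofReal_zero
  let χ := hc.toSchwartzMap hb
  refine ⟨(𝓕⁻ χ : SchwartzMap _ ℂ), ?_⟩
  have h1 : 𝓕 (⇑(𝓕⁻ χ : SchwartzMap (EuclideanSpace ℝ (Fin d)) ℂ)) =
      fun x => ((b x : ℝ) : ℂ) := by
    have : (𝓕 (𝓕⁻ χ : SchwartzMap (EuclideanSpace ℝ (Fin d)) ℂ) : SchwartzMap _ ℂ) = χ :=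
      FourierTransform.fourier_fourierInv_eq _
    exact congrArg (fun g : SchwartzMap (EuclideanSpace ℝ (Fin d)) ℂ => (⇑g : _ → ℂ)) this
  rw [h1]
  refine ⟨fun ξ hξ => ?_, fun ξ => ?_⟩
  · simp only
    rw [b.one_of_mem_closedBall (by simpa [b] using hξ.le), Complex.ofReal_one]
  · rw [← Complex.ofReal_one, ← Complex.ofReal_sub, Complex.norm_real, Real.norm_eq_abs, abs_le]
    exact ⟨by linarith [b.le_one (x := ξ)], by linarith [b.nonneg (x := ξ)]⟩

lemma exists_lowFrequency_part {p p' : ℝ≥0∞} (hconj : 1 / p + 1 / p' = 1)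
    (φ f : SchwartzMap (EuclideanSpace ℝ (Fin d)) ℂ) {M : ℝ≥0∞} (hM : ∀ x, ‖φ x‖ₑ ≤ M)
    {κ r : ℝ} (hκ : 0 < κ) (hr : 0 < r) :
    ∃ h : SchwartzMap (EuclideanSpace ℝ (Fin d)) ℂ,
      (∀ ξ, 𝓕 (⇑h) ξ = 𝓕 (⇑f) ξ * 𝓕 (⇑φ) ((r / κ) • ξ)) ∧
      eLpNorm (⇑h) p (volume.restrict (Metric.ball 0 r)) ≤
        eLpNorm (⇑f) p volume * (ENNReal.ofReal κ ^ (d : ℝ) *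
            (M * volume (Metric.ball (0 : EuclideanSpace ℝ (Fin d)) 1))) +
          eLpNorm (⇑f) p (volume.restrict (Metric.ball 0 r)ᶜ) *
            (ENNReal.ofReal κ ^ ((d : ℝ) * (1 / p).toReal) * (eLpNorm (⇑φ) p' volume *
              volume (Metric.ball (0 : EuclideanSpace ℝ (Fin d)) 1) ^ (1 / p).toReal)) := by
  have hrk : 0 < r / κ := by positivity
  obtain ⟨ψ, hψ, hψF⟩ := exists_dilation φ hrk
  set c : ℝ := ((r / κ) ^ d)⁻¹ with hc
  have hcpos : 0 < c := by positivity
  set g : SchwartzMap (EuclideanSpace ℝ (Fin d)) ℂ := (c : ℂ) • ψ with hg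
  have hgF : ∀ ξ, 𝓕 (⇑g) ξ = 𝓕 (⇑φ) ((r / κ) • ξ) := by
    intro ξ
    have h3 : 𝓕 (⇑g) = (c : ℂ) • 𝓕 (⇑ψ) := by
      have : (𝓕 g : SchwartzMap (EuclideanSpace ℝ (Fin d)) ℂ) = (c : ℂ) • 𝓕 ψ :=
        FourierTransform.fourier_smul _ _
      exact congrArg (fun g : SchwartzMap (EuclideanSpace ℝ (Fin d)) ℂ => (⇑g : _ → ℂ)) this
    rw [h3, Pi.smul_apply, hψF, Complex.coe_smul, smul_smul, hc, inv_mul_cancel₀ (by positivity),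
      one_smul]
  have hce : ‖(c : ℂ)‖ₑ = ENNReal.ofReal κ ^ (d : ℝ) * ENNReal.ofReal r ^ (-(d : ℝ)) := by
    rw [← ofReal_norm, Complex.norm_real, Real.norm_of_nonneg hcpos.le, hc,
      ENNReal.ofReal_rpow_of_pos hκ, ENNReal.ofReal_rpow_of_pos hr, ← ENNReal.ofReal_mul (by positivity)]
    congr 1
    rw [Real.rpow_neg hr.le, Real.rpow_natCast, Real.rpow_natCast, div_pow]
    field_simp
  have hgM : ∀ x, ‖g x‖ₑ ≤ ENNReal.ofReal κ ^ (d : ℝ) * ENNReal.ofReal r ^ (-(d : ℝ)) * M := by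
    intro x
    have : g x = (c : ℂ) • ψ x := rfl
    rw [this, enorm_smul, hce, hψ]
    gcongr
    exact hM _
  have hsum : (1 / p).toReal + (1 / p').toReal = 1 := by
    have h1 : 1 / p ≠ ⊤ := ne_top_of_le_ne_top ENNReal.one_ne_top (le_self_add.trans_eq hconj)
    have h2 : 1 / p' ≠ ⊤ := ne_top_of_le_ne_top ENNReal.one_ne_top (le_add_self.trans_eq hconj)
    rw [← ENNReal.toReal_add h1 h2, hconj, ENNReal.toReal_one]
  have hgN : eLpNorm (⇑g) p' volume = ENNReal.ofReal κ ^ ((d : ℝ) * (1 / p).toReal) *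
      ENNReal.ofReal r ^ (-((d : ℝ) * (1 / p).toReal)) * eLpNorm (⇑φ) p' volume := by
    have h1 : (⇑g) = (c : ℂ) • fun x => φ ((r / κ)⁻¹ • x) := by
      funext x
      rw [Pi.smul_apply, ← hψ]; rfl
    rw [h1, eLpNorm_const_smul, eLpNorm_comp_smul _ _ (inv_pos.2 hrk), hce, ← mul_assoc]
    congr 1
    rw [ENNReal.ofReal_rpow_of_pos hκ, ENNReal.ofReal_rpow_of_pos hr, ENNReal.ofReal_rpow_of_pos hκ,
      ENNReal.ofReal_rpow_of_pos hr, ← ENNReal.ofReal_mul (by positivity),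
      ← ENNReal.ofReal_mul (by positivity), ← ENNReal.ofReal_mul (by positivity)]
    congr 1
    rw [inv_div, Real.div_rpow hκ.le hr.le, div_eq_mul_inv, ← Real.rpow_neg hr.le, neg_neg,
      mul_mul_mul_comm, ← Real.rpow_add hκ, ← Real.rpow_add hr]
    congr 2
    · linear_combination -(d : ℝ) * hsum
    · linear_combination (d : ℝ) * hsum
  refine ⟨SchwartzMap.convolution (ContinuousLinearMap.mul ℂ ℂ) f g, fun ξ => ?_, ?_⟩
  · rw [← hgF]
    have := SchwartzMap.fourier_convolution (ContinuousLinearMap.mul ℂ ℂ) f g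
    exact congrArg (fun g : SchwartzMap (EuclideanSpace ℝ (Fin d)) ℂ => g ξ) this
  · refine (eLpNorm_le_of_ae_enorm_bound (Filter.Eventually.of_forall fun x =>
      enorm_convolution_apply_le hconj f g (s := Metric.ball 0 r) measurableSet_ball hgM x)).trans ?_
    set v := volume (Metric.ball (0 : EuclideanSpace ℝ (Fin d)) 1) with hv
    have hv0 : v ≠ 0 := (Metric.measure_ball_pos _ _ one_pos).ne'
    have hvt : v ≠ ⊤ := measure_ball_lt_top.ne
    have hR0 : ENNReal.ofReal r ≠ 0 := by simpa using hr
    have hRt : ENNReal.ofReal r ≠ ⊤ := ENNReal.ofReal_ne_top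
    rw [Measure.restrict_apply_univ, smul_eq_mul, add_mul, volume_ball_eq hr, hgN, ← hv]
    have e1 : p.toReal⁻¹ = (1 / p).toReal := by rw [one_div, ENNReal.toReal_inv]
    rw [e1]
    have hvol : (ENNReal.ofReal r ^ (d : ℝ) * v) ^ (1 / p').toReal *
        (ENNReal.ofReal r ^ (d : ℝ) * v) ^ (1 / p).toReal = ENNReal.ofReal r ^ (d : ℝ) * v := by
      have : ENNReal.ofReal r ^ (d : ℝ) ≠ 0 := (ENNReal.rpow_pos (pos_iff_ne_zero.2 hR0) hRt).ne'
      rw [← ENNReal.rpow_add _ _ (by positivity) (by finiteness), add_comm, hsum, ENNReal.rpow_one]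
    have hcancel : ∀ s : ℝ, ENNReal.ofReal r ^ (-s) * ENNReal.ofReal r ^ s = 1 := by
      intro s
      rw [← ENNReal.rpow_add _ _ hR0 hRt, neg_add_cancel, ENNReal.rpow_zero]
    refine add_le_add (le_of_eq ?_) (le_of_eq ?_)
    · calc _ = eLpNorm (⇑f) p volume * (ENNReal.ofReal κ ^ (d : ℝ) * ENNReal.ofReal r ^ (-(d : ℝ)) * M *
            ((ENNReal.ofReal r ^ (d : ℝ) * v) ^ (1 / p').toReal *
              (ENNReal.ofReal r ^ (d : ℝ) * v) ^ (1 / p).toReal)) := by ring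
        _ = eLpNorm (⇑f) p volume * (ENNReal.ofReal κ ^ (d : ℝ) * (M * v)) *
            (ENNReal.ofReal r ^ (-(d : ℝ)) * ENNReal.ofReal r ^ (d : ℝ)) := by
          rw [hvol]; ring
        _ = _ := by rw [hcancel, mul_one]
    · rw [ENNReal.mul_rpow_of_nonneg _ _ ENNReal.toReal_nonneg, ← ENNReal.rpow_mul]
      calc _ = eLpNorm (⇑f) p (volume.restrict (Metric.ball 0 r)ᶜ) *
            (ENNReal.ofReal κ ^ ((d : ℝ) * (1 / p).toReal) * (eLpNorm (⇑φ) p' volume *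
              v ^ (1 / p).toReal)) * (ENNReal.ofReal r ^ (-((d : ℝ) * (1 / p).toReal)) *
                ENNReal.ofReal r ^ ((d : ℝ) * (1 / p).toReal)) := by ring
        _ = _ := by rw [hcancel, mul_one]

lemma one_le_of_two_le_conj {p p' : ℝ≥0∞} (hconj : 1 / p + 1 / p' = 1) : 1 ≤ p ∧ 1 ≤ p' := by
  have h1 : 1 / p ≤ 1 := le_self_add.trans_eq hconj
  have h2 : 1 / p' ≤ 1 := le_add_self.trans_eq hconj
  simpa using And.intro h1 h2

/-- A function is controlled by its part away from the origin together with the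
high-frequency part of its Fourier transform, at dual scales. -/
lemma exists_annihilation (hd : 1 ≤ d) {p p' : ℝ≥0∞} (hp : 2 ≤ p) (hconj : 1 / p + 1 / p' = 1) :
    ∃ κ : ℝ, 0 < κ ∧ ∃ C : ℝ≥0∞, C ≠ ⊤ ∧
      ∀ (f : SchwartzMap (EuclideanSpace ℝ (Fin d)) ℂ) (r : ℝ), 0 < r →
        eLpNorm (⇑f) p volume ≤ C * (eLpNorm (⇑f) p (volume.restrict (Metric.ball 0 r)ᶜ) +
          eLpNorm (𝓕 (⇑f)) p' (volume.restrict (Metric.ball 0 (κ / r))ᶜ)) := by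
  obtain ⟨φ, hφ1, hφ2⟩ := exists_lowFrequency_kernel (d := d)
  obtain ⟨C₀, hC₀, hHY⟩ := exists_hausdorffYoung (V := EuclideanSpace ℝ (Fin d)) hp hconj
  set M : ℝ≥0∞ := ENNReal.ofReal (SchwartzMap.seminorm ℝ 0 0 φ) with hMdef
  have hM : ∀ x, ‖φ x‖ₑ ≤ M := fun x => by
    rw [← ofReal_norm]
    exact ENNReal.ofReal_le_ofReal (SchwartzMap.norm_le_seminorm ℝ φ x)
  set v := volume (Metric.ball (0 : EuclideanSpace ℝ (Fin d)) 1) with hv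
  have hvt : v ≠ ⊤ := measure_ball_lt_top.ne
  have hMv : M * v ≠ ⊤ := ENNReal.mul_ne_top ENNReal.ofReal_ne_top hvt
  obtain ⟨κ, hκ, hκs⟩ : ∃ κ : ℝ, 0 < κ ∧ ENNReal.ofReal κ ^ (d : ℝ) * (M * v) ≤ 1 / 2 := by
    have hpos : 0 < (2 * ((M * v).toReal + 1))⁻¹ := by positivity
    refine ⟨_, hpos, ?_⟩
    have hle : ENNReal.ofReal (2 * ((M * v).toReal + 1))⁻¹ ^ (d : ℝ) ≤
        ENNReal.ofReal (2 * ((M * v).toReal + 1))⁻¹ := by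
      refine ENNReal.rpow_le_self_of_le_one ?_ (by exact_mod_cast hd)
      rw [ENNReal.ofReal_le_one]
      refine inv_le_one_of_one_le₀ ?_
      linarith [ENNReal.toReal_nonneg (a := M * v)]
    refine (mul_le_mul_left hle _).trans ?_
    nth_rewrite 2 [← ENNReal.ofReal_toReal hMv]
    rw [← ENNReal.ofReal_mul hpos.le, show (1 / 2 : ℝ≥0∞) = ENNReal.ofReal (1 / 2) by
      rw [ENNReal.ofReal_div_of_pos two_pos, ENNReal.ofReal_one, ENNReal.ofReal_ofNat]]
    refine ENNReal.ofReal_le_ofReal ?_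
    rw [inv_mul_le_iff₀ (by positivity)]
    linarith
  set D : ℝ≥0∞ := ENNReal.ofReal κ ^ ((d : ℝ) * (1 / p).toReal) * (eLpNorm (⇑φ) p' volume *
    v ^ (1 / p).toReal) with hD
  have hDt : D ≠ ⊤ := by
    have := (φ.memLp p' volume).eLpNorm_ne_top
    have h0 : (0 : ℝ) ≤ (1 / p).toReal := ENNReal.toReal_nonneg
    rw [hD]; finiteness
  have hp1 := one_le_of_two_le_conj hconj
  refine ⟨κ, hκ, 2 * (C₀ + D + 1), by finiteness, fun f r hr => ?_⟩
  obtain ⟨h, hF, hN⟩ := exists_lowFrequency_part hconj φ f hM hκ hr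
  rw [← hv, ← hD] at hN
  set F := eLpNorm (⇑f) p volume with hFdef
  set X := eLpNorm (⇑f) p (volume.restrict (Metric.ball 0 r)ᶜ) with hX
  set G := eLpNorm (𝓕 (⇑f)) p' (volume.restrict (Metric.ball 0 (κ / r))ᶜ) with hG
  have hFt : F ≠ ⊤ := (f.memLp p volume).eLpNorm_ne_top
  have hdiffF : ∀ ξ, 𝓕 (⇑(f - h)) ξ = 𝓕 (⇑f) ξ * (1 - 𝓕 (⇑φ) ((r / κ) • ξ)) := by
    intro ξ
    have : (𝓕 (f - h) : SchwartzMap (EuclideanSpace ℝ (Fin d)) ℂ) = 𝓕 f - 𝓕 h := by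
      rw [eq_sub_iff_add_eq, ← FourierTransform.fourier_add, sub_add_cancel]
    have := congrArg (fun g : SchwartzMap (EuclideanSpace ℝ (Fin d)) ℂ => g ξ) this
    have h2 : 𝓕 (⇑(f - h)) ξ = 𝓕 (⇑f) ξ - 𝓕 (⇑h) ξ := this
    rw [h2, hF]; ring
  have hdiff : eLpNorm (⇑(f - h)) p volume ≤ C₀ * G := by
    refine (hHY _).trans ?_
    gcongr
    rw [hG, ← eLpNorm_indicator_eq_eLpNorm_restrict measurableSet_ball.compl]
    refine eLpNorm_mono fun ξ => ?_
    rw [hdiffF]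
    by_cases hξ : ξ ∈ (Metric.ball (0 : EuclideanSpace ℝ (Fin d)) (κ / r))ᶜ
    · rw [Set.indicator_of_mem hξ, norm_mul]
      exact mul_le_of_le_one_right (norm_nonneg _) (hφ2 _)
    · rw [Set.indicator_of_notMem hξ]
      have : ‖ξ‖ < κ / r := by simpa using hξ
      rw [hφ1, sub_self, mul_zero]
      rw [norm_smul, Real.norm_of_nonneg (by positivity)]
      calc r / κ * ‖ξ‖ < r / κ * (κ / r) := by gcongr
        _ = 1 := by field_simp
  have hball : eLpNorm (⇑f) p (volume.restrict (Metric.ball 0 r)) ≤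
      C₀ * G + (F * (1 / 2) + X * D) := by
    have : (⇑f) = (⇑(f - h)) + ⇑h := by
      funext x
      simp
    rw [this]
    refine (eLpNorm_add_le (f - h).continuous.aestronglyMeasurable
      h.continuous.aestronglyMeasurable hp1.1).trans ?_
    refine add_le_add ((eLpNorm_restrict_le _ _ _ _).trans hdiff) (hN.trans ?_)
    gcongr
  have hfin : F ≤ C₀ * G + (F / 2 + X * D) + X := by
    refine (eLpNorm_le_restrict_add_compl f.continuous.aestronglyMeasurable hp1.1
      measurableSet_ball).trans (add_le_add (hball.trans ?_) le_rfl)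
    rw [mul_one_div]
  have h1 : F - F / 2 ≤ C₀ * G + X * D + X := by
    rw [tsub_le_iff_right]
    refine hfin.trans (le_of_eq ?_)
    ring
  rw [ENNReal.sub_half hFt] at h1
  calc F = 2 * (F / 2) := by rw [ENNReal.mul_div_cancel (by simp) (by simp)]
    _ ≤ 2 * (C₀ * G + X * D + X) := by gcongr
    _ ≤ 2 * (C₀ * G + X * D + X + (C₀ * X + D * G + G)) := mul_le_mul_right le_self_add _
    _ = _ := by ring

end Annihilation

section BrokenPower

/-- The radial profile of `brokenWeight`. -/
noncomputable def brokenPower (A : ℝ × ℝ) (s : ℝ) : ℝ :=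
  if s < 1 then s ^ A.1 else s ^ A.2

lemma brokenWeight_eq {d : ℕ} (A : ℝ × ℝ) (x : EuclideanSpace ℝ (Fin d)) :
    brokenWeight A x = brokenPower A ‖x‖ := rfl

variable {A B : ℝ × ℝ}

lemma brokenPower_of_le_one {s : ℝ} (hs : s ≤ 1) : brokenPower A s = s ^ A.1 := by
  unfold brokenPower
  split_ifs with h
  · rfl
  · rw [le_antisymm hs (not_lt.1 h), Real.one_rpow, Real.one_rpow]

lemma brokenPower_of_one_le {s : ℝ} (hs : 1 ≤ s) : brokenPower A s = s ^ A.2 := by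
  unfold brokenPower
  rw [if_neg (not_lt.2 hs)]

lemma brokenPower_nonneg {s : ℝ} (hs : 0 ≤ s) : 0 ≤ brokenPower A s := by
  unfold brokenPower
  split_ifs <;> positivity

lemma brokenPower_pos {s : ℝ} (hs : 0 < s) : 0 < brokenPower A s := by
  unfold brokenPower
  split_ifs <;> positivity

lemma brokenPower_mono (hA1 : 0 < A.1) (hA2 : 0 < A.2) {s t : ℝ} (hs : 0 ≤ s) (hst : s ≤ t) :
    brokenPower A s ≤ brokenPower A t := by
  rcases le_total t 1 with ht | ht
  · rw [brokenPower_of_le_one ht, brokenPower_of_le_one (hst.trans ht)]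
    exact Real.rpow_le_rpow hs hst hA1.le
  rw [brokenPower_of_one_le ht]
  rcases le_total s 1 with h | h
  · rw [brokenPower_of_le_one h]
    exact (Real.rpow_le_one hs h hA1.le).trans (Real.one_le_rpow ht hA2.le)
  · rw [brokenPower_of_one_le h]
    exact Real.rpow_le_rpow hs hst hA2.le

lemma exists_brokenPower_eq (hA1 : 0 < A.1) (hA2 : 0 < A.2) {t : ℝ} (ht : 0 < t) :
    ∃ s : ℝ, 0 < s ∧ brokenPower A s = t := by
  rcases le_total t 1 with h | h
  · refine ⟨t ^ A.1⁻¹, by positivity, ?_⟩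
    rw [brokenPower_of_le_one (Real.rpow_le_one ht.le h (by positivity)),
      Real.rpow_inv_rpow ht.le hA1.ne']
  · refine ⟨t ^ A.2⁻¹, by positivity, ?_⟩
    rw [brokenPower_of_one_le (Real.one_le_rpow h (by positivity)),
      Real.rpow_inv_rpow ht.le hA2.ne']

lemma brokenPower_mul_le_of_le_one {r y : ℝ} (hr : 0 < r)
    (hr1 : r ≤ 1) (hy : 0 ≤ y) : brokenPower A (r * y) ≤ r ^ A.1 * (y ^ A.1 + y ^ A.2) := by
  rcases le_total (r * y) 1 with h | h
  · rw [brokenPower_of_le_one h, Real.mul_rpow hr.le hy]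
    gcongr
    have : 0 ≤ y ^ A.2 := by positivity
    linarith
  · have hy1 : 1 ≤ y := h.trans (mul_le_of_le_one_left hy hr1)
    rw [brokenPower_of_one_le h]
    have h0 : (0 : ℝ) ≤ y ^ A.2 := by positivity
    have h0' : (0 : ℝ) ≤ y ^ A.1 := by positivity
    rcases le_total A.1 A.2 with h12 | h12
    · rw [Real.mul_rpow hr.le hy]
      have := Real.rpow_le_rpow_of_exponent_ge hr hr1 h12
      have h1 : (0 : ℝ) ≤ r ^ A.2 := by positivity
      gcongr
      linarith
    · refine (Real.rpow_le_rpow_of_exponent_le h h12).trans ?_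
      rw [Real.mul_rpow hr.le hy]
      gcongr
      linarith

lemma brokenPower_mul_le_of_one_le (hA1 : 0 < A.1) {r y : ℝ}
    (hr1 : 1 ≤ r) (hy : 0 ≤ y) : brokenPower A (r * y) ≤ r ^ A.2 * (y ^ A.1 + y ^ A.2) := by
  have hr : 0 < r := by linarith
  have h0 : (0 : ℝ) ≤ y ^ A.2 := by positivity
  have h0' : (0 : ℝ) ≤ y ^ A.1 := by positivity
  rcases le_total 1 (r * y) with h | h
  · rw [brokenPower_of_one_le h, Real.mul_rpow hr.le hy]
    gcongr
    linarith
  · rw [brokenPower_of_le_one h]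
    rcases le_total A.1 A.2 with h12 | h12
    · rw [Real.mul_rpow hr.le hy]
      have := Real.rpow_le_rpow_of_exponent_le hr1 h12
      gcongr
      linarith
    · rcases hy.eq_or_lt with rfl | hy0
      · rw [mul_zero, Real.zero_rpow hA1.ne']; positivity
      refine (Real.rpow_le_rpow_of_exponent_ge (by positivity) h h12).trans ?_
      rw [Real.mul_rpow hr.le hy]
      gcongr
      linarith

/-- Doubling property of broken powers. -/
lemma brokenPower_dilate_le (hA1 : 0 < A.1) (hA2 : 0 < A.2) {l s : ℝ} (hl : 1 ≤ l) (hs : 0 ≤ s) :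
    brokenPower A (l * s) ≤ l ^ (A.1 + A.2) * brokenPower A s := by
  have hl0 : 0 < l := by linarith
  have e1 : l ^ A.1 ≤ l ^ (A.1 + A.2) := Real.rpow_le_rpow_of_exponent_le hl (by linarith)
  have e2 : l ^ A.2 ≤ l ^ (A.1 + A.2) := Real.rpow_le_rpow_of_exponent_le hl (by linarith)
  rcases le_total (l * s) 1 with h | h
  · have hs1 : s ≤ 1 := (le_mul_of_one_le_left hs hl).trans h
    rw [brokenPower_of_le_one h, brokenPower_of_le_one hs1, Real.mul_rpow hl0.le hs]
    gcongr
  rw [brokenPower_of_one_le h]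
  rcases le_total 1 s with hs1 | hs1
  · rw [brokenPower_of_one_le hs1, Real.mul_rpow hl0.le hs]
    gcongr
  · have hs0 : 0 < s := by
      rcases hs.eq_or_lt with rfl | h'
      · rw [mul_zero] at h; linarith
      · exact h'
    rw [brokenPower_of_le_one hs1]
    calc (l * s) ^ A.2 ≤ (l * s) ^ A.2 * (l * s) ^ A.1 :=
          le_mul_of_one_le_right (by positivity) (Real.one_le_rpow h hA1.le)
      _ = l ^ (A.1 + A.2) * s ^ A.1 * s ^ A.2 := by
          rw [Real.mul_rpow hl0.le hs, Real.mul_rpow hl0.le hs, Real.rpow_add hl0]; ring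
      _ ≤ l ^ (A.1 + A.2) * s ^ A.1 * 1 := by
          gcongr
          exact Real.rpow_le_one hs hs1 hA2.le
      _ = _ := mul_one _

lemma one_le_brokenPower_mul {δ α K : ℝ} (hB1 : 0 < B.1) (hB2 : 0 < B.2)
    (hδ : 0 ≤ δ) (hα : 0 ≤ α) (h12 : A.1 ≤ B.2) (h21 : B.1 ≤ A.2)
    (hα' : A.1 * (B.2 + δ) ≤ B.2 * (α + B.2)) (hK : 1 ≤ K) {r S : ℝ} (hr : 0 < r) (hS : 0 < S)
    (h : brokenPower B r⁻¹ ≤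
      K * brokenPower B S * S ^ δ * (if r ≤ 1 then r ^ α else r ^ δ)) :
    1 ≤ K * (brokenPower A r * brokenPower B S) := by
  have hK0 : 0 < K := by linarith
  have hwS := brokenPower_pos (A := B) hS
  rcases le_or_gt r 1 with hr1 | hr1
  · have hri : 1 ≤ r⁻¹ := (one_le_inv₀ hr).2 hr1
    rw [if_pos hr1, brokenPower_of_one_le hri, Real.inv_rpow hr.le] at h
    rw [brokenPower_of_le_one hr1]
    have hrB : 0 < r ^ B.2 := by positivity
    rw [inv_le_iff_one_le_mul₀ hrB] at h
    have hrAB : r ^ B.2 ≤ r ^ A.1 := Real.rpow_le_rpow_of_exponent_ge hr hr1 h12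
    rcases le_total S 1 with hS1 | hS1
    · refine h.trans ?_
      have h1 : S ^ δ ≤ 1 := Real.rpow_le_one hS.le hS1 hδ
      have h2 : r ^ α ≤ 1 := Real.rpow_le_one hr.le hr1 hα
      calc K * brokenPower B S * S ^ δ * r ^ α * r ^ B.2
          ≤ K * brokenPower B S * 1 * 1 * r ^ A.1 := by gcongr
        _ = _ := by ring
    · rw [brokenPower_of_one_le hS1] at h ⊢
      have e : K * S ^ B.2 * S ^ δ * r ^ α * r ^ B.2 = K * (S ^ (B.2 + δ) * r ^ (α + B.2)) := by
        rw [Real.rpow_add hS, Real.rpow_add hr]; ring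
      rw [e] at h
      have hθ0 : 0 < B.2 + δ := by linarith
      have hθ : 0 < B.2 / (B.2 + δ) := by positivity
      have hθ1 : B.2 / (B.2 + δ) ≤ 1 := (div_le_one hθ0).2 (by linarith)
      have h3 : 1 ≤ (K * (S ^ (B.2 + δ) * r ^ (α + B.2))) ^ (B.2 / (B.2 + δ)) :=
        Real.one_le_rpow h hθ.le
      refine h3.trans ?_
      rw [Real.mul_rpow hK0.le (by positivity), Real.mul_rpow (by positivity) (by positivity),
        ← Real.rpow_mul hS.le, ← Real.rpow_mul hr.le, mul_div_cancel₀ _ hθ0.ne']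
      have h4 : K ^ (B.2 / (B.2 + δ)) ≤ K := by
        calc K ^ (B.2 / (B.2 + δ)) ≤ K ^ (1 : ℝ) := Real.rpow_le_rpow_of_exponent_le hK hθ1
          _ = K := Real.rpow_one K
      have h5 : r ^ ((α + B.2) * (B.2 / (B.2 + δ))) ≤ r ^ A.1 := by
        refine Real.rpow_le_rpow_of_exponent_ge hr hr1 ?_
        rw [mul_div_assoc', le_div_iff₀ hθ0]
        linarith
      rw [mul_comm (S ^ B.2)]
      exact mul_le_mul h4 (mul_le_mul_of_nonneg_right h5 (by positivity)) (by positivity) hK0.le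
  · have hri : r⁻¹ ≤ 1 := (inv_le_one₀ hr).2 hr1.le
    rw [if_neg (not_le.2 hr1), brokenPower_of_le_one hri, Real.inv_rpow hr.le] at h
    rw [brokenPower_of_one_le hr1.le]
    have hrAB : r ^ B.1 ≤ r ^ A.2 := Real.rpow_le_rpow_of_exponent_le hr1.le h21
    have hrB : 0 < r ^ B.1 := by positivity
    rcases le_total (r * S) 1 with hS1 | hS1
    · rw [inv_le_iff_one_le_mul₀ hrB] at h
      refine h.trans ?_
      calc K * brokenPower B S * S ^ δ * r ^ δ * r ^ B.1
          = K * (r ^ B.1 * brokenPower B S) * (r * S) ^ δ := by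
            rw [Real.mul_rpow hr.le hS.le]; ring
        _ ≤ K * (r ^ A.2 * brokenPower B S) * 1 := by
            gcongr
            exact Real.rpow_le_one (by positivity) hS1 hδ
        _ = _ := mul_one _
    · have hS2 : r⁻¹ ≤ S := (inv_le_iff_one_le_mul₀ hr).2 (by linarith)
      have h4 := brokenPower_mono hB1 hB2 (by positivity) hS2
      rw [brokenPower_of_le_one hri, Real.inv_rpow hr.le] at h4
      calc (1 : ℝ) = r ^ B.1 * (r ^ B.1)⁻¹ := (mul_inv_cancel₀ hrB.ne').symm
        _ ≤ r ^ A.2 * brokenPower B S := by gcongr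
        _ ≤ K * (r ^ A.2 * brokenPower B S) := le_mul_of_one_le_left (by positivity) hK

end BrokenPower

section Dyadic

variable {d : ℕ}

lemma brokenPower_mul_eLpNorm_tail_le {A : ℝ × ℝ} (hA1 : 0 < A.1) (hA2 : 0 < A.2)
    (g : EuclideanSpace ℝ (Fin d) → ℂ) (p : ℝ≥0∞) {r : ℝ} (hr : 0 ≤ r) :
    ENNReal.ofReal (brokenPower A r) * eLpNorm g p (volume.restrict (Metric.ball 0 r)ᶜ) ≤
      eLpNorm (fun x => brokenWeight A x * ‖g x‖) p volume := by
  have h1 : ENNReal.ofReal (brokenPower A r) = ‖((brokenPower A r : ℝ) : ℂ)‖ₑ := by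
    rw [← ofReal_norm, Complex.norm_real, Real.norm_of_nonneg (brokenPower_nonneg hr)]
  rw [h1, ← eLpNorm_const_smul]
  refine le_trans (eLpNorm_mono_ae ?_) (eLpNorm_restrict_le _ _ _ (Metric.ball 0 r)ᶜ)
  refine (ae_restrict_mem measurableSet_ball.compl).mono fun x hx => ?_
  have hx' : r ≤ ‖x‖ := by simpa using hx
  rw [Pi.smul_apply, norm_smul, norm_mul, norm_norm, Complex.norm_real, brokenWeight_eq,
    Real.norm_of_nonneg (brokenPower_nonneg hr), Real.norm_of_nonneg (brokenPower_nonneg (norm_nonneg _))]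
  gcongr
  exact brokenPower_mono hA1 hA2 hr hx'

lemma eLpNorm_restrict_le_of_subset_ball {q₁ q₂ : ℝ≥0∞} (h : q₁ ≤ q₂)
    (h0 : 0 ≤ (1 / q₁).toReal - (1 / q₂).toReal)
    {g : EuclideanSpace ℝ (Fin d) → ℂ} (hg : Continuous g) {S : ℝ} (hS : 0 < S)
    {s : Set (EuclideanSpace ℝ (Fin d))} (hs : s ⊆ Metric.ball 0 S) :
    eLpNorm g q₁ (volume.restrict s) ≤ eLpNorm g q₂ (volume.restrict s) *
      (ENNReal.ofReal (S ^ ((d : ℝ) * ((1 / q₁).toReal - (1 / q₂).toReal))) *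
        volume (Metric.ball (0 : EuclideanSpace ℝ (Fin d)) 1) ^
          ((1 / q₁).toReal - (1 / q₂).toReal)) := by
  refine (eLpNorm_le_eLpNorm_mul_rpow_measure_univ h hg.aestronglyMeasurable).trans ?_
  have e : 1 / q₁.toReal - 1 / q₂.toReal = (1 / q₁).toReal - (1 / q₂).toReal := by
    simp [ENNReal.toReal_inv]
  rw [e, Measure.restrict_apply_univ]
  refine mul_le_mul_right ((ENNReal.rpow_le_rpow (measure_mono hs) h0).trans (le_of_eq ?_)) _
  rw [volume_ball_eq hS, ENNReal.mul_rpow_of_nonneg _ _ h0, ← ENNReal.rpow_mul,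
    ENNReal.ofReal_rpow_of_pos hS]

lemma half_sub_nonneg {p : ℝ≥0∞} (hp : 2 ≤ p) : 0 ≤ 1 / 2 - (1 / p).toReal := by
  have : (1 / p).toReal ≤ (1 / 2 : ℝ≥0∞).toReal :=
    ENNReal.toReal_mono (by simp) (by gcongr)
  simpa using this

lemma eLpNorm_two_le_dyadic {A : ℝ × ℝ} (hA1 : 0 < A.1) (hA2 : 0 < A.2) {p : ℝ≥0∞} (hp : 2 ≤ p) :
    ∃ C : ℝ≥0∞, C ≠ ⊤ ∧ ∀ (f : SchwartzMap (EuclideanSpace ℝ (Fin d)) ℂ) (r : ℝ) (D : ℝ), 0 < r →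
      (∀ n : ℕ, ∑ k ∈ Finset.range n, (2 ^ k * r) ^ ((d : ℝ) * (1 / 2 - (1 / p).toReal)) /
        brokenPower A (2 ^ k * r) ≤ D) →
      eLpNorm (⇑f) 2 volume ≤ C *
        (ENNReal.ofReal (r ^ ((d : ℝ) * (1 / 2 - (1 / p).toReal))) * eLpNorm (⇑f) p volume +
          ENNReal.ofReal D * eLpNorm (fun x => brokenWeight A x * ‖f x‖) p volume) := by
  set θ := 1 / 2 - (1 / p).toReal with hθ
  have hθ0 : 0 ≤ θ := half_sub_nonneg hp
  have hθe : (1 / (2 : ℝ≥0∞)).toReal - (1 / p).toReal = θ := by simp [hθ]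
  set δ := (d : ℝ) * θ with hδ
  have hδ0 : 0 ≤ δ := by positivity
  set V := volume (Metric.ball (0 : EuclideanSpace ℝ (Fin d)) 1) ^ θ with hV
  have hVt : V ≠ ⊤ := ENNReal.rpow_ne_top_of_nonneg hθ0 measure_ball_lt_top.ne
  refine ⟨V * ENNReal.ofReal (2 ^ δ), by finiteness, fun f r D hr hD => ?_⟩
  set X := eLpNorm (fun x => brokenWeight A x * ‖f x‖) p volume with hX
  set F := eLpNorm (⇑f) p volume with hF
  have hball : ∀ (S : ℝ) (s : Set (EuclideanSpace ℝ (Fin d))), 0 < S → s ⊆ Metric.ball 0 S →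
      eLpNorm (⇑f) 2 (volume.restrict s) ≤
        eLpNorm (⇑f) p (volume.restrict s) * (ENNReal.ofReal (S ^ δ) * V) := by
    intro S s hS hs
    have := eLpNorm_restrict_le_of_subset_ball hp (by rw [hθe]; exact hθ0) f.continuous hS hs
    rwa [hθe] at this
  have hshell : ∀ k : ℕ, eLpNorm (⇑f) 2
      (volume.restrict (Metric.ball 0 (2 ^ (k + 1) * r) \ Metric.ball 0 (2 ^ k * r))) ≤
        V * ENNReal.ofReal (2 ^ δ) * (ENNReal.ofReal ((2 ^ k * r) ^ δ / brokenPower A (2 ^ k * r)) * X) := by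
    intro k
    have hs : 0 < 2 ^ k * r := by positivity
    have hw := brokenPower_pos (A := A) hs
    refine (hball _ _ (by positivity) Set.sdiff_subset).trans ?_
    have h1 := brokenPower_mul_eLpNorm_tail_le hA1 hA2 (⇑f) p hs.le
    rw [← hX, mul_comm, ← ENNReal.le_div_iff_mul_le (Or.inl (by simpa using hw))
      (Or.inl ENNReal.ofReal_ne_top)] at h1
    have h2 : eLpNorm (⇑f) p (volume.restrict
        (Metric.ball 0 (2 ^ (k + 1) * r) \ Metric.ball 0 (2 ^ k * r))) ≤
        X / ENNReal.ofReal (brokenPower A (2 ^ k * r)) :=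
      (eLpNorm_mono_measure _ (Measure.restrict_mono (fun x hx => hx.2) le_rfl)).trans h1
    refine (mul_le_mul_left h2 _).trans (le_of_eq ?_)
    rw [pow_succ, mul_right_comm, mul_comm _ (2 : ℝ), Real.mul_rpow two_pos.le hs.le,
      ENNReal.ofReal_mul (by positivity), ENNReal.ofReal_div_of_pos hw, div_eq_mul_inv, div_eq_mul_inv]
    ring
  have hn : ∀ n : ℕ, eLpNorm (⇑f) 2 (volume.restrict (Metric.ball 0 (2 ^ n * r))) ≤
      V * ENNReal.ofReal (2 ^ δ) * (ENNReal.ofReal (r ^ δ) * F + ENNReal.ofReal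
        (∑ k ∈ Finset.range n, (2 ^ k * r) ^ δ / brokenPower A (2 ^ k * r)) * X) := by
    intro n
    induction n with
    | zero =>
      simp only [pow_zero, one_mul, Finset.range_zero, Finset.sum_empty, ENNReal.ofReal_zero,
        zero_mul, add_zero]
      refine (hball r _ hr subset_rfl).trans ?_
      have h2 : (1 : ℝ≥0∞) ≤ ENNReal.ofReal (2 ^ δ) := by
        rw [ENNReal.one_le_ofReal]
        exact Real.one_le_rpow one_le_two hδ0
      calc _ ≤ F * (ENNReal.ofReal (r ^ δ) * V) * 1 := by
            rw [mul_one]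
            exact mul_le_mul_left (eLpNorm_restrict_le _ _ _ _) _
        _ ≤ F * (ENNReal.ofReal (r ^ δ) * V) * ENNReal.ofReal (2 ^ δ) := by gcongr
        _ = _ := by ring
    | succ n ih =>
      have hsub : Metric.ball (0 : EuclideanSpace ℝ (Fin d)) (2 ^ n * r) ⊆
          Metric.ball 0 (2 ^ (n + 1) * r) := by
        refine Metric.ball_subset_ball ?_
        rw [pow_succ]
        have : 0 < 2 ^ n * r := by positivity
        nlinarith
      have h1 := eLpNorm_le_restrict_add_compl (μ := volume.restrict (Metric.ball 0 (2 ^ (n + 1) * r)))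
        f.continuous.aestronglyMeasurable (p := 2) one_le_two
        (s := Metric.ball (0 : EuclideanSpace ℝ (Fin d)) (2 ^ n * r)) measurableSet_ball
      rw [Measure.restrict_restrict measurableSet_ball, Set.inter_eq_left.2 hsub,
        Measure.restrict_restrict measurableSet_ball.compl, Set.inter_comm, ← Set.sdiff_eq] at h1
      refine h1.trans ((add_le_add ih (hshell n)).trans (le_of_eq ?_))
      rw [Finset.sum_range_succ, ENNReal.ofReal_add]
      · ring
      · refine Finset.sum_nonneg fun k _ => ?_
        have := brokenPower_pos (A := A) (s := 2 ^ k * r) (by positivity)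
        positivity
      · have := brokenPower_pos (A := A) (s := 2 ^ n * r) (by positivity)
        positivity
  have hlim := Lp.eLpNorm_lim_le_liminf_eLpNorm (p := 2) (μ := volume)
    (f := fun n : ℕ => (Metric.ball (0 : EuclideanSpace ℝ (Fin d)) (2 ^ n * r)).indicator ⇑f)
    (fun n => f.continuous.aestronglyMeasurable.indicator measurableSet_ball) (⇑f)
    (Filter.Eventually.of_forall fun x => by
      have hpow : Filter.Tendsto (fun n : ℕ => (2 : ℝ) ^ n * r) Filter.atTop Filter.atTop :=
        (tendsto_pow_atTop_atTop_of_one_lt one_lt_two).atTop_mul_const hr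
      refine tendsto_const_nhds.congr' ?_
      filter_upwards [hpow.eventually_gt_atTop ‖x‖] with n hn
      rw [Set.indicator_of_mem (by simpa using hn)])
  refine hlim.trans (Filter.liminf_le_of_frequently_le' (Filter.Frequently.of_forall fun n => ?_))
  rw [eLpNorm_indicator_eq_eLpNorm_restrict measurableSet_ball]
  refine (hn n).trans ?_
  gcongr
  exact hD n

end Dyadic

section DyadicSums

variable {A B : ℝ × ℝ} {δ : ℝ}

lemma sum_range_geometric_le {q : ℝ} (h0 : 0 ≤ q) (h1 : q < 1) (n : ℕ) :
    ∑ k ∈ Finset.range n, q ^ k ≤ (1 - q)⁻¹ := by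
  rw [← tsum_geometric_of_lt_one h0 h1]
  exact (summable_geometric_of_lt_one h0 h1).sum_le_tsum _ fun k _ => pow_nonneg h0 k

lemma two_pow_mul_rpow {r : ℝ} (hr : 0 < r) (η : ℝ) (k : ℕ) :
    (2 ^ k * r) ^ (-η) = r ^ (-η) * ((2 : ℝ) ^ (-η)) ^ k := by
  rw [Real.mul_rpow (by positivity) hr.le, mul_comm, ← Real.rpow_natCast, ← Real.rpow_natCast,
    ← Real.rpow_mul two_pos.le, ← Real.rpow_mul two_pos.le, mul_comm (k : ℝ)]

lemma sum_le_of_le_rpow_neg {φ : ℝ → ℝ} {η c : ℝ} (hη : 0 < η) {r : ℝ} (hc : 0 ≤ c)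
    (h : ∀ k : ℕ, φ (2 ^ k * r) ≤ c * ((2 : ℝ) ^ (-η)) ^ k) (n : ℕ) :
    ∑ k ∈ Finset.range n, φ (2 ^ k * r) ≤ (1 - (2 : ℝ) ^ (-η))⁻¹ * c := by
  refine (Finset.sum_le_sum fun k _ => h k).trans ?_
  rw [← Finset.mul_sum, mul_comm]
  gcongr
  exact sum_range_geometric_le (by positivity)
    (Real.rpow_lt_one_of_one_lt_of_neg one_lt_two (by linarith)) n

lemma exists_dyadic_sum_le_of_one_le (hA2 : δ < A.2) :
    ∃ C : ℝ, 0 < C ∧ ∀ r : ℝ, 1 ≤ r → ∀ n : ℕ, ∑ k ∈ Finset.range n,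
      (2 ^ k * r) ^ δ / brokenPower A (2 ^ k * r) ≤ C * (r ^ δ / brokenPower A r) := by
  have hη : 0 < A.2 - δ := by linarith
  have hq : (2 : ℝ) ^ (-(A.2 - δ)) < 1 :=
    Real.rpow_lt_one_of_one_lt_of_neg one_lt_two (by linarith)
  refine ⟨(1 - (2 : ℝ) ^ (-(A.2 - δ)))⁻¹, inv_pos.2 (by linarith), fun r hr n => ?_⟩
  have hr0 : 0 < r := by linarith
  have e : ∀ s : ℝ, 1 ≤ s → s ^ δ / brokenPower A s = s ^ (-(A.2 - δ)) := by
    intro s hs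
    rw [brokenPower_of_one_le hs, ← Real.rpow_sub (by linarith)]
    congr 1; ring
  have hk : ∀ k : ℕ, 1 ≤ 2 ^ k * r := fun k => by
    have : (1 : ℝ) ≤ 2 ^ k := one_le_pow₀ one_le_two
    nlinarith
  refine sum_le_of_le_rpow_neg (φ := fun s => s ^ δ / brokenPower A s) hη
    (div_nonneg (by positivity) (brokenPower_nonneg hr0.le)) (fun k => ?_) n
  rw [e _ (hk k), e _ hr, two_pow_mul_rpow hr0]

lemma exists_dyadic_sum_le_rpow_neg {ρ : ℝ} (hρ : 0 < ρ) (hρA : A.1 - δ ≤ ρ) (hA2 : δ < A.2) :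
    ∃ C : ℝ, 0 < C ∧ ∀ r : ℝ, 0 < r → r ≤ 1 → ∀ n : ℕ, ∑ k ∈ Finset.range n,
      (2 ^ k * r) ^ δ / brokenPower A (2 ^ k * r) ≤ C * r ^ (-ρ) := by
  set η := min ρ (A.2 - δ) with hη
  have hη0 : 0 < η := lt_min hρ (by linarith)
  have hηρ : η ≤ ρ := min_le_left _ _
  have hηA : η ≤ A.2 - δ := min_le_right _ _
  have hq : (2 : ℝ) ^ (-η) < 1 := Real.rpow_lt_one_of_one_lt_of_neg one_lt_two (by linarith)
  refine ⟨(1 - (2 : ℝ) ^ (-η))⁻¹, inv_pos.2 (by linarith), fun r hr hr1 n => ?_⟩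
  refine sum_le_of_le_rpow_neg (φ := fun s => s ^ δ / brokenPower A s) hη0 (by positivity)
    (fun k => ?_) n
  have hs : 0 < 2 ^ k * r := by positivity
  have h2k : (1 : ℝ) ≤ 2 ^ k := one_le_pow₀ one_le_two
  rcases le_total (2 ^ k * r) 1 with h | h
  · rw [brokenPower_of_le_one h, ← Real.rpow_sub hs]
    calc (2 ^ k * r) ^ (δ - A.1) ≤ (2 ^ k * r) ^ (-ρ) :=
          Real.rpow_le_rpow_of_exponent_ge hs h (by linarith)
      _ = r ^ (-ρ) * ((2 : ℝ) ^ (-ρ)) ^ k := two_pow_mul_rpow hr _ _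
      _ ≤ r ^ (-ρ) * ((2 : ℝ) ^ (-η)) ^ k := by
          gcongr
          exact one_le_two
  · rw [brokenPower_of_one_le h, ← Real.rpow_sub hs]
    calc (2 ^ k * r) ^ (δ - A.2) ≤ (2 ^ k * r) ^ (-η) :=
          Real.rpow_le_rpow_of_exponent_le h (by linarith)
      _ = r ^ (-η) * ((2 : ℝ) ^ (-η)) ^ k := two_pow_mul_rpow hr _ _
      _ ≤ r ^ (-ρ) * ((2 : ℝ) ^ (-η)) ^ k := by
          have := Real.rpow_le_rpow_of_exponent_ge hr hr1 (neg_le_neg hηρ)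
          exact mul_le_mul_of_nonneg_right this (by positivity)

lemma exists_dyadic_sum_le_const (hA1 : A.1 < δ) (hA2 : δ < A.2) :
    ∃ C : ℝ, 0 < C ∧ ∀ r : ℝ, 0 < r → ∀ n : ℕ, ∑ k ∈ Finset.range n,
      (2 ^ k * r) ^ δ / brokenPower A (2 ^ k * r) ≤ C := by
  set η := min (δ - A.1) (A.2 - δ) with hη
  have hη0 : 0 < η := lt_min (by linarith) (by linarith)
  have hη1 : η ≤ δ - A.1 := min_le_left _ _
  have hη2 : η ≤ A.2 - δ := min_le_right _ _
  set a : ℝ := 2 ^ η with ha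
  have ha1 : 1 < a := Real.one_lt_rpow one_lt_two hη0
  set Φ : ℝ → ℝ := fun s => s ^ η / (1 + s ^ η) with hΦ
  set C : ℝ := 2 * (1 + a) / (a - 1) with hC
  have hC0 : 0 < C := div_pos (by linarith) (by linarith)
  refine ⟨C, hC0, fun r hr n => ?_⟩
  have key : ∀ s : ℝ, 0 < s → s ^ δ / brokenPower A s ≤ C * (Φ (2 * s) - Φ s) := by
    intro s hs
    set u := s ^ η with hu
    have hu0 : 0 < u := by positivity
    have e : Φ (2 * s) - Φ s = (a - 1) * u / ((1 + a * u) * (1 + u)) := by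
      simp only [hΦ]
      rw [Real.mul_rpow two_pos.le hs.le, ← ha, ← hu, div_sub_div _ _ (by positivity) (by positivity)]
      congr 1
      ring
    have e2 : C * (Φ (2 * s) - Φ s) = 2 * (1 + a) * u / ((1 + a * u) * (1 + u)) := by
      have : a - 1 ≠ 0 := by linarith
      rw [e, hC]
      field_simp
    rw [e2, le_div_iff₀ (by positivity)]
    rcases le_total s 1 with h | h
    · have hu1 : u ≤ 1 := Real.rpow_le_one hs.le h hη0.le
      have h1 : s ^ δ / brokenPower A s ≤ u := by
        rw [brokenPower_of_le_one h, ← Real.rpow_sub hs]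
        exact Real.rpow_le_rpow_of_exponent_ge hs h hη1
      have h2 : (1 + a * u) * (1 + u) ≤ 2 * (1 + a) := by
        have : a * u ≤ a := by nlinarith
        nlinarith
      calc _ ≤ u * (2 * (1 + a)) := by gcongr
        _ = _ := by ring
    · have hu1 : 1 ≤ u := Real.one_le_rpow h hη0.le
      have h1 : s ^ δ / brokenPower A s ≤ u⁻¹ := by
        rw [brokenPower_of_one_le h, ← Real.rpow_sub hs, hu, ← Real.rpow_neg hs.le]
        exact Real.rpow_le_rpow_of_exponent_le h (by linarith)
      have h2 : (1 + a * u) * (1 + u) ≤ (1 + a) * u * (2 * u) := by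
        have h3 : 1 + a * u ≤ (1 + a) * u := by nlinarith
        have h4 : 1 + u ≤ 2 * u := by linarith
        exact mul_le_mul h3 h4 (by positivity) (by positivity)
      calc _ ≤ u⁻¹ * ((1 + a) * u * (2 * u)) := by gcongr
        _ = _ := by field_simp
  calc _ ≤ ∑ k ∈ Finset.range n, C * (Φ (2 ^ (k + 1) * r) - Φ (2 ^ k * r)) := by
        refine Finset.sum_le_sum fun k _ => ?_
        rw [pow_succ, mul_comm _ (2 : ℝ), mul_assoc]
        exact key _ (by positivity)
    _ = C * (Φ (2 ^ n * r) - Φ (2 ^ 0 * r)) := by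
        rw [← Finset.mul_sum, Finset.sum_range_sub (fun k => Φ (2 ^ k * r))]
    _ ≤ C * 1 := by
        gcongr
        have h1 : Φ (2 ^ n * r) ≤ 1 := by
          simp only [hΦ]
          rw [div_le_one (by positivity)]
          linarith
        have h2 : 0 ≤ Φ (2 ^ 0 * r) := by
          simp only [hΦ]
          positivity
        linarith
    _ = C := mul_one C

lemma exists_dyadic_exponents (hA1 : 0 < A.1) (hB2 : 0 < B.2) (hδ : 0 ≤ δ) (h12 : A.1 ≤ B.2)
    (hA2 : δ < A.2) (h : (A.1 < δ ∧ δ * A.1 ≤ B.2 ^ 2) ∨ δ < A.1 ∨ (A.1 = δ ∧ A.1 < B.2)) :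
    ∃ α ρ C : ℝ, 0 ≤ α ∧ α ≤ δ ∧ α ≤ A.1 - ρ ∧ A.1 * (B.2 + δ) ≤ B.2 * (α + B.2) ∧ 0 < C ∧
      ∀ r : ℝ, 0 < r → r ≤ 1 → ∀ n : ℕ, ∑ k ∈ Finset.range n,
        (2 ^ k * r) ^ δ / brokenPower A (2 ^ k * r) ≤ C * r ^ (-ρ) := by
  rcases h with ⟨h1, h2⟩ | h1 | ⟨h1, h2⟩
  · obtain ⟨C, hC, hs⟩ := exists_dyadic_sum_le_const h1 hA2
    refine ⟨A.1, 0, C, hA1.le, h1.le, by simp, by nlinarith, hC, fun r hr _ n => ?_⟩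
    simpa using hs r hr n
  · obtain ⟨C, hC, hs⟩ := exists_dyadic_sum_le_rpow_neg (A := A) (ρ := A.1 - δ) (by linarith)
      le_rfl hA2
    exact ⟨δ, A.1 - δ, C, hδ, le_rfl, by linarith, by nlinarith, hC, hs⟩
  · set κ := min δ ((B.2 ^ 2 - δ ^ 2) / B.2) with hκ
    have hpos : 0 < B.2 ^ 2 - δ ^ 2 := by nlinarith
    have hκ0 : 0 < κ := lt_min (by linarith) (by positivity)
    have hκ2 : κ * B.2 ≤ B.2 ^ 2 - δ ^ 2 := by
      rw [← le_div_iff₀ hB2]; exact min_le_right _ _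
    obtain ⟨C, hC, hs⟩ := exists_dyadic_sum_le_rpow_neg (A := A) (ρ := κ) hκ0 (by linarith) hA2
    have hκ1 : κ ≤ δ := min_le_left _ _
    refine ⟨δ - κ, κ, C, by linarith, by linarith, by linarith, ?_, hC, hs⟩
    rw [h1]
    nlinarith

end DyadicSums

section Sufficiency

variable {d : ℕ} {A B : ℝ × ℝ} {δ α ρ : ℝ}

lemma mul_le_of_scale_estimates (hA1 : 0 < A.1) (hA2 : 0 < A.2) (hB1 : 0 < B.1) (hB2 : 0 < B.2)
    (hδ : 0 ≤ δ) (hα : 0 ≤ α) (hαδ : α ≤ δ) (hαρ : α ≤ A.1 - ρ) (h12 : A.1 ≤ B.2)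
    (h21 : B.1 ≤ A.2) (hα' : A.1 * (B.2 + δ) ≤ B.2 * (α + B.2))
    {K L κ F G X Y N : ℝ} (hK : 1 ≤ K) (hL : 1 ≤ L)
    (hLκ : ∀ s : ℝ, 0 < s → brokenPower B s ≤ L * brokenPower B (κ * s))
    (hF : 0 < F) (hG : 0 < G) (hX : 0 < X) (hY : 0 < Y) (hκ : 0 < κ)
    (h1 : ∀ r : ℝ, 0 < r → F ≤ K * (X / brokenPower A r + Y / brokenPower B (κ / r)))
    (h2 : ∀ S : ℝ, 0 < S → G ≤ K * (S ^ δ * N + Y / brokenPower B S))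
    (h3 : ∀ r : ℝ, 1 ≤ r → N ≤ K * (r ^ δ * F + r ^ δ / brokenPower A r * X))
    (h4 : ∀ r : ℝ, 0 < r → r ≤ 1 → N ≤ K * (r ^ δ * F + r ^ (-ρ) * X)) :
    F * G ≤ 16 * K ^ 4 * L * (X * Y) := by
  have hK0 : 0 < K := by linarith
  obtain ⟨r, hr, hrA⟩ := exists_brokenPower_eq hA1 hA2 (t := 2 * K * X / F) (by positivity)
  obtain ⟨S, hS, hSB⟩ := exists_brokenPower_eq hB1 hB2 (t := 2 * K * Y / G) (by positivity)
  have hwr := brokenPower_pos (A := A) hr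
  have hwS := brokenPower_pos (A := B) hS
  have hXF : K * (X / brokenPower A r) = F / 2 := by rw [hrA]; field_simp
  have hYG : K * (Y / brokenPower B S) = G / 2 := by rw [hSB]; field_simp
  have hX' : X = brokenPower A r * F / (2 * K) := by rw [hrA]; field_simp
  have hXle : X ≤ brokenPower A r * F := by
    rw [hX']
    exact div_le_self (by positivity) (by linarith)
  have hFB : F * brokenPower B r⁻¹ ≤ L * (brokenPower B S * G) := by
    have hw := brokenPower_pos (A := B) (s := κ / r) (by positivity)
    have h := h1 r hr
    rw [mul_add, hXF] at h
    have h' : F / 2 ≤ K * (Y / brokenPower B (κ / r)) := by linarith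
    rw [mul_div_assoc', le_div_iff₀ hw] at h'
    have hSG : brokenPower B S * G = 2 * K * Y := by rw [hSB]; field_simp
    have hl := hLκ r⁻¹ (by positivity)
    rw [← div_eq_mul_inv] at hl
    calc F * brokenPower B r⁻¹ ≤ F * (L * brokenPower B (κ / r)) := by gcongr
      _ = L * (2 * (F / 2 * brokenPower B (κ / r))) := by ring
      _ ≤ L * (2 * (K * Y)) := by gcongr
      _ = _ := by rw [hSG]; ring
  have hGN : G ≤ 2 * K * S ^ δ * N := by
    have h := h2 S hS
    rw [mul_add, hYG] at h
    linarith
  have hN : N ≤ 2 * K * (if r ≤ 1 then r ^ α else r ^ δ) * F := by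
    split_ifs with hr1
    · have e1 : r ^ δ ≤ r ^ α := Real.rpow_le_rpow_of_exponent_ge hr hr1 hαδ
      have e2 : r ^ (-ρ) * brokenPower A r ≤ r ^ α := by
        rw [brokenPower_of_le_one hr1, ← Real.rpow_add hr]
        exact Real.rpow_le_rpow_of_exponent_ge hr hr1 (by linarith)
      calc N ≤ K * (r ^ δ * F + r ^ (-ρ) * X) := h4 r hr hr1
        _ ≤ K * (r ^ α * F + r ^ (-ρ) * (brokenPower A r * F)) := by gcongr
        _ = K * (r ^ α * F + r ^ (-ρ) * brokenPower A r * F) := by ring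
        _ ≤ K * (r ^ α * F + r ^ α * F) := by gcongr
        _ = _ := by ring
    · calc N ≤ K * (r ^ δ * F + r ^ δ / brokenPower A r * X) := h3 r (not_le.1 hr1).le
        _ ≤ K * (r ^ δ * F + r ^ δ / brokenPower A r * (brokenPower A r * F)) := by gcongr
        _ = _ := by field_simp; ring
  have hmain : brokenPower B r⁻¹ ≤ 4 * K ^ 2 * L * brokenPower B S * S ^ δ *
      (if r ≤ 1 then r ^ α else r ^ δ) := by
    set b := if r ≤ 1 then r ^ α else r ^ δ with hb
    have hGb : G ≤ 2 * K * S ^ δ * (2 * K * b * F) := hGN.trans (by gcongr)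
    refine le_of_mul_le_mul_left ?_ hF
    calc F * brokenPower B r⁻¹ ≤ L * (brokenPower B S * (2 * K * S ^ δ * (2 * K * b * F))) :=
          hFB.trans (by gcongr)
      _ = _ := by ring
  have hK4 : 1 ≤ 4 * K ^ 2 * L := by
    have : 1 ≤ K ^ 2 := one_le_pow₀ hK
    nlinarith
  have hfin := one_le_brokenPower_mul hB1 hB2 hδ hα h12 h21 hα' hK4 hr hS hmain
  rw [hrA, hSB] at hfin
  have : 4 * K ^ 2 * L * (2 * K * X / F * (2 * K * Y / G)) =
      16 * K ^ 4 * L * (X * Y) / (F * G) := by field_simp; ring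
  rw [this, le_div_iff₀ (by positivity)] at hfin
  linarith

lemma exists_brokenPower_le_dilate (hB1 : 0 < B.1) (hB2 : 0 < B.2) {κ : ℝ} (hκ : 0 < κ) :
    ∃ L : ℝ, 1 ≤ L ∧ ∀ s : ℝ, 0 < s → brokenPower B s ≤ L * brokenPower B (κ * s) := by
  have h1 : 1 ≤ max 1 κ⁻¹ := le_max_left _ _
  refine ⟨(max 1 κ⁻¹) ^ (B.1 + B.2), Real.one_le_rpow h1 (by positivity), fun s hs => ?_⟩
  refine le_trans (brokenPower_mono hB1 hB2 hs.le ?_) (brokenPower_dilate_le hB1 hB2 h1 (by positivity))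
  calc s = κ⁻¹ * (κ * s) := by field_simp
    _ ≤ max 1 κ⁻¹ * (κ * s) := by
      gcongr
      exact le_max_right _ _

lemma eLpNorm_eq_zero_of_brokenWeight {A : ℝ × ℝ} (g : EuclideanSpace ℝ (Fin d) → ℂ)
    (hg : Continuous g) (hd : 1 ≤ d) {p : ℝ≥0∞} (hp : p ≠ 0)
    (h : eLpNorm (fun x => brokenWeight A x * ‖g x‖) p volume = 0) : eLpNorm g p volume = 0 := by
  have hm : Measurable fun x : EuclideanSpace ℝ (Fin d) => brokenWeight A x :=
    Measurable.ite (measurableSet_lt measurable_norm measurable_const)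
      (measurable_norm.pow_const _) (measurable_norm.pow_const _)
  have hm' : AEStronglyMeasurable (fun x => brokenWeight A x * ‖g x‖) volume :=
    (hm.mul hg.norm.measurable).aestronglyMeasurable
  rw [eLpNorm_eq_zero_iff hm' hp] at h
  rw [eLpNorm_eq_zero_iff hg.aestronglyMeasurable hp]
  have : Nonempty (Fin d) := ⟨⟨0, hd⟩⟩
  have h0 : ∀ᵐ x : EuclideanSpace ℝ (Fin d), x ≠ 0 := by
    rw [ae_iff]
    simp
  filter_upwards [h, h0] with x hx hx0
  have hw : 0 < brokenWeight A x := by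
    rw [brokenWeight_eq]
    exact brokenPower_pos (norm_pos_iff.2 hx0)
  simpa [hw.ne'] using hx

lemma fourier_continuous (f : SchwartzMap (EuclideanSpace ℝ (Fin d)) ℂ) : Continuous (𝓕 (⇑f)) :=
  (𝓕 f : SchwartzMap (EuclideanSpace ℝ (Fin d)) ℂ).continuous

lemma eLpNorm_tail_le_div (hA1 : 0 < A.1) (hA2 : 0 < A.2)
    (g : EuclideanSpace ℝ (Fin d) → ℂ) (p : ℝ≥0∞) {r : ℝ} (hr : 0 < r) :
    eLpNorm g p (volume.restrict (Metric.ball 0 r)ᶜ) ≤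
      ENNReal.ofReal (1 / brokenPower A r) *
        eLpNorm (fun x => brokenWeight A x * ‖g x‖) p volume := by
  have hw := brokenPower_pos (A := A) hr
  rw [ENNReal.ofReal_div_of_pos hw, ENNReal.ofReal_one, one_div, mul_comm, ← div_eq_mul_inv,
    ENNReal.le_div_iff_mul_le (Or.inl (by simpa using hw)) (Or.inl ENNReal.ofReal_ne_top), mul_comm]
  exact brokenPower_mul_eLpNorm_tail_le hA1 hA2 g p hr.le

lemma toReal_le_mul_add {K : ℝ} (hK : 0 ≤ K) {a b c C : ℝ≥0∞} {s t : ℝ} (hs : 0 ≤ s)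
    (ht : 0 ≤ t) (hb : b ≠ ⊤) (hc : c ≠ ⊤) (hC : C ≤ ENNReal.ofReal K)
    (h : a ≤ C * (ENNReal.ofReal s * b + ENNReal.ofReal t * c)) :
    a.toReal ≤ K * (s * b.toReal + t * c.toReal) := by
  refine ENNReal.toReal_le_of_le_ofReal (by positivity) (h.trans ?_)
  rw [ENNReal.ofReal_mul hK, ENNReal.ofReal_add (by positivity) (by positivity),
    ENNReal.ofReal_mul hs, ENNReal.ofReal_mul ht, ENNReal.ofReal_toReal hb, ENNReal.ofReal_toReal hc]
  gcongr

theorem exists_uncertainty_constant (hd : 1 ≤ d) {p p' : ℝ≥0∞} (hp : 2 ≤ p)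
    (hconj : 1 / p + 1 / p' = 1) (hA1 : 0 < A.1) (hA2 : 0 < A.2) (hB1 : 0 < B.1) (hB2 : 0 < B.2)
    (h12 : A.1 ≤ B.2) (h21 : B.1 ≤ A.2) (hδA : (d : ℝ) * (1 / 2 - (1 / p).toReal) < A.2)
    (h : (A.1 < (d : ℝ) * (1 / 2 - (1 / p).toReal) ∧
          (d : ℝ) * (1 / 2 - (1 / p).toReal) * A.1 ≤ B.2 ^ 2) ∨
        (d : ℝ) * (1 / 2 - (1 / p).toReal) < A.1 ∨
        (A.1 = (d : ℝ) * (1 / 2 - (1 / p).toReal) ∧ A.1 < B.2)) :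
    ∃ C : ℝ, 0 < C ∧
      ∀ f : SchwartzMap (EuclideanSpace ℝ (Fin d)) ℂ,
        eLpNorm (⇑f) p volume * eLpNorm (𝓕 (⇑f)) p' volume ≤ ENNReal.ofReal C *
          (eLpNorm (fun x => brokenWeight A x * ‖f x‖) p volume *
            eLpNorm (fun ξ => brokenWeight B ξ * ‖𝓕 (⇑f) ξ‖) p' volume) := by
  have hθ0 := half_sub_nonneg hp
  obtain ⟨hp1, hp1'⟩ := one_le_of_two_le_conj hconj
  have hinv : (1 / p').toReal = 1 - (1 / p).toReal := by
    have h1 : 1 / p ≠ ⊤ := ne_top_of_le_ne_top ENNReal.one_ne_top (le_self_add.trans_eq hconj)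
    have h2 : 1 / p' ≠ ⊤ := ne_top_of_le_ne_top ENNReal.one_ne_top (le_add_self.trans_eq hconj)
    have := congrArg ENNReal.toReal hconj
    rw [ENNReal.toReal_add h1 h2, ENNReal.toReal_one] at this
    linarith
  have hp'2 : p' ≤ 2 := by
    rcases exponent_cases hp hconj with ⟨-, rfl⟩ | ⟨-, rfl⟩ | ⟨P, Q, hPQ, hP, -, rfl⟩
    · exact one_le_two
    · exact le_rfl
    · rw [← ENNReal.ofReal_ofNat 2]
      refine ENNReal.ofReal_le_ofReal ?_
      have := hPQ.sub_one_mul_conj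
      have := hPQ.symm.pos
      nlinarith
  have hθ' : (1 / p').toReal - (1 / (2 : ℝ≥0∞)).toReal = 1 / 2 - (1 / p).toReal := by
    rw [hinv]; norm_num; ring
  set δ := (d : ℝ) * (1 / 2 - (1 / p).toReal) with hδ
  have hδ0 : 0 ≤ δ := by positivity
  obtain ⟨κ, hκ, C₁, hC₁, hann⟩ := exists_annihilation hd hp hconj
  obtain ⟨C₂, hC₂, hdy⟩ := eLpNorm_two_le_dyadic (d := d) hA1 hA2 hp
  obtain ⟨D₁, hD₁, hsum₁⟩ := exists_dyadic_sum_le_of_one_le hδA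
  obtain ⟨α, ρ, D₂, hα, hαδ, hαρ, hα', hD₂, hsum₂⟩ :=
    exists_dyadic_exponents hA1 hB2 hδ0 h12 hδA h
  obtain ⟨L, hL, hLκ⟩ := exists_brokenPower_le_dilate hB1 hB2 hκ
  set V := volume (Metric.ball (0 : EuclideanSpace ℝ (Fin d)) 1) ^ (1 / 2 - (1 / p).toReal) with hV
  have hVt : V ≠ ⊤ := ENNReal.rpow_ne_top_of_nonneg hθ0 measure_ball_lt_top.ne
  set T : ℝ≥0∞ := 1 + C₁ + V + C₂ * (1 + ENNReal.ofReal D₁ + ENNReal.ofReal D₂) with hT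
  have hTt : T ≠ ⊤ := by finiteness
  have hK1 : 1 ≤ T.toReal := by
    rw [← ENNReal.toReal_one]
    refine ENNReal.toReal_mono hTt ?_
    rw [hT, add_assoc, add_assoc]
    exact le_self_add
  set K := T.toReal with hK
  have hKT : ENNReal.ofReal K = T := ENNReal.ofReal_toReal hTt
  have hK0 : 0 ≤ K := by linarith
  refine ⟨16 * K ^ 4 * L, by positivity, fun f => ?_⟩
  set F := eLpNorm (⇑f) p volume with hF
  set G := eLpNorm (𝓕 (⇑f)) p' volume with hG
  set X := eLpNorm (fun x => brokenWeight A x * ‖f x‖) p volume with hX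
  set Y := eLpNorm (fun ξ => brokenWeight B ξ * ‖𝓕 (⇑f) ξ‖) p' volume with hY
  set N := eLpNorm (⇑f) 2 volume with hN
  have hfc := f.continuous
  have hfc' := fourier_continuous f
  rcases eq_or_ne F 0 with hF0 | hF0
  · simp [hF0]
  rcases eq_or_ne G 0 with hG0 | hG0
  · simp [hG0]
  have hX0 : X ≠ 0 := fun h0 => hF0
    (eLpNorm_eq_zero_of_brokenWeight _ hfc hd (one_pos.trans_le hp1).ne' h0)
  have hY0 : Y ≠ 0 := fun h0 => hG0
    (eLpNorm_eq_zero_of_brokenWeight _ hfc' hd (one_pos.trans_le hp1').ne' h0)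
  have hCpos : ENNReal.ofReal (16 * K ^ 4 * L) ≠ 0 := by
    rw [ne_eq, ENNReal.ofReal_eq_zero, not_le]; positivity
  rcases eq_or_ne X ⊤ with hXt | hXt
  · rw [hXt, ENNReal.top_mul hY0, ENNReal.mul_top hCpos]; exact le_top
  rcases eq_or_ne Y ⊤ with hYt | hYt
  · rw [hYt, ENNReal.mul_top hX0, ENNReal.mul_top hCpos]; exact le_top
  have hFt : F ≠ ⊤ := (f.memLp p volume).eLpNorm_ne_top
  have hNt : N ≠ ⊤ := (f.memLp 2 volume).eLpNorm_ne_top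
  have hGt : G ≠ ⊤ :=
    ((𝓕 f : SchwartzMap (EuclideanSpace ℝ (Fin d)) ℂ).memLp p' volume).eLpNorm_ne_top
  have hdy' : ∀ (r D D₀ E : ℝ), 0 < r → 0 < D₀ → 0 ≤ E → D = D₀ * E →
      ENNReal.ofReal D₀ ≤ ENNReal.ofReal D₁ + ENNReal.ofReal D₂ →
      (∀ n : ℕ, ∑ k ∈ Finset.range n, (2 ^ k * r) ^ δ / brokenPower A (2 ^ k * r) ≤ D) →
      N.toReal ≤ K * (r ^ δ * F.toReal + E * X.toReal) := by
    intro r D D₀ E hr hD₀ hE hDE hDD hs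
    refine toReal_le_mul_add hK0 (by positivity) hE hFt hXt hKT.ge ((hdy f r D hr hs).trans ?_)
    rw [hDE, ENNReal.ofReal_mul hD₀.le]
    calc C₂ * (ENNReal.ofReal (r ^ δ) * F + ENNReal.ofReal D₀ * ENNReal.ofReal E * X)
        ≤ C₂ * (ENNReal.ofReal (r ^ δ) * F * (1 + ENNReal.ofReal D₁ + ENNReal.ofReal D₂) +
          (1 + ENNReal.ofReal D₁ + ENNReal.ofReal D₂) * ENNReal.ofReal E * X) := by
          refine mul_le_mul_right (add_le_add ?_ ?_) _
          · refine le_mul_of_one_le_right zero_le ?_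
            rw [add_assoc]; exact le_self_add
          · refine mul_le_mul_left (mul_le_mul_left ?_ _) _
            rw [add_assoc]; exact hDD.trans le_add_self
      _ = C₂ * (1 + ENNReal.ofReal D₁ + ENNReal.ofReal D₂) *
          (ENNReal.ofReal (r ^ δ) * F + ENNReal.ofReal E * X) := by ring
      _ ≤ T * (ENNReal.ofReal (r ^ δ) * F + ENNReal.ofReal E * X) := by
          gcongr
          exact le_add_self
  have hreal : F.toReal * G.toReal ≤ 16 * K ^ 4 * L * (X.toReal * Y.toReal) := by
    refine mul_le_of_scale_estimates (N := N.toReal) (κ := κ) hA1 hA2 hB1 hB2 hδ0 hα hαδ hαρ h12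
      h21 hα' hK1 hL hLκ (ENNReal.toReal_pos hF0 hFt) (ENNReal.toReal_pos hG0 hGt)
      (ENNReal.toReal_pos hX0 hXt) (ENNReal.toReal_pos hY0 hYt) hκ ?_ ?_ ?_ ?_
    · intro r hr
      have hw1 := brokenPower_pos (A := A) hr
      have hw2 := brokenPower_pos (A := B) (s := κ / r) (by positivity)
      rw [← one_div_mul_eq_div _ X.toReal, ← one_div_mul_eq_div _ Y.toReal]
      refine toReal_le_mul_add (C := C₁) hK0 (by positivity) (by positivity) hXt hYt ?_
        ((hann f r hr).trans ?_)
      · rw [hKT, hT, add_comm 1 C₁, add_assoc, add_assoc]; exact le_self_add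
      · gcongr
        · exact eLpNorm_tail_le_div hA1 hA2 _ _ hr
        · exact eLpNorm_tail_le_div hB1 hB2 _ _ (by positivity)
    · intro S hS
      have hw := brokenPower_pos (A := B) hS
      rw [← one_div_mul_eq_div]
      refine toReal_le_mul_add (C := 1 + V) hK0 (by positivity) (by positivity) hNt hYt ?_
        ((eLpNorm_le_restrict_add_compl hfc'.aestronglyMeasurable hp1'
          (s := Metric.ball 0 S) measurableSet_ball).trans ?_)
      · rw [hKT, hT, add_right_comm 1 C₁, add_assoc]; exact le_self_add
      · have hb := eLpNorm_restrict_le_of_subset_ball hp'2 (by rw [hθ']; exact hθ0) hfc' hS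
          (s := Metric.ball 0 S) subset_rfl
        rw [hθ', ← hδ, ← hV] at hb
        have hb2 : eLpNorm (𝓕 (⇑f)) 2 (volume.restrict (Metric.ball 0 S)) ≤ N := by
          rw [hN, ← eLpNorm_two_fourier f]
          exact eLpNorm_restrict_le _ _ _ _
        have ht := eLpNorm_tail_le_div hB1 hB2 (𝓕 (⇑f)) p' hS
        rw [← hY] at ht
        calc _ ≤ N * (ENNReal.ofReal (S ^ δ) * V) + ENNReal.ofReal (1 / brokenPower B S) * Y :=
              add_le_add (hb.trans (mul_le_mul_left hb2 _)) ht
          _ ≤ N * (ENNReal.ofReal (S ^ δ) * V) + ENNReal.ofReal (1 / brokenPower B S) * Y +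
              (ENNReal.ofReal (S ^ δ) * N + V * (ENNReal.ofReal (1 / brokenPower B S) * Y)) :=
              le_self_add
          _ = _ := by ring
    · intro r hr
      have hr0 : 0 < r := by linarith
      have hw := brokenPower_pos (A := A) hr0
      exact hdy' r _ D₁ _ hr0 hD₁ (by positivity) rfl le_self_add (hsum₁ r hr)
    · intro r hr hr1
      exact hdy' r _ D₂ _ hr hD₂ (by positivity) rfl le_add_self (hsum₂ r hr hr1)
  have := ENNReal.ofReal_le_ofReal hreal
  rwa [ENNReal.ofReal_mul ENNReal.toReal_nonneg, ENNReal.ofReal_mul (by positivity),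
    ENNReal.ofReal_mul ENNReal.toReal_nonneg, ENNReal.ofReal_toReal hFt, ENNReal.ofReal_toReal hGt,
    ENNReal.ofReal_toReal hXt, ENNReal.ofReal_toReal hYt] at this

end Sufficiency

section Rademacher

variable {ι V : Type*} [DecidableEq ι] [NormedAddCommGroup V] [InnerProductSpace ℝ V]

/-- The sum of `b` and the vectors `v i`, `i ∈ I`, with sign `+` for `i ∈ T` and `-` otherwise. -/
def signedSum (I : Finset ι) (v : ι → V) (b : V) (T : Finset ι) : V :=
  b + ∑ i ∈ I, (if i ∈ T then (1 : ℝ) else -1) • v i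

lemma signedSum_insert_of_notMem {I T : Finset ι} {a : ι} (ha : a ∉ I) (haT : a ∉ T) (v : ι → V)
    (b : V) : signedSum (insert a I) v b T = signedSum I v b T - v a := by
  unfold signedSum
  rw [Finset.sum_insert ha, if_neg haT, neg_one_smul]
  abel

lemma signedSum_insert_insert {I T : Finset ι} {a : ι} (ha : a ∉ I) (v : ι → V)
    (b : V) : signedSum (insert a I) v b (insert a T) = signedSum I v b T + v a := by
  unfold signedSum
  rw [Finset.sum_insert ha, if_pos (Finset.mem_insert_self _ _), one_smul, add_assoc b]
  congr 1
  rw [add_comm]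
  congr 1
  refine Finset.sum_congr rfl fun i hi => ?_
  have : i ≠ a := fun h => ha (h ▸ hi)
  simp [this]

lemma sum_powerset_signedSum_insert {I : Finset ι} {a : ι} (ha : a ∉ I) (v : ι → V) (b : V)
    (Φ : V → ℝ) :
    ∑ T ∈ (insert a I).powerset, Φ (signedSum (insert a I) v b T) =
      ∑ T ∈ I.powerset, (Φ (signedSum I v b T - v a) + Φ (signedSum I v b T + v a)) := by
  rw [Finset.sum_powerset_insert ha, Finset.sum_add_distrib]
  congr 1
  · refine Finset.sum_congr rfl fun T hT => ?_
    rw [signedSum_insert_of_notMem ha fun h => ha (Finset.mem_powerset.1 hT h)]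
  · refine Finset.sum_congr rfl fun T _ => ?_
    rw [signedSum_insert_insert ha]

lemma sum_norm_signedSum_sq (I : Finset ι) (v : ι → V) (b : V) :
    ∑ T ∈ I.powerset, ‖signedSum I v b T‖ ^ 2 = 2 ^ I.card * (‖b‖ ^ 2 + ∑ i ∈ I, ‖v i‖ ^ 2) := by
  induction I using Finset.induction_on with
  | empty => simp [signedSum]
  | insert a I ha ih =>
    rw [sum_powerset_signedSum_insert ha v b (fun z => ‖z‖ ^ 2), Finset.card_insert_of_notMem ha,
      Finset.sum_insert ha]
    have : ∀ z : V, ‖z - v a‖ ^ 2 + ‖z + v a‖ ^ 2 = 2 * ‖z‖ ^ 2 + 2 * ‖v a‖ ^ 2 := fun z => by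
      rw [norm_sub_sq_real, norm_add_sq_real]; ring
    simp only [this]
    rw [Finset.sum_add_distrib, ← Finset.mul_sum, ih, Finset.sum_const, Finset.card_powerset,
      nsmul_eq_mul]
    push_cast
    ring

lemma sum_norm_signedSum_pow_four_le (I : Finset ι) (v : ι → V) (b : V) :
    ∑ T ∈ I.powerset, ‖signedSum I v b T‖ ^ 4 ≤
      2 ^ I.card * (3 * (‖b‖ ^ 2 + ∑ i ∈ I, ‖v i‖ ^ 2) ^ 2) := by
  induction I using Finset.induction_on with
  | empty =>
    simp only [signedSum, Finset.powerset_empty, Finset.sum_empty, Finset.sum_singleton, add_zero,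
      Finset.card_empty, pow_zero, one_mul]
    nlinarith [sq_nonneg (‖b‖ ^ 2)]
  | insert a I ha ih =>
    rw [sum_powerset_signedSum_insert ha v b (fun z => ‖z‖ ^ 4), Finset.card_insert_of_notMem ha,
      Finset.sum_insert ha]
    have key : ∀ z : V, ‖z - v a‖ ^ 4 + ‖z + v a‖ ^ 4 ≤
        2 * ‖z‖ ^ 4 + 12 * ‖v a‖ ^ 2 * ‖z‖ ^ 2 + 2 * ‖v a‖ ^ 4 := fun z => by
      have e1 : ‖z - v a‖ ^ 4 = (‖z - v a‖ ^ 2) ^ 2 := by ring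
      have e2 : ‖z + v a‖ ^ 4 = (‖z + v a‖ ^ 2) ^ 2 := by ring
      rw [e1, e2, norm_sub_sq_real, norm_add_sq_real]
      have h := sq_le_sq' (neg_le_of_abs_le (abs_real_inner_le_norm z (v a)))
        (le_of_abs_le (abs_real_inner_le_norm z (v a)))
      nlinarith
    refine (Finset.sum_le_sum fun T _ => key _).trans ?_
    rw [Finset.sum_add_distrib, Finset.sum_add_distrib, ← Finset.mul_sum, ← Finset.mul_sum,
      sum_norm_signedSum_sq, Finset.sum_const, Finset.card_powerset, nsmul_eq_mul]
    push_cast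
    set σ := ‖b‖ ^ 2 + ∑ i ∈ I, ‖v i‖ ^ 2 with hσ
    have e : ‖b‖ ^ 2 + (‖v a‖ ^ 2 + ∑ i ∈ I, ‖v i‖ ^ 2) = σ + ‖v a‖ ^ 2 := by rw [hσ]; ring
    rw [e, pow_succ (2 : ℝ)]
    have h2 : (0 : ℝ) ≤ 2 ^ I.card * ‖v a‖ ^ 4 := by positivity
    nlinarith

/-- The lower Khinchine inequality in `L¹`. -/
lemma le_sum_norm_signedSum (I : Finset ι) (v : ι → V) (b : V) :
    2 ^ I.card * (5 / 9 * √(‖b‖ ^ 2 + ∑ i ∈ I, ‖v i‖ ^ 2)) ≤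
      ∑ T ∈ I.powerset, ‖signedSum I v b T‖ := by
  set σ := √(‖b‖ ^ 2 + ∑ i ∈ I, ‖v i‖ ^ 2) with hσ
  have hσ2 : ‖b‖ ^ 2 + ∑ i ∈ I, ‖v i‖ ^ 2 = σ ^ 2 := (Real.sq_sqrt (by positivity)).symm
  have hσ0 : 0 ≤ σ := Real.sqrt_nonneg _
  rcases hσ0.eq_or_lt with h0 | h0
  · rw [← h0, mul_zero, mul_zero]; positivity
  have key : ∀ t : ℝ, 0 ≤ t → 27 * σ ^ 2 * t ^ 2 - 4 * t ^ 4 ≤ 27 * σ ^ 3 * t := fun t ht => by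
    have : 0 ≤ t * ((2 * t - 3 * σ) ^ 2 * (t + 3 * σ)) := by positivity
    nlinarith
  have h := Finset.sum_le_sum fun T (_ : T ∈ I.powerset) =>
    key ‖signedSum I v b T‖ (norm_nonneg _)
  rw [Finset.sum_sub_distrib, ← Finset.mul_sum, ← Finset.mul_sum, ← Finset.mul_sum,
    sum_norm_signedSum_sq, hσ2] at h
  have h4 := sum_norm_signedSum_pow_four_le I v b
  rw [hσ2] at h4
  have h3 : 0 < 27 * σ ^ 3 := by positivity
  refine le_of_mul_le_mul_left ?_ h3
  nlinarith

end Rademacher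

section Averages

variable {α E κ : Type*} [MeasurableSpace α] {μ : Measure α} [NormedAddCommGroup E]

lemma le_sum_eLpNorm {p : ℝ≥0∞} (hp : 1 ≤ p) (S : Finset κ) {h : κ → α → E} {H : α → ℝ}
    (hh : ∀ i ∈ S, AEStronglyMeasurable (h i) μ) (hH : ∀ x, ‖H x‖ ≤ ∑ i ∈ S, ‖h i x‖) :
    eLpNorm H p μ ≤ ∑ i ∈ S, eLpNorm (h i) p μ := by
  calc eLpNorm H p μ ≤ eLpNorm (∑ i ∈ S, fun x => ‖h i x‖) p μ := by
        refine eLpNorm_mono fun x => (hH x).trans ?_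
        rw [Finset.sum_apply]
        exact le_abs_self _
    _ ≤ ∑ i ∈ S, eLpNorm (fun x => ‖h i x‖) p μ := eLpNorm_sum_le (fun i hi => (hh i hi).norm) hp
    _ = _ := by simp only [eLpNorm_norm]

lemma eLpNorm_ofReal_rpow_eq_lintegral_enorm (g : α → E) {Q : ℝ} (hQ : 0 < Q) :
    eLpNorm g (ENNReal.ofReal Q) μ ^ Q = ∫⁻ x, ‖g x‖ₑ ^ Q ∂μ := by
  rw [eLpNorm_eq_lintegral_rpow_enorm_toReal (by simpa using hQ) ENNReal.ofReal_ne_top,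
    ENNReal.toReal_ofReal hQ.le, ← ENNReal.rpow_mul, one_div_mul_cancel hQ.ne', ENNReal.rpow_one]

lemma sum_eLpNorm_le {Q : ℝ} (hQ1 : 1 ≤ Q) (hQ2 : Q ≤ 2) (S : Finset κ) {h : κ → α → E} {H : α → ℝ}
    (hh : ∀ i ∈ S, AEStronglyMeasurable (h i) μ)
    (hH : ∀ x, ∑ i ∈ S, ‖h i x‖ ^ 2 ≤ S.card * ‖H x‖ ^ 2) :
    ∑ i ∈ S, eLpNorm (h i) (ENNReal.ofReal Q) μ ≤
      S.card * eLpNorm H (ENNReal.ofReal Q) μ := by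
  have hQ0 : 0 < Q := by linarith
  rcases S.eq_empty_or_nonempty with rfl | hS
  · simp
  have hn : (S.card : ℝ≥0∞) ≠ 0 := by simpa using hS.ne_empty
  have hnt : (S.card : ℝ≥0∞) ≠ ⊤ := ENNReal.natCast_ne_top _
  have hw : ∑ _i ∈ S, (S.card : ℝ≥0∞)⁻¹ = 1 := by
    rw [Finset.sum_const, nsmul_eq_mul, ENNReal.mul_inv_cancel hn hnt]
  have hpt : ∀ x, ∑ i ∈ S, (S.card : ℝ≥0∞)⁻¹ * ‖h i x‖ₑ ^ Q ≤ ‖H x‖ₑ ^ Q := by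
    intro x
    have h2 : ∑ i ∈ S, (S.card : ℝ≥0∞)⁻¹ * ‖h i x‖ₑ ^ (2 : ℝ) ≤ ‖H x‖ₑ ^ (2 : ℝ) := by
      rw [← Finset.mul_sum, mul_comm, ← div_eq_mul_inv]
      refine ENNReal.div_le_of_le_mul ?_
      have := ENNReal.ofReal_le_ofReal (hH x)
      rw [ENNReal.ofReal_sum_of_nonneg (fun _ _ => by positivity),
        ENNReal.ofReal_mul (by positivity), ENNReal.ofReal_natCast, mul_comm] at this
      simpa only [ENNReal.ofReal_pow (norm_nonneg _), ofReal_norm, ENNReal.rpow_two] using this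
    have hj := ENNReal.rpow_arith_mean_le_arith_mean_rpow S (fun _ => (S.card : ℝ≥0∞)⁻¹)
      (fun i => ‖h i x‖ₑ ^ Q) hw (p := 2 / Q) (by rw [le_div_iff₀ hQ0]; linarith)
    simp only [← ENNReal.rpow_mul, mul_div_cancel₀ (2 : ℝ) hQ0.ne'] at hj
    have := (ENNReal.rpow_le_rpow_iff (z := Q / 2) (by positivity)).2 (hj.trans h2)
    rw [← ENNReal.rpow_mul, ← ENNReal.rpow_mul] at this
    convert this using 2 
    · rw [div_mul_div_cancel₀ hQ0.ne', div_self two_ne_zero, ENNReal.rpow_one]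
    · ring
  have hJ := ENNReal.rpow_arith_mean_le_arith_mean_rpow S (fun _ => (S.card : ℝ≥0∞)⁻¹)
      (fun i => eLpNorm (h i) (ENNReal.ofReal Q) μ) hw hQ1
  have hfin : ∑ i ∈ S, (S.card : ℝ≥0∞)⁻¹ * eLpNorm (h i) (ENNReal.ofReal Q) μ ≤
      eLpNorm H (ENNReal.ofReal Q) μ := by
    rw [← ENNReal.rpow_le_rpow_iff hQ0]
    refine hJ.trans ?_
    rw [eLpNorm_ofReal_rpow_eq_lintegral_enorm H hQ0]
    have e2 : ∑ i ∈ S, (S.card : ℝ≥0∞)⁻¹ * eLpNorm (h i) (ENNReal.ofReal Q) μ ^ Q =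
        ∫⁻ x, ∑ i ∈ S, (S.card : ℝ≥0∞)⁻¹ * ‖h i x‖ₑ ^ Q ∂μ := by
      rw [lintegral_finsetSum' _ fun i hi => ((hh i hi).enorm.pow_const Q).const_mul _]
      refine Finset.sum_congr rfl fun i hi => ?_
      rw [eLpNorm_ofReal_rpow_eq_lintegral_enorm _ hQ0, lintegral_const_mul'' _ ((hh i hi).enorm.pow_const Q)]
    rw [e2]
    exact lintegral_mono hpt
  rw [← Finset.mul_sum, mul_comm, ← div_eq_mul_inv, ENNReal.div_le_iff hn hnt] at hfin
  rwa [mul_comm]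

end Averages

section DisjointSupports

variable {α E κ : Type*} [MeasurableSpace α] {μ : Measure α} [NormedAddCommGroup E]

lemma map_sum_eq_sum_of_disjoint {M : Type*} [AddCommMonoid M] {S : Finset κ} {z : κ → E}
    (hz : ∀ i ∈ S, ∀ j ∈ S, z i ≠ 0 → z j ≠ 0 → i = j) (Φ : E → M) (hΦ : Φ 0 = 0) :
    Φ (∑ i ∈ S, z i) = ∑ i ∈ S, Φ (z i) := by
  by_cases h : ∃ i ∈ S, z i ≠ 0
  · obtain ⟨i, hi, hzi⟩ := h
    have h0 : ∀ j ∈ S, j ≠ i → z j = 0 := fun j hj hji =>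
      by_contra fun hzj => hji (hz j hj i hi hzj hzi)
    rw [Finset.sum_eq_single_of_mem i hi h0,
      Finset.sum_eq_single_of_mem i hi fun j hj hji => by rw [h0 j hj hji, hΦ]]
  · push Not at h
    rw [Finset.sum_eq_zero h, hΦ, Finset.sum_eq_zero fun j hj => by rw [h j hj, hΦ]]

lemma eLpNorm_sum_le_of_disjoint {p : ℝ≥0∞} (hp : p ≠ 0) (S : Finset κ) {h : κ → α → E}
    (hh : ∀ i ∈ S, AEStronglyMeasurable (h i) μ)
    (hd : ∀ x, ∀ i ∈ S, ∀ j ∈ S, h i x ≠ 0 → h j x ≠ 0 → i = j) {M : ℝ≥0∞}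
    (hM : ∀ i ∈ S, eLpNorm (h i) p μ ≤ M) :
    eLpNorm (fun x => ∑ i ∈ S, h i x) p μ ≤ (S.card : ℝ≥0∞) ^ (1 / p).toReal * M := by
  rcases eq_or_ne p ⊤ with rfl | hpt
  · rw [ENNReal.div_top, ENNReal.toReal_zero, ENNReal.rpow_zero, one_mul]
    refine eLpNormEssSup_le_of_ae_enorm_bound ?_
    have hae : ∀ᵐ x ∂μ, ∀ i ∈ S, ‖h i x‖ₑ ≤ M := by
      refine (Filter.eventually_all_finset S).2 ?_
      intro i hi
      filter_upwards [ae_le_eLpNormEssSup (f := h i) (μ := μ)] with x hx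
      exact hx.trans (hM i hi)
    filter_upwards [hae] with x hx
    by_cases h0 : ∃ i ∈ S, h i x ≠ 0
    · obtain ⟨i, hi, hzi⟩ := h0
      rw [Finset.sum_eq_single_of_mem i hi fun j hj hji =>
        by_contra fun hzj => hji (hd x j hj i hi hzj hzi)]
      exact hx i hi
    · push Not at h0
      rw [Finset.sum_eq_zero h0, enorm_zero]
      exact zero_le
  · have hP : 0 < p.toReal := ENNReal.toReal_pos hp hpt
    have hpP : p = ENNReal.ofReal p.toReal := (ENNReal.ofReal_toReal hpt).symm
    have e : (1 / p).toReal = 1 / p.toReal := by rw [ENNReal.toReal_div, ENNReal.toReal_one]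
    rw [e, ← ENNReal.rpow_le_rpow_iff hP, ENNReal.mul_rpow_of_nonneg _ _ hP.le,
      ← ENNReal.rpow_mul, one_div_mul_cancel hP.ne', ENNReal.rpow_one]
    generalize p.toReal = P at hpP hP
    subst hpP
    rw [eLpNorm_ofReal_rpow_eq_lintegral_enorm _ hP]
    have hpt : ∀ x, ‖∑ i ∈ S, h i x‖ₑ ^ P = ∑ i ∈ S, ‖h i x‖ₑ ^ P := fun x =>
      map_sum_eq_sum_of_disjoint (hd x) (fun z => ‖z‖ₑ ^ P) (by simp [hP])
    simp only [hpt]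
    rw [lintegral_finsetSum' _ fun i hi => (hh i hi).enorm.pow_const P, ← nsmul_eq_mul]
    refine Finset.sum_le_card_nsmul _ _ _ fun i hi => ?_
    rw [← eLpNorm_ofReal_rpow_eq_lintegral_enorm _ hP]
    exact ENNReal.rpow_le_rpow (hM i hi) hP.le

end DisjointSupports

section Bumps

variable {d : ℕ}

lemma exists_bump : ∃ ψ : SchwartzMap (EuclideanSpace ℝ (Fin d)) ℂ,
    (∀ x, ψ x ≠ 0 → ‖x‖ < 1 / 4) ∧ ⇑ψ ≠ 0 := by
  let b : ContDiffBump (0 : EuclideanSpace ℝ (Fin d)) :=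
    ⟨1 / 8, 1 / 4, by norm_num, by norm_num⟩
  have hb : ContDiff ℝ ((⊤ : ℕ∞) : WithTop ℕ∞) (fun x => ((b x : ℝ) : ℂ)) :=
    Complex.ofRealCLM.contDiff.comp b.contDiff
  have hc : HasCompactSupport (fun x => ((b x : ℝ) : ℂ)) :=
    b.hasCompactSupport.comp_left (g := fun t : ℝ => (t : ℂ)) Complex.ofReal_zero
  refine ⟨hc.toSchwartzMap hb, fun x hx => ?_, fun h => ?_⟩
  · have hx' : b x ≠ 0 := fun h0 => hx (by
      change ((b x : ℝ) : ℂ) = 0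
      rw [h0, Complex.ofReal_zero])
    have : x ∈ Function.support b := hx'
    rw [b.support_eq] at this
    simpa [b] using this
  · have := congrFun h 0
    change ((b 0 : ℝ) : ℂ) = 0 at this
    rw [b.one_of_mem_closedBall (by simp [b])] at this
    simp at this

lemma exists_dilation_translation (f : SchwartzMap (EuclideanSpace ℝ (Fin d)) ℂ) {r : ℝ}
    (hr : 0 < r) (a : EuclideanSpace ℝ (Fin d)) :
    ∃ g : SchwartzMap (EuclideanSpace ℝ (Fin d)) ℂ, (∀ x, g x = f (r⁻¹ • x - a)) ∧
      ∀ ξ, ‖𝓕 (⇑g) ξ‖ = r ^ d * ‖𝓕 (⇑f) (r • ξ)‖ := by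
  obtain ⟨g, hg, hg'⟩ := exists_dilation (SchwartzMap.compSubConstCLM ℂ a f) hr
  refine ⟨g, fun x => hg x, fun ξ => ?_⟩
  rw [hg', norm_smul, Real.norm_of_nonneg (by positivity)]
  congr 1
  have := VectorFourier.fourierIntegral_comp_add_right Real.fourierChar
    (volume : Measure (EuclideanSpace ℝ (Fin d))) (innerₗ _) (⇑f) (-a)
  have h2 := congrFun this (r • ξ)
  have h3 : 𝓕 (⇑(SchwartzMap.compSubConstCLM ℂ a f)) (r • ξ) =
      VectorFourier.fourierIntegral Real.fourierChar volume (innerₗ _)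
        (⇑f ∘ fun v => v + -a) (r • ξ) := by
    congr with v
  rw [h3, h2, Circle.norm_smul]
  rfl

lemma eLpNorm_comp_inv_smul_sub {E : Type*} [NormedAddCommGroup E]
    (g : EuclideanSpace ℝ (Fin d) → E)
    (hg : Continuous g) (p : ℝ≥0∞) {r : ℝ} (hr : 0 < r) (a : EuclideanSpace ℝ (Fin d)) :
    eLpNorm (fun x => g (r⁻¹ • x - a)) p volume =
      ENNReal.ofReal (r ^ ((d : ℝ) * (1 / p).toReal)) * eLpNorm g p volume := by
  rw [eLpNorm_comp_smul (fun y => g (y - a)) p (inv_pos.2 hr), Real.inv_rpow hr.le,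
    Real.rpow_neg hr.le, inv_inv]
  congr 1
  exact eLpNorm_comp_measurePreserving hg.aestronglyMeasurable
    (measurePreserving_sub_right volume a)

end Bumps

section WeightedNorms

variable {d : ℕ} {A B : ℝ × ℝ}

lemma measurable_brokenPower_norm (A : ℝ × ℝ) (r : ℝ) :
    Measurable fun x : EuclideanSpace ℝ (Fin d) => brokenPower A (r * ‖x‖) := by
  unfold brokenPower
  refine Measurable.ite (measurableSet_lt (by fun_prop) (by fun_prop)) ?_ ?_
  · exact (measurable_norm.const_mul r).pow_const _
  · exact (measurable_norm.const_mul r).pow_const _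

lemma measurable_brokenWeight (A : ℝ × ℝ) :
    Measurable fun x : EuclideanSpace ℝ (Fin d) => brokenWeight A x := by
  simpa [brokenWeight_eq] using measurable_brokenPower_norm (d := d) A 1

/-- The sum of the two power weights making up a broken power weight. -/
noncomputable def powerSum (A : ℝ × ℝ) (s : ℝ) : ℝ := s ^ A.1 + s ^ A.2

lemma powerSum_nonneg {s : ℝ} (hs : 0 ≤ s) : 0 ≤ powerSum A s := by
  unfold powerSum; positivity

lemma eLpNorm_powerSum_ne_top (hA1 : 0 ≤ A.1) (hA2 : 0 ≤ A.2)
    (f : SchwartzMap (EuclideanSpace ℝ (Fin d)) ℂ) (p : ℝ≥0∞) :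
    eLpNorm (fun x => powerSum A ‖x‖ * ‖f x‖) p volume ≠ ⊤ := by
  set m := ⌈A.1⌉₊ + ⌈A.2⌉₊ with hm
  set g : EuclideanSpace ℝ (Fin d) → ℝ := fun x => (1 + ‖x‖ ^ 2) ^ m with hg
  have hgt : g.HasTemperateGrowth := by
    have h1 : (fun x : EuclideanSpace ℝ (Fin d) => 1 + ‖x‖ ^ 2).HasTemperateGrowth :=
      (Function.HasTemperateGrowth.const 1).add (Function.hasTemperateGrowth_norm_sq _)
    exact h1.pow m
  have hle : ∀ s : ℝ, 0 ≤ s → powerSum A s ≤ 2 * (1 + s ^ 2) ^ m := by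
    intro s hs
    have h1 : 1 ≤ 1 + s ^ 2 := by nlinarith [sq_nonneg s]
    have key : ∀ a : ℝ, 0 ≤ a → ⌈a⌉₊ ≤ m → s ^ a ≤ (1 + s ^ 2) ^ m := by
      intro a ha ham
      calc s ^ a ≤ (1 + s ^ 2) ^ a :=
            Real.rpow_le_rpow hs (by nlinarith [sq_nonneg (s - 1 / 2)]) ha
        _ ≤ (1 + s ^ 2) ^ (m : ℝ) := Real.rpow_le_rpow_of_exponent_le h1
            ((Nat.le_ceil a).trans (by exact_mod_cast ham))
        _ = _ := Real.rpow_natCast _ _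
    have := key A.1 hA1 (by omega)
    have := key A.2 hA2 (by omega)
    unfold powerSum
    linarith
  refine ne_top_of_le_ne_top
    (((2 : ℝ) • SchwartzMap.smulLeftCLM ℂ g f).memLp p volume).eLpNorm_ne_top
    (eLpNorm_mono fun x => ?_)
  rw [smul_apply, SchwartzMap.smulLeftCLM_apply_apply hgt, norm_smul, norm_smul,
    norm_mul, norm_norm, Real.norm_of_nonneg (powerSum_nonneg (norm_nonneg _)), ← mul_assoc]
  refine mul_le_mul_of_nonneg_right ((hle _ (norm_nonneg _)).trans (le_of_eq ?_)) (norm_nonneg _)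
  rw [Real.norm_of_nonneg zero_le_two, Real.norm_of_nonneg (by positivity)]

lemma eLpNorm_brokenWeight_dilation_le {r K : ℝ} (hr : 0 < r)
    (hK : ∀ y : ℝ, 0 ≤ y → brokenPower A (r * y) ≤ K * powerSum A y)
    (g : EuclideanSpace ℝ (Fin d) → ℂ) (p : ℝ≥0∞) :
    eLpNorm (fun x => brokenWeight A x * ‖g (r⁻¹ • x)‖) p volume ≤
      ENNReal.ofReal (r ^ ((d : ℝ) * (1 / p).toReal)) *
        (ENNReal.ofReal K * eLpNorm (fun x => powerSum A ‖x‖ * ‖g x‖) p volume) := by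
  have e : (fun x => brokenWeight A x * ‖g (r⁻¹ • x)‖) =
      fun x => (fun y => brokenPower A (r * ‖y‖) * ‖g y‖) (r⁻¹ • x) := by
    ext x
    simp only
    rw [brokenWeight_eq, norm_smul, Real.norm_of_nonneg (inv_nonneg.2 hr.le),
      mul_inv_cancel_left₀ hr.ne']
  rw [e, eLpNorm_comp_smul (fun y => brokenPower A (r * ‖y‖) * ‖g y‖) p (inv_pos.2 hr),
    Real.inv_rpow hr.le, Real.rpow_neg hr.le, inv_inv]
  gcongr
  refine eLpNorm_le_mul_eLpNorm_of_ae_le_mul (Filter.Eventually.of_forall fun x => ?_) p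
  rw [norm_mul, norm_mul, norm_norm, ← mul_assoc,
    Real.norm_of_nonneg (powerSum_nonneg (norm_nonneg _)),
    Real.norm_of_nonneg (brokenPower_nonneg (by positivity))]
  exact mul_le_mul_of_nonneg_right (hK _ (norm_nonneg _)) (norm_nonneg _)

end WeightedNorms

section Randomization

variable {d : ℕ} {A B : ℝ × ℝ} {ι : Type*} [DecidableEq ι]

lemma signed_uncertainty {p p' : ℝ≥0∞} (hp : 2 ≤ p) (hconj : 1 / p + 1 / p' = 1) {C : ℝ}
    (hC : ∀ f : SchwartzMap (EuclideanSpace ℝ (Fin d)) ℂ,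
      eLpNorm (⇑f) p volume * eLpNorm (𝓕 (⇑f)) p' volume ≤ ENNReal.ofReal C *
        (eLpNorm (fun x => brokenWeight A x * ‖f x‖) p volume *
          eLpNorm (fun ξ => brokenWeight B ξ * ‖𝓕 (⇑f) ξ‖) p' volume))
    (u : SchwartzMap (EuclideanSpace ℝ (Fin d)) ℂ) (I : Finset ι)
    (g : ι → SchwartzMap (EuclideanSpace ℝ (Fin d)) ℂ)
    (hdisj : ∀ x, u x ≠ 0 → ∀ i ∈ I, g i x = 0) :
    eLpNorm (⇑u) p volume *
        (ENNReal.ofReal (5 / 9) * eLpNorm (fun ξ => √(∑ i ∈ I, ‖𝓕 (⇑(g i)) ξ‖ ^ 2)) p' volume) ≤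
      ENNReal.ofReal C *
        ((eLpNorm (fun x => brokenWeight A x * ‖u x‖) p volume +
          eLpNorm (fun x => ∑ i ∈ I, brokenWeight A x * ‖g i x‖) p volume) *
        (eLpNorm (fun ξ => brokenWeight B ξ * ‖𝓕 (⇑u) ξ‖) p' volume +
          eLpNorm (fun ξ => brokenWeight B ξ * √(∑ i ∈ I, ‖𝓕 (⇑(g i)) ξ‖ ^ 2)) p' volume)) := by
  obtain ⟨hp1, hp1'⟩ := one_le_of_two_le_conj hconj
  obtain ⟨Q, hQ1, hQ2, rfl⟩ : ∃ Q : ℝ, 1 ≤ Q ∧ Q ≤ 2 ∧ p' = ENNReal.ofReal Q := by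
    rcases exponent_cases hp hconj with ⟨-, rfl⟩ | ⟨-, rfl⟩ | ⟨P, Q, hPQ, hP, -, rfl⟩
    · exact ⟨1, le_rfl, one_le_two, by simp⟩
    · exact ⟨2, one_le_two, le_rfl, by simp⟩
    · refine ⟨Q, hPQ.symm.lt.le, ?_, rfl⟩
      rw [hPQ.conjugate_eq, div_le_iff₀ (by linarith)]
      linarith
  set G : EuclideanSpace ℝ (Fin d) → ℝ := fun ξ => √(∑ i ∈ I, ‖𝓕 (⇑(g i)) ξ‖ ^ 2) with hG
  let f : Finset ι → SchwartzMap (EuclideanSpace ℝ (Fin d)) ℂ := fun T =>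
    u + ∑ i ∈ I, (if i ∈ T then (1 : ℝ) else -1) • g i
  have hf : ∀ T x, f T x = signedSum I (fun i => g i x) (u x) T := by
    intro T x
    simp only [f, signedSum, add_apply, sum_apply, smul_apply]
  have hff : ∀ T ξ, 𝓕 (⇑(f T)) ξ = signedSum I (fun i => 𝓕 (⇑(g i)) ξ) (𝓕 (⇑u) ξ) T := by
    intro T ξ
    have h1 : (𝓕 (f T) : SchwartzMap (EuclideanSpace ℝ (Fin d)) ℂ) =
        𝓕 u + ∑ i ∈ I, (if i ∈ T then (1 : ℝ) else -1) • 𝓕 (g i) := by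
      simp only [f, FourierTransform.fourier_add, FourierTransform.fourier_sum,
        FourierTransform.fourier_smul]
    have h2 : 𝓕 (⇑(f T)) ξ = (𝓕 (f T) : SchwartzMap (EuclideanSpace ℝ (Fin d)) ℂ) ξ := rfl
    rw [h2, h1]
    simp only [add_apply, sum_apply, smul_apply, signedSum]
    rfl
  set n : ℝ≥0∞ := ((I.powerset).card : ℝ≥0∞) with hn
  have hn' : n = 2 ^ I.card := by rw [hn, Finset.card_powerset]; push_cast; rfl
  have hn0 : n ≠ 0 := by rw [hn']; positivity
  have hnt : n ≠ ⊤ := ENNReal.natCast_ne_top _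
  have hwm := measurable_brokenWeight (d := d) B
  -- the norm of `f T` dominates that of `u`
  have hF : ∀ T, eLpNorm (⇑u) p volume ≤ eLpNorm (⇑(f T)) p volume := by
    intro T
    refine eLpNorm_mono fun x => ?_
    by_cases hx : u x = 0
    · rw [hx, norm_zero]; exact norm_nonneg _
    · rw [hf, signedSum, Finset.sum_eq_zero fun i hi => by rw [hdisj x hx i hi, smul_zero],
        add_zero]
  have hX : ∀ T, eLpNorm (fun x => brokenWeight A x * ‖f T x‖) p volume ≤
      eLpNorm (fun x => brokenWeight A x * ‖u x‖) p volume +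
        eLpNorm (fun x => ∑ i ∈ I, brokenWeight A x * ‖g i x‖) p volume := by
    intro T
    have hwA := measurable_brokenWeight (d := d) A
    refine (eLpNorm_mono_real (g := fun x => brokenWeight A x * ‖u x‖ +
      ∑ i ∈ I, brokenWeight A x * ‖g i x‖) fun x => ?_).trans (eLpNorm_add_le
        (hwA.mul u.continuous.norm.measurable).aestronglyMeasurable ?_ hp1)
    · have hw : 0 ≤ brokenWeight A x := by
        rw [brokenWeight_eq]; exact brokenPower_nonneg (norm_nonneg _)
      rw [norm_mul, norm_norm, Real.norm_of_nonneg hw, ← Finset.mul_sum, ← mul_add, hf, signedSum]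
      refine mul_le_mul_of_nonneg_left ((norm_add_le _ _).trans ?_) hw
      refine add_le_add_right ((norm_sum_le _ _).trans (Finset.sum_le_sum fun i _ => ?_)) _
      rw [norm_smul]
      split_ifs <;> simp
    · exact (Finset.measurable_fun_sum _ fun i _ =>
        hwA.mul (g i).continuous.norm.measurable).aestronglyMeasurable
  have hGlow : n * (ENNReal.ofReal (5 / 9) * eLpNorm G (ENNReal.ofReal Q) volume) ≤
      ∑ T ∈ I.powerset, eLpNorm (𝓕 (⇑(f T))) (ENNReal.ofReal Q) volume := by
    have e : n * (ENNReal.ofReal (5 / 9) * eLpNorm G (ENNReal.ofReal Q) volume) =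
        eLpNorm ((2 ^ I.card * (5 / 9) : ℝ) • G) (ENNReal.ofReal Q) volume := by
      rw [eLpNorm_const_smul, ← mul_assoc, hn', Real.enorm_of_nonneg (by positivity),
        ENNReal.ofReal_mul (by positivity), ENNReal.ofReal_pow zero_le_two, ENNReal.ofReal_ofNat]
    rw [e]
    refine le_sum_eLpNorm hp1' _ (fun T _ => (fourier_continuous _).aestronglyMeasurable)
      fun ξ => ?_
    have := le_sum_norm_signedSum I (fun i => 𝓕 (⇑(g i)) ξ) (𝓕 (⇑u) ξ)
    simp only [hff]
    refine le_trans ?_ this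
    rw [Pi.smul_apply, smul_eq_mul, Real.norm_of_nonneg (by positivity), mul_assoc]
    refine mul_le_mul_of_nonneg_left (mul_le_mul_of_nonneg_left ?_ (by norm_num)) (by positivity)
    exact Real.sqrt_le_sqrt (le_add_of_nonneg_left (by positivity))
  have hYup : ∑ T ∈ I.powerset,
      eLpNorm (fun ξ => brokenWeight B ξ * ‖𝓕 (⇑(f T)) ξ‖) (ENNReal.ofReal Q) volume ≤
      n * (eLpNorm (fun ξ => brokenWeight B ξ * ‖𝓕 (⇑u) ξ‖) (ENNReal.ofReal Q) volume +
        eLpNorm (fun ξ => brokenWeight B ξ * G ξ) (ENNReal.ofReal Q) volume) := by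
    have hGm : Measurable G := (Finset.measurable_fun_sum _ fun i _ =>
      (fourier_continuous (g i)).norm.measurable.pow_const 2).sqrt
    refine (sum_eLpNorm_le hQ1 hQ2 I.powerset (H := fun ξ => brokenWeight B ξ * ‖𝓕 (⇑u) ξ‖ +
      brokenWeight B ξ * G ξ) (fun T _ =>
        (hwm.mul (fourier_continuous _).norm.measurable).aestronglyMeasurable) fun ξ => ?_).trans
        (mul_le_mul_right (eLpNorm_add_le
          (hwm.mul (fourier_continuous _).norm.measurable).aestronglyMeasurable
          (hwm.mul hGm).aestronglyMeasurable hp1') _)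
    have hG0 : 0 ≤ G ξ := Real.sqrt_nonneg _
    have hG2 : G ξ ^ 2 = ∑ i ∈ I, ‖𝓕 (⇑(g i)) ξ‖ ^ 2 := Real.sq_sqrt (by positivity)
    simp only [Pi.mul_apply, norm_mul, norm_norm, mul_pow, hff]
    rw [← Finset.mul_sum, sum_norm_signedSum_sq, ← hG2, ← mul_add, norm_mul, mul_pow,
      Finset.card_powerset, Real.norm_of_nonneg (add_nonneg (norm_nonneg _) hG0)]
    push_cast
    have h0 : (0 : ℝ) ≤ ‖𝓕 (⇑u) ξ‖ * G ξ := by positivity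
    have h1 : (0 : ℝ) ≤ 2 ^ I.card * ‖brokenWeight B ξ‖ ^ 2 := by positivity
    nlinarith
  have hsum : n * (eLpNorm (⇑u) p volume *
      (ENNReal.ofReal (5 / 9) * eLpNorm G (ENNReal.ofReal Q) volume)) ≤
      n * (ENNReal.ofReal C *
        ((eLpNorm (fun x => brokenWeight A x * ‖u x‖) p volume +
          eLpNorm (fun x => ∑ i ∈ I, brokenWeight A x * ‖g i x‖) p volume) *
        (eLpNorm (fun ξ => brokenWeight B ξ * ‖𝓕 (⇑u) ξ‖) (ENNReal.ofReal Q) volume +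
          eLpNorm (fun ξ => brokenWeight B ξ * G ξ) (ENNReal.ofReal Q) volume))) := by
    calc _ = eLpNorm (⇑u) p volume *
          (n * (ENNReal.ofReal (5 / 9) * eLpNorm G (ENNReal.ofReal Q) volume)) := by ring
      _ ≤ eLpNorm (⇑u) p volume *
          ∑ T ∈ I.powerset, eLpNorm (𝓕 (⇑(f T))) (ENNReal.ofReal Q) volume := by gcongr
      _ = ∑ T ∈ I.powerset, eLpNorm (⇑u) p volume *
          eLpNorm (𝓕 (⇑(f T))) (ENNReal.ofReal Q) volume := Finset.mul_sum _ _ _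
      _ ≤ ∑ T ∈ I.powerset, ENNReal.ofReal C *
          ((eLpNorm (fun x => brokenWeight A x * ‖u x‖) p volume +
            eLpNorm (fun x => ∑ i ∈ I, brokenWeight A x * ‖g i x‖) p volume) *
          eLpNorm (fun ξ => brokenWeight B ξ * ‖𝓕 (⇑(f T)) ξ‖) (ENNReal.ofReal Q) volume) := by
        refine Finset.sum_le_sum fun T _ => ?_
        exact (mul_le_mul_left (hF T) _).trans ((hC (f T)).trans
          (mul_le_mul_right (mul_le_mul_left (hX T) _) _))
      _ ≤ _ := by
        rw [← Finset.mul_sum, ← Finset.mul_sum]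
        calc _ ≤ _ := mul_le_mul_right (mul_le_mul_right hYup _) _
          _ = _ := by ring
  exact (ENNReal.mul_le_mul_iff_right hn0 hnt).1 hsum

end Randomization

section Scaling

variable {d : ℕ} {A B : ℝ × ℝ}

lemma ofReal_pow_mul_rpow_inv {p p' : ℝ≥0∞} (hconj : 1 / p + 1 / p' = 1) {r : ℝ} (hr : 0 < r) :
    ENNReal.ofReal (r ^ d) * ENNReal.ofReal (r⁻¹ ^ ((d : ℝ) * (1 / p').toReal)) =
      ENNReal.ofReal (r ^ ((d : ℝ) * (1 / p).toReal)) := by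
  have h1 : 1 / p ≠ ⊤ := ne_top_of_le_ne_top ENNReal.one_ne_top (le_self_add.trans_eq hconj)
  have h2 : 1 / p' ≠ ⊤ := ne_top_of_le_ne_top ENNReal.one_ne_top (le_add_self.trans_eq hconj)
  have h := congrArg ENNReal.toReal hconj
  rw [ENNReal.toReal_add h1 h2, ENNReal.toReal_one] at h
  rw [← ENNReal.ofReal_mul (by positivity), Real.inv_rpow hr.le, ← Real.rpow_neg hr.le,
    ← Real.rpow_natCast, ← Real.rpow_add hr]
  congr 2
  linear_combination (-(d : ℝ)) * h

lemma eLpNorm_fourier_dilation {p p' : ℝ≥0∞} (hconj : 1 / p + 1 / p' = 1)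
    (f : EuclideanSpace ℝ (Fin d) → ℂ) {r : ℝ} (hr : 0 < r) :
    eLpNorm (fun ξ => r ^ d * ‖f (r • ξ)‖) p' volume =
      ENNReal.ofReal (r ^ ((d : ℝ) * (1 / p).toReal)) * eLpNorm f p' volume := by
  have e : (fun ξ => r ^ d * ‖f (r • ξ)‖) = (r ^ d : ℝ) • fun ξ => ‖f (r • ξ)‖ := rfl
  rw [e, eLpNorm_const_smul, eLpNorm_norm, eLpNorm_comp_smul f p' hr,
    Real.enorm_of_nonneg (by positivity), ← mul_assoc, Real.rpow_neg hr.le, ← Real.inv_rpow hr.le,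
    ofReal_pow_mul_rpow_inv hconj hr]

lemma eLpNorm_brokenWeight_fourier_dilation_le {p p' : ℝ≥0∞} (hconj : 1 / p + 1 / p' = 1)
    (f : EuclideanSpace ℝ (Fin d) → ℂ) {r K : ℝ} (hr : 0 < r)
    (hK : ∀ y : ℝ, 0 ≤ y → brokenPower A (r⁻¹ * y) ≤ K * powerSum A y) :
    eLpNorm (fun ξ => brokenWeight A ξ * (r ^ d * ‖f (r • ξ)‖)) p' volume ≤
      ENNReal.ofReal (r ^ ((d : ℝ) * (1 / p).toReal)) *
        (ENNReal.ofReal K * eLpNorm (fun x => powerSum A ‖x‖ * ‖f x‖) p' volume) := by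
  have e : (fun ξ => brokenWeight A ξ * (r ^ d * ‖f (r • ξ)‖)) =
      (r ^ d : ℝ) • fun ξ => brokenWeight A ξ * ‖f (r⁻¹⁻¹ • ξ)‖ := by
    ext ξ
    rw [inv_inv, Pi.smul_apply, smul_eq_mul]
    ring
  rw [e, eLpNorm_const_smul, Real.enorm_of_nonneg (by positivity),
    ← ofReal_pow_mul_rpow_inv hconj hr, mul_assoc]
  exact mul_le_mul_right (eLpNorm_brokenWeight_dilation_le (inv_pos.2 hr) hK f p') _

end Scaling

section Lattice

variable {d : ℕ} {A B : ℝ × ℝ}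

/-- The lattice points of the cube `[2 ^ j, 2 ^ (j + 1))^d`. -/
def dyadicCube (d j : ℕ) : Finset (Fin d → ℕ) :=
  Fintype.piFinset fun _ => Finset.Ico (2 ^ j) (2 ^ (j + 1))

/-- A lattice point seen as a point of Euclidean space. -/
def latticePoint (k : Fin d → ℕ) : EuclideanSpace ℝ (Fin d) := WithLp.toLp 2 fun i => (k i : ℝ)

lemma card_dyadicCube (d j : ℕ) : (dyadicCube d j).card = (2 ^ j) ^ d := by
  rw [dyadicCube, Fintype.card_piFinset]
  simp [pow_succ, mul_two]

lemma one_le_norm_latticePoint_sub {k l : Fin d → ℕ} (h : k ≠ l) :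
    1 ≤ ‖latticePoint k - latticePoint l‖ := by
  obtain ⟨i, hi⟩ := Function.ne_iff.1 h
  refine le_trans ?_ (PiLp.norm_apply_le _ i)
  have h0 : (k i : ℤ) - l i ≠ 0 := by omega
  have := Int.one_le_abs h0
  rw [Real.norm_eq_abs]
  change 1 ≤ |(k i : ℝ) - l i|
  exact_mod_cast this

lemma two_pow_le_norm_latticePoint (hd : 1 ≤ d) {j : ℕ} {k : Fin d → ℕ} (hk : k ∈ dyadicCube d j) :
    2 ^ j ≤ ‖latticePoint k‖ := by
  have h := (Finset.mem_Ico.1 (Fintype.mem_piFinset.1 hk ⟨0, hd⟩)).1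
  refine le_trans ?_ (PiLp.norm_apply_le (latticePoint k) ⟨0, hd⟩)
  rw [Real.norm_eq_abs]
  change 2 ^ j ≤ |((k ⟨0, hd⟩ : ℕ) : ℝ)|
  rw [abs_of_nonneg (Nat.cast_nonneg _)]
  exact_mod_cast h

lemma norm_latticePoint_le {j : ℕ} {k : Fin d → ℕ} (hk : k ∈ dyadicCube d j) :
    ‖latticePoint k‖ ≤ 2 * d * 2 ^ j := by
  rw [EuclideanSpace.norm_eq]
  refine Real.sqrt_le_iff.2 ⟨by positivity, ?_⟩
  have hle : ∀ i ∈ Finset.univ, ‖latticePoint k i‖ ^ 2 ≤ (2 * 2 ^ j : ℝ) ^ 2 := by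
    intro i _
    have h := (Finset.mem_Ico.1 (Fintype.mem_piFinset.1 hk i)).2.le
    have h' : (k i : ℝ) ≤ 2 * 2 ^ j := by
      rw [pow_succ, mul_comm] at h
      exact_mod_cast h
    have e : ‖latticePoint k i‖ = (k i : ℝ) := by
      rw [Real.norm_eq_abs]
      exact abs_of_nonneg (Nat.cast_nonneg _)
    rw [e]
    gcongr
  refine (Finset.sum_le_card_nsmul _ _ _ hle).trans ?_
  rw [Finset.card_univ, Fintype.card_fin, nsmul_eq_mul]
  have h1 : (d : ℝ) ≤ (d : ℝ) ^ 2 := by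
    exact_mod_cast Nat.le_self_pow two_ne_zero d
  calc (d : ℝ) * (2 * 2 ^ j) ^ 2 ≤ (d : ℝ) ^ 2 * (2 * 2 ^ j) ^ 2 := by gcongr
    _ = _ := by ring

lemma eq_of_mem_dyadicCube (hd : 1 ≤ d) {i j : ℕ} {k : Fin d → ℕ} (hi : k ∈ dyadicCube d i)
    (hj : k ∈ dyadicCube d j) : i = j := by
  have h1 := Finset.mem_Ico.1 (Fintype.mem_piFinset.1 hi ⟨0, hd⟩)
  have h2 := Finset.mem_Ico.1 (Fintype.mem_piFinset.1 hj ⟨0, hd⟩)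
  rw [← Nat.log_eq_of_pow_le_of_lt_pow h1.1 h1.2, Nat.log_eq_of_pow_le_of_lt_pow h2.1 h2.2]

lemma eq_of_norm_sub_latticePoint_lt {x : EuclideanSpace ℝ (Fin d)} {k l : Fin d → ℕ}
    (hk : ‖x - latticePoint k‖ < 1 / 4) (hl : ‖x - latticePoint l‖ < 1 / 4) : k = l := by
  by_contra h
  have h1 := one_le_norm_latticePoint_sub h
  have h2 : latticePoint k - latticePoint l =
      (x - latticePoint l) - (x - latticePoint k) := by abel
  rw [h2] at h1
  linarith [norm_sub_le (x - latticePoint l) (x - latticePoint k)]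

lemma eLpNorm_lattice_sum_le (hd : 1 ≤ d) {p : ℝ≥0∞} (hp : p ≠ 0) (hA1 : 0 < A.1) (hA2 : 0 < A.2)
    {ψ : SchwartzMap (EuclideanSpace ℝ (Fin d)) ℂ} (hψ : ∀ x, ψ x ≠ 0 → ‖x‖ < 1 / 4)
    {l t m : ℝ} (hl : 0 < l) (ht : 0 ≤ t) (J : Finset ℕ)
    (g : (Σ _ : ℕ, Fin d → ℕ) → SchwartzMap (EuclideanSpace ℝ (Fin d)) ℂ)
    (hg : ∀ i x, ‖g i x‖ =
      t * (2 ^ i.1 : ℝ) ^ (-((d : ℝ) / 2)) * ‖ψ (l⁻¹ • x - latticePoint i.2)‖)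
    (hm : ∀ j ∈ J, (2 ^ j : ℝ) ^ (-((d : ℝ) * (1 / 2 - (1 / p).toReal))) *
      brokenPower A (l * 2 ^ j) ≤ m) :
    eLpNorm (fun x => ∑ i ∈ J.sigma (dyadicCube d), brokenWeight A x * ‖g i x‖) p volume ≤
      (J.card : ℝ≥0∞) ^ (1 / p).toReal * (ENNReal.ofReal
        ((2 * d + 1 : ℝ) ^ (A.1 + A.2) * t * m * l ^ ((d : ℝ) * (1 / p).toReal)) *
          eLpNorm (⇑ψ) p volume) := by
  set D : ℝ := (2 * d + 1 : ℝ) ^ (A.1 + A.2) with hD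
  have hD0 : 0 < D := by positivity
  have hne : ∀ i x, brokenWeight A x * ‖g i x‖ ≠ 0 → ‖l⁻¹ • x - latticePoint i.2‖ < 1 / 4 := by
    intro i x h
    refine hψ _ fun h0 => h ?_
    rw [hg, h0, norm_zero, mul_zero, mul_zero]
  have hmeas : ∀ i, AEStronglyMeasurable (fun x => brokenWeight A x * ‖g i x‖) volume := fun i =>
    ((measurable_brokenWeight A).mul (g i).continuous.norm.measurable).aestronglyMeasurable
  have hmeas' : ∀ j, AEStronglyMeasurable
      (fun x => ∑ k ∈ dyadicCube d j, brokenWeight A x * ‖g ⟨j, k⟩ x‖) volume := fun j =>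
    (Finset.measurable_fun_sum _ fun k _ => (measurable_brokenWeight A).mul
      (g ⟨j, k⟩).continuous.norm.measurable).aestronglyMeasurable
  have hsingle : ∀ (j : ℕ) (k), k ∈ dyadicCube d j →
      eLpNorm (fun x => brokenWeight A x * ‖g ⟨j, k⟩ x‖) p volume ≤
        ENNReal.ofReal (D * brokenPower A (l * 2 ^ j) * (t * (2 ^ j : ℝ) ^ (-((d : ℝ) / 2)))) *
          (ENNReal.ofReal (l ^ ((d : ℝ) * (1 / p).toReal)) * eLpNorm (⇑ψ) p volume) := by
    intro j k hk
    rw [← eLpNorm_comp_inv_smul_sub (⇑ψ) ψ.continuous p hl (latticePoint k)]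
    refine eLpNorm_le_mul_eLpNorm_of_ae_le_mul (Filter.Eventually.of_forall fun x => ?_) p
    have hw : 0 ≤ brokenWeight A x := by
      rw [brokenWeight_eq]; exact brokenPower_nonneg (norm_nonneg _)
    have hw' : 0 ≤ brokenPower A (l * 2 ^ j) := brokenPower_nonneg (by positivity)
    rw [norm_mul, norm_norm, Real.norm_of_nonneg hw, hg]
    by_cases h0 : ψ (l⁻¹ • x - latticePoint k) = 0
    · simp [h0]
    have hx : ‖x‖ ≤ (2 * d + 1) * (l * 2 ^ j) := by
      have h1 := hψ _ h0
      have h2 : ‖l⁻¹ • x‖ ≤ (2 * d + 1) * 2 ^ j := by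
        have h3 : ‖l⁻¹ • x‖ ≤ ‖l⁻¹ • x - latticePoint k‖ + ‖latticePoint k‖ := by
          simpa using norm_add_le (l⁻¹ • x - latticePoint k) (latticePoint k)
        have h4 := norm_latticePoint_le hk
        have h5 : (1 : ℝ) ≤ 2 ^ j := one_le_pow₀ one_le_two
        linarith
      rw [norm_smul, Real.norm_of_nonneg (inv_nonneg.2 hl.le), inv_mul_le_iff₀ hl] at h2
      linarith
    have hwx : brokenWeight A x ≤ D * brokenPower A (l * 2 ^ j) := by
      rw [brokenWeight_eq]
      exact (brokenPower_mono hA1 hA2 (norm_nonneg _) hx).trans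
        (brokenPower_dilate_le hA1 hA2 (by linarith [Nat.cast_nonneg (α := ℝ) d]) (by positivity))
    calc _ ≤ D * brokenPower A (l * 2 ^ j) *
          (t * (2 ^ j : ℝ) ^ (-((d : ℝ) / 2)) * ‖ψ (l⁻¹ • x - latticePoint k)‖) := by gcongr
      _ = _ := by ring
  have hlevel : ∀ j ∈ J,
      eLpNorm (fun x => ∑ k ∈ dyadicCube d j, brokenWeight A x * ‖g ⟨j, k⟩ x‖) p volume ≤
        ENNReal.ofReal (D * t * m * l ^ ((d : ℝ) * (1 / p).toReal)) * eLpNorm (⇑ψ) p volume := by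
    intro j hj
    refine (eLpNorm_sum_le_of_disjoint hp (dyadicCube d j)
      (h := fun k x => brokenWeight A x * ‖g ⟨j, k⟩ x‖) (fun k _ => hmeas ⟨j, k⟩)
      (fun x k _ k' _ h h' => eq_of_norm_sub_latticePoint_lt (hne ⟨j, k⟩ x h) (hne ⟨j, k'⟩ x h'))
      (hsingle j)).trans ?_
    have h2j : (0 : ℝ) < 2 ^ j := by positivity
    have e1 : (((dyadicCube d j).card : ℕ) : ℝ≥0∞) ^ (1 / p).toReal =
        ENNReal.ofReal ((2 ^ j : ℝ) ^ ((d : ℝ) * (1 / p).toReal)) := by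
      rw [card_dyadicCube, ← ENNReal.ofReal_natCast, ENNReal.ofReal_rpow_of_nonneg (by positivity)
        ENNReal.toReal_nonneg]
      push_cast
      rw [Real.rpow_mul h2j.le, Real.rpow_natCast]
    rw [e1, ← mul_assoc, ← mul_assoc, ← ENNReal.ofReal_mul (by positivity),
      ← ENNReal.ofReal_mul (mul_nonneg (by positivity) (mul_nonneg (mul_nonneg hD0.le
        (brokenPower_nonneg (by positivity))) (by positivity)))]
    refine mul_le_mul_left (ENNReal.ofReal_le_ofReal ?_) _
    have e2 : (2 ^ j : ℝ) ^ ((d : ℝ) * (1 / p).toReal) * (2 ^ j : ℝ) ^ (-((d : ℝ) / 2)) =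
        (2 ^ j : ℝ) ^ (-((d : ℝ) * (1 / 2 - (1 / p).toReal))) := by
      rw [← Real.rpow_add h2j]
      congr 1
      ring
    calc _ = D * t * (((2 ^ j : ℝ) ^ ((d : ℝ) * (1 / p).toReal) *
          (2 ^ j : ℝ) ^ (-((d : ℝ) / 2))) * brokenPower A (l * 2 ^ j)) *
          l ^ ((d : ℝ) * (1 / p).toReal) := by ring
      _ ≤ D * t * m * l ^ ((d : ℝ) * (1 / p).toReal) := by
        rw [e2]
        gcongr
        exact hm j hj
  simp only [Finset.sum_sigma]
  refine eLpNorm_sum_le_of_disjoint hp J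
    (h := fun j x => ∑ k ∈ dyadicCube d j, brokenWeight A x * ‖g ⟨j, k⟩ x‖)
    (fun j _ => hmeas' j) (fun x i _ j _ hi hj => ?_) hlevel
  obtain ⟨k, hk, hk0⟩ := Finset.exists_ne_zero_of_sum_ne_zero hi
  obtain ⟨k', hk', hk0'⟩ := Finset.exists_ne_zero_of_sum_ne_zero hj
  obtain rfl : k = k' := eq_of_norm_sub_latticePoint_lt (hne ⟨i, k⟩ x hk0) (hne ⟨j, k'⟩ x hk0')
  exact eq_of_mem_dyadicCube hd hk hk'

end Lattice

section TestFunctions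

variable {d : ℕ} {A B : ℝ × ℝ} {p p' : ℝ≥0∞}

lemma exists_bump_norms (hp : p ≠ 0) (hp' : p' ≠ 0) (hA1 : 0 ≤ A.1) (hA2 : 0 ≤ A.2)
    (hB1 : 0 ≤ B.1) (hB2 : 0 ≤ B.2) :
    ∃ ψ : SchwartzMap (EuclideanSpace ℝ (Fin d)) ℂ, (∀ x, ψ x ≠ 0 → ‖x‖ < 1 / 4) ∧
      ∃ P G X Y : ℝ, 0 < P ∧ 0 < G ∧ 0 < X ∧ 0 < Y ∧
        eLpNorm (⇑ψ) p volume = ENNReal.ofReal P ∧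
        eLpNorm (𝓕 (⇑ψ)) p' volume = ENNReal.ofReal G ∧
        eLpNorm (fun x => powerSum A ‖x‖ * ‖ψ x‖) p volume ≤ ENNReal.ofReal X ∧
        eLpNorm (fun ξ => powerSum B ‖ξ‖ * ‖𝓕 (⇑ψ) ξ‖) p' volume ≤ ENNReal.ofReal Y := by
  obtain ⟨ψ, hψ, hψ0⟩ := exists_bump (d := d)
  let φ : SchwartzMap (EuclideanSpace ℝ (Fin d)) ℂ := 𝓕 ψ
  have hψ0' : ψ ≠ 0 := fun h => hψ0 (by rw [h]; rfl)
  have hφ0 : φ ≠ 0 := fun h => hψ0' <| by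
    have : (FourierTransform.fourierCLE ℂ (SchwartzMap (EuclideanSpace ℝ (Fin d)) ℂ)) ψ = 0 := h
    exact (ContinuousLinearEquiv.map_eq_zero_iff _).1 this
  have hP : eLpNorm (⇑ψ) p volume ≠ 0 := fun h => hψ0' (schwartz_eq_zero_of_eLpNorm_eq_zero hp h)
  have hG : eLpNorm (⇑φ) p' volume ≠ 0 := fun h => hφ0 (schwartz_eq_zero_of_eLpNorm_eq_zero hp' h)
  have hPt : eLpNorm (⇑ψ) p volume ≠ ⊤ := (ψ.memLp p volume).eLpNorm_ne_top
  have hGt : eLpNorm (⇑φ) p' volume ≠ ⊤ := (φ.memLp p' volume).eLpNorm_ne_top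
  have hbound : ∀ z : ℝ≥0∞, z ≠ ⊤ → ∃ Z : ℝ, 0 < Z ∧ z ≤ ENNReal.ofReal Z := fun z hz =>
    ⟨z.toReal + 1, by positivity, (ENNReal.ofReal_toReal hz).symm.trans_le
      (ENNReal.ofReal_le_ofReal (by linarith))⟩
  obtain ⟨X, hX, hX'⟩ := hbound _ (eLpNorm_powerSum_ne_top hA1 hA2 ψ p)
  obtain ⟨Y, hY, hY'⟩ := hbound _ (eLpNorm_powerSum_ne_top hB1 hB2 φ p')
  exact ⟨ψ, hψ, _, _, X, Y, ENNReal.toReal_pos hP hPt, ENNReal.toReal_pos hG hGt, hX, hY,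
    (ENNReal.ofReal_toReal hPt).symm, (ENNReal.ofReal_toReal hGt).symm, hX', hY'⟩

lemma exists_scaling_bound (hconj : 1 / p + 1 / p' = 1)
    (hA1 : 0 ≤ A.1) (hA2 : 0 ≤ A.2) (hB1 : 0 ≤ B.1) (hB2 : 0 ≤ B.2) {C : ℝ} (hC0 : 0 < C)
    (hC : ∀ f : SchwartzMap (EuclideanSpace ℝ (Fin d)) ℂ,
      eLpNorm (⇑f) p volume * eLpNorm (𝓕 (⇑f)) p' volume ≤ ENNReal.ofReal C *
        (eLpNorm (fun x => brokenWeight A x * ‖f x‖) p volume *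
          eLpNorm (fun ξ => brokenWeight B ξ * ‖𝓕 (⇑f) ξ‖) p' volume)) :
    ∃ K : ℝ, 0 < K ∧ ∀ r a b : ℝ, 0 < r → 0 ≤ a → 0 ≤ b →
      (∀ y : ℝ, 0 ≤ y → brokenPower A (r * y) ≤ a * powerSum A y) →
      (∀ y : ℝ, 0 ≤ y → brokenPower B (r⁻¹ * y) ≤ b * powerSum B y) → 1 ≤ K * (a * b) := by
  obtain ⟨hp1, hp1'⟩ := one_le_of_two_le_conj hconj
  obtain ⟨ψ, -, P, G, X, Y, hP, hG, hX, hY, eP, eG, hX', hY'⟩ :=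
    exists_bump_norms (d := d) (p := p) (p' := p') (zero_lt_one.trans_le hp1).ne'
      (zero_lt_one.trans_le hp1').ne' hA1 hA2 hB1 hB2
  refine ⟨C * X * Y / (P * G), by positivity, fun r a b hr ha hb hA hB => ?_⟩
  obtain ⟨f, hf, hf'⟩ := exists_dilation_translation ψ hr 0
  have h := hC f
  simp only [sub_zero] at hf
  set E : ℝ := r ^ ((d : ℝ) * (1 / p).toReal) with hE
  have hE0 : 0 < E := by positivity
  have n1 : eLpNorm (⇑f) p volume = ENNReal.ofReal (E * P) := by
    rw [ENNReal.ofReal_mul hE0.le, ← eP, ← eLpNorm_comp_inv_smul_sub (⇑ψ) ψ.continuous p hr 0]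
    congr 1
    ext x
    rw [hf, sub_zero]
  have n2 : eLpNorm (𝓕 (⇑f)) p' volume = ENNReal.ofReal (E * G) := by
    rw [ENNReal.ofReal_mul hE0.le, ← eG, ← eLpNorm_fourier_dilation hconj _ hr]
    simp only [← hf', eLpNorm_norm]
  have n3 : eLpNorm (fun x => brokenWeight A x * ‖f x‖) p volume ≤
      ENNReal.ofReal (E * (a * X)) := by
    simp only [hf]
    rw [ENNReal.ofReal_mul hE0.le, ENNReal.ofReal_mul ha]
    exact (eLpNorm_brokenWeight_dilation_le hr hA ψ p).trans
      (mul_le_mul_right (mul_le_mul_right hX' _) _)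
  have n4 : eLpNorm (fun ξ => brokenWeight B ξ * ‖𝓕 (⇑f) ξ‖) p' volume ≤
      ENNReal.ofReal (E * (b * Y)) := by
    simp only [hf']
    rw [ENNReal.ofReal_mul hE0.le, ENNReal.ofReal_mul hb]
    exact (eLpNorm_brokenWeight_fourier_dilation_le hconj _ hr hB).trans
      (mul_le_mul_right (mul_le_mul_right hY' _) _)
  have h' := h.trans (mul_le_mul_right (mul_le_mul' n3 n4) _)
  rw [n1, n2, ← ENNReal.ofReal_mul (by positivity), ← ENNReal.ofReal_mul (by positivity),
    ← ENNReal.ofReal_mul hC0.le, ENNReal.ofReal_le_ofReal_iff (by positivity)] at h'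
  rw [div_mul_eq_mul_div, one_le_div (by positivity)]
  refine le_of_mul_le_mul_left (a := E ^ 2) ?_ (by positivity)
  linarith

lemma sqrt_sum_lattice (J : Finset ℕ) {t z : ℝ} (ht : 0 ≤ t) (hz : 0 ≤ z) :
    √(∑ i ∈ J.sigma (dyadicCube d), (t * (2 ^ i.1 : ℝ) ^ (-((d : ℝ) / 2)) * z) ^ 2) =
      t * √J.card * z := by
  have e : ∀ j : ℕ, ∑ _k ∈ dyadicCube d j, (t * (2 ^ j : ℝ) ^ (-((d : ℝ) / 2)) * z) ^ 2 =
      (t * z) ^ 2 := by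
    intro j
    have h2j : (0 : ℝ) < 2 ^ j := by positivity
    have h1 : ((2 ^ j : ℝ) ^ (-((d : ℝ) / 2))) ^ 2 = ((2 ^ j : ℝ) ^ d)⁻¹ := by
      rw [← Real.rpow_natCast (((2 ^ j : ℝ) ^ (-((d : ℝ) / 2)))), ← Real.rpow_mul h2j.le,
        ← Real.rpow_natCast ((2 : ℝ) ^ j) d, ← Real.rpow_neg h2j.le]
      congr 1
      push_cast
      ring
    rw [Finset.sum_const, card_dyadicCube, nsmul_eq_mul, mul_pow, mul_pow, h1]
    push_cast
    field_simp
  simp only [Finset.sum_sigma, e, Finset.sum_const, nsmul_eq_mul]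
  rw [Real.sqrt_mul (by positivity), Real.sqrt_sq (by positivity)]
  ring

lemma exists_lattice_bound (hd : 1 ≤ d) (hp : 2 ≤ p) (hconj : 1 / p + 1 / p' = 1)
    (hA1 : 0 < A.1) (hA2 : 0 < A.2) (hB1 : 0 < B.1) (hB2 : 0 < B.2) {C : ℝ} (hC0 : 0 < C)
    (hC : ∀ f : SchwartzMap (EuclideanSpace ℝ (Fin d)) ℂ,
      eLpNorm (⇑f) p volume * eLpNorm (𝓕 (⇑f)) p' volume ≤ ENNReal.ofReal C *
        (eLpNorm (fun x => brokenWeight A x * ‖f x‖) p volume *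
          eLpNorm (fun ξ => brokenWeight B ξ * ‖𝓕 (⇑f) ξ‖) p' volume)) :
    ∃ K : ℝ, 0 < K ∧ ∀ (J : Finset ℕ) (ε l m : ℝ), J.Nonempty → 0 < ε → ε ≤ l → l ≤ 1 → 0 < m →
      (∀ j ∈ J, (2 ^ j : ℝ) ^ (-((d : ℝ) * (1 / 2 - (1 / p).toReal))) *
        brokenPower A (l * 2 ^ j) ≤ m) →
      1 ≤ K * ((J.card : ℝ) ^ (-(1 / 2 - (1 / p).toReal)) * m * ε⁻¹ ^ B.2 +
        ε ^ A.1 * l⁻¹ ^ B.2) := by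
  obtain ⟨hp1, hp1'⟩ := one_le_of_two_le_conj hconj
  obtain ⟨ψ, hψ, P, G, X, Y, hP, hG, hX, hY, eP, eG, hX', hY'⟩ :=
    exists_bump_norms (d := d) (p := p) (p' := p') (zero_lt_one.trans_le hp1).ne'
      (zero_lt_one.trans_le hp1').ne' hA1.le hA2.le hB1.le hB2.le
  set D : ℝ := (2 * d + 1 : ℝ) ^ (A.1 + A.2) with hD
  have hD0 : 0 < D := by positivity
  refine ⟨C * (X + D * P) * Y / (P * (5 / 9 * G)), by positivity,
    fun J ε l m hJ hε hεl hl1 hm0 hm => ?_⟩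
  have hl : 0 < l := hε.trans_le hεl
  have hN : (0 : ℝ) < J.card := by exact_mod_cast hJ.card_pos
  set q : ℝ := (1 / p).toReal with hq
  set E : ℝ := ε ^ ((d : ℝ) * q) with hE
  set L : ℝ := l ^ ((d : ℝ) * q) with hL
  have hE0 : 0 < E := by positivity
  have hL0 : 0 < L := by positivity
  set N : ℝ := (J.card : ℝ) with hNdef
  set t : ℝ := N ^ (-q) * ε ^ A.1 / m * E / L with ht
  have ht0 : 0 < t := by positivity
  obtain ⟨u, hu, hu'⟩ := exists_dilation_translation ψ hε 0
  simp only [sub_zero] at hu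
  choose v hv hv' using fun k : Fin d → ℕ => exists_dilation_translation ψ hl (latticePoint k)
  let g : (Σ _ : ℕ, Fin d → ℕ) → SchwartzMap (EuclideanSpace ℝ (Fin d)) ℂ := fun i =>
    (t * (2 ^ i.1 : ℝ) ^ (-((d : ℝ) / 2))) • v i.2
  have hg : ∀ i x, ‖g i x‖ =
      t * (2 ^ i.1 : ℝ) ^ (-((d : ℝ) / 2)) * ‖ψ (l⁻¹ • x - latticePoint i.2)‖ := by
    intro i x
    rw [smul_apply, norm_smul, hv, Real.norm_of_nonneg (by positivity)]
  have hgF : ∀ i ξ, ‖𝓕 (⇑(g i)) ξ‖ =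
      t * (2 ^ i.1 : ℝ) ^ (-((d : ℝ) / 2)) * (l ^ d * ‖𝓕 (⇑ψ) (l • ξ)‖) := by
    intro i ξ
    have h2 : 𝓕 (⇑(g i)) ξ = (𝓕 (g i) : SchwartzMap (EuclideanSpace ℝ (Fin d)) ℂ) ξ := rfl
    rw [h2, FourierTransform.fourier_smul, smul_apply, norm_smul, ← hv' i.2 ξ,
      Real.norm_of_nonneg (by positivity)]
    rfl
  have hsq : ∀ ξ, √(∑ i ∈ J.sigma (dyadicCube d), ‖𝓕 (⇑(g i)) ξ‖ ^ 2) =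
      t * √N * (l ^ d * ‖𝓕 (⇑ψ) (l • ξ)‖) := by
    intro ξ
    simp only [hgF]
    exact sqrt_sum_lattice J ht0.le (by positivity)
  have hdisj : ∀ x, u x ≠ 0 → ∀ i ∈ J.sigma (dyadicCube d), g i x = 0 := by
    intro x hx i hi
    rw [← norm_eq_zero, hg]
    by_contra h
    have h1 := hψ _ (norm_ne_zero_iff.1 (right_ne_zero_of_mul h))
    rw [hu] at hx
    have h2 := hψ _ hx
    rw [norm_smul, Real.norm_of_nonneg (inv_nonneg.2 hε.le)] at h2
    have h3 := two_pow_le_norm_latticePoint hd (Finset.mem_sigma.1 hi).2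
    have h4 : (1 : ℝ) ≤ 2 ^ i.1 := one_le_pow₀ one_le_two
    have h5 : ‖l⁻¹ • x‖ ≤ ε⁻¹ * ‖x‖ := by
      rw [norm_smul, Real.norm_of_nonneg (inv_nonneg.2 hl.le)]
      exact mul_le_mul_of_nonneg_right (inv_anti₀ hε hεl) (norm_nonneg _)
    have h6 := norm_sub_rev (l⁻¹ • x) (latticePoint i.2)
    have h7 := norm_sub_norm_le (latticePoint i.2) (l⁻¹ • x)
    linarith
  have h := signed_uncertainty hp hconj hC u (J.sigma (dyadicCube d)) g hdisj
  simp only [hsq] at h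
  have n1 : eLpNorm (⇑u) p volume = ENNReal.ofReal (E * P) := by
    rw [ENNReal.ofReal_mul hE0.le, ← eP, ← eLpNorm_comp_inv_smul_sub (⇑ψ) ψ.continuous p hε 0]
    congr 1
    ext x
    rw [hu, sub_zero]
  have n2 : eLpNorm (fun ξ => t * √N * (l ^ d * ‖𝓕 (⇑ψ) (l • ξ)‖)) p' volume =
      ENNReal.ofReal (t * √N * (L * G)) := by
    have e : (fun ξ => t * √N * (l ^ d * ‖𝓕 (⇑ψ) (l • ξ)‖)) =
      (t * √N) • fun ξ => l ^ d * ‖𝓕 (⇑ψ) (l • ξ)‖ := rfl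
    rw [e, eLpNorm_const_smul, eLpNorm_fourier_dilation hconj _ hl, eG,
      Real.enorm_of_nonneg (by positivity), ← ENNReal.ofReal_mul (by positivity),
      ← ENNReal.ofReal_mul (by positivity)]
  have n3 : eLpNorm (fun x => brokenWeight A x * ‖u x‖) p volume ≤
      ENNReal.ofReal (E * (ε ^ A.1 * X)) := by
    simp only [hu]
    rw [ENNReal.ofReal_mul hE0.le, ENNReal.ofReal_mul (by positivity)]
    exact (eLpNorm_brokenWeight_dilation_le hε (fun y hy => brokenPower_mul_le_of_le_one hε
      (hεl.trans hl1) hy) ψ p).trans (mul_le_mul_right (mul_le_mul_right hX' _) _)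
  have n4 : eLpNorm (fun ξ => brokenWeight B ξ * ‖𝓕 (⇑u) ξ‖) p' volume ≤
      ENNReal.ofReal (E * (ε⁻¹ ^ B.2 * Y)) := by
    simp only [hu']
    rw [ENNReal.ofReal_mul hE0.le, ENNReal.ofReal_mul (by positivity)]
    exact (eLpNorm_brokenWeight_fourier_dilation_le hconj _ hε fun y hy =>
      brokenPower_mul_le_of_one_le hB1 ((one_le_inv₀ hε).2 (hεl.trans hl1)) hy).trans
      (mul_le_mul_right (mul_le_mul_right hY' _) _)
  have n5 : eLpNorm (fun ξ => brokenWeight B ξ *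
      (t * √N * (l ^ d * ‖𝓕 (⇑ψ) (l • ξ)‖))) p' volume ≤
      ENNReal.ofReal (t * √N * (L * (l⁻¹ ^ B.2 * Y))) := by
    have e : (fun ξ => brokenWeight B ξ * (t * √N * (l ^ d * ‖𝓕 (⇑ψ) (l • ξ)‖))) =
        (t * √N) • fun ξ => brokenWeight B ξ * (l ^ d * ‖𝓕 (⇑ψ) (l • ξ)‖) := by
      ext ξ
      rw [Pi.smul_apply, smul_eq_mul]
      ring
    rw [e, eLpNorm_const_smul, Real.enorm_of_nonneg (by positivity),
      ENNReal.ofReal_mul (p := t * √N) (by positivity), ENNReal.ofReal_mul hL0.le,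
      ENNReal.ofReal_mul (p := l⁻¹ ^ B.2) (by positivity)]
    exact mul_le_mul_right ((eLpNorm_brokenWeight_fourier_dilation_le hconj _ hl fun y hy =>
      brokenPower_mul_le_of_one_le hB1 ((one_le_inv₀ hl).2 hl1) hy).trans
      (mul_le_mul_right (mul_le_mul_right hY' _) _)) _
  have n6 : eLpNorm (fun x => ∑ i ∈ J.sigma (dyadicCube d), brokenWeight A x * ‖g i x‖) p volume ≤
      ENNReal.ofReal (N ^ q * (D * t * m * L * P)) := by
    refine (eLpNorm_lattice_sum_le hd (zero_lt_one.trans_le hp1).ne' hA1 hA2 hψ hl ht0.le J g hg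
      hm).trans_eq ?_
    rw [eP, ← ENNReal.ofReal_natCast, ENNReal.ofReal_rpow_of_nonneg hN.le ENNReal.toReal_nonneg,
      ← ENNReal.ofReal_mul (by positivity), ← ENNReal.ofReal_mul (by positivity)]
  have h' := h.trans (mul_le_mul_right (mul_le_mul' (add_le_add n3 n6) (add_le_add n4 n5)) _)
  rw [n1, n2, ← ENNReal.ofReal_add (by positivity) (by positivity),
    ← ENNReal.ofReal_add (by positivity) (by positivity), ← ENNReal.ofReal_mul (by positivity),
    ← ENNReal.ofReal_mul (by positivity), ← ENNReal.ofReal_mul (by positivity),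
    ← ENNReal.ofReal_mul hC0.le, ENNReal.ofReal_le_ofReal_iff (by positivity)] at h'
  have htL : t * L = N ^ (-q) * ε ^ A.1 / m * E := by
    rw [ht]; field_simp
  have hNq : N ^ q * N ^ (-q) = 1 := by rw [← Real.rpow_add hN, add_neg_cancel, Real.rpow_zero]
  have hNs : √N * N ^ (-q) * N ^ (-(1 / 2 - q)) = 1 := by
    rw [Real.sqrt_eq_rpow, ← Real.rpow_add hN, ← Real.rpow_add hN, ← Real.rpow_zero N]
    congr 1
    ring
  set S : ℝ := N ^ (-(1 / 2 - q)) with hS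
  have hS0 : 0 < S := by positivity
  have e1 : N ^ q * (D * t * m * L * P) = D * P * ε ^ A.1 * E := by
    calc _ = N ^ q * D * m * P * (t * L) := by ring
      _ = (N ^ q * N ^ (-q)) * D * P * ε ^ A.1 * E := by rw [htL]; field_simp
      _ = _ := by rw [hNq, one_mul]
  have e2 : t * √N * L * S * m = ε ^ A.1 * E := by
    calc _ = (t * L) * √N * S * m := by ring
      _ = (√N * N ^ (-q) * S) * ε ^ A.1 * E := by rw [htL]; field_simp
      _ = _ := by rw [hNs, one_mul]
  rw [e1] at h'
  rw [div_mul_eq_mul_div, one_le_div (by positivity)]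
  refine le_of_mul_le_mul_left (a := E ^ 2 * ε ^ A.1) ?_ (by positivity)
  have h'' := mul_le_mul_of_nonneg_right h' (mul_nonneg hS0.le hm0.le)
  have e3 : E * P * (5 / 9 * (t * √N * (L * G))) * (S * m) =
      E * P * (5 / 9 * G) * (t * √N * L * S * m) := by ring
  have e4 : C * ((E * (ε ^ A.1 * X) + D * P * ε ^ A.1 * E) *
      (E * (ε⁻¹ ^ B.2 * Y) + t * √N * (L * (l⁻¹ ^ B.2 * Y)))) * (S * m) =
      C * (E * (ε ^ A.1 * X) + D * P * ε ^ A.1 * E) * Y *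
        (E * ε⁻¹ ^ B.2 * S * m + (t * √N * L * S * m) * l⁻¹ ^ B.2) := by ring
  rw [e3, e4, e2] at h''
  linarith

end TestFunctions

section Exponents

open Filter Topology

variable {A B : ℝ × ℝ} {K q δ : ℝ}

lemma eventually_mul_rpow_lt (K : ℝ) {c η : ℝ} (hc : 0 < c) (hη : 0 < η) :
    ∀ᶠ r in 𝓝[>] (0 : ℝ), K * r ^ c < η := by
  have h : Tendsto (fun r : ℝ => K * r ^ c) (𝓝 0) (𝓝 (K * 0 ^ c)) :=
    ((Real.continuousAt_rpow_const 0 c (Or.inr hc.le)).tendsto).const_mul K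
  rw [Real.zero_rpow hc.ne', mul_zero] at h
  exact (h.mono_left nhdsWithin_le_nhds).eventually_lt_const hη

lemma exists_mul_rpow_lt (K : ℝ) {c η : ℝ} (hc : 0 < c) (hη : 0 < η) :
    ∃ r : ℝ, 0 < r ∧ r ≤ 1 ∧ K * r ^ c < η := by
  have h1 : ∀ᶠ r in 𝓝[>] (0 : ℝ), r ≤ 1 :=
    nhdsWithin_le_nhds (Iic_mem_nhds zero_lt_one)
  obtain ⟨r, h, h', h''⟩ := ((eventually_mul_rpow_lt K hc hη).and
    (h1.and self_mem_nhdsWithin)).exists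
  exact ⟨r, h'', h', h⟩

lemma exists_nat_mul_rpow_neg_lt (K : ℝ) {c η : ℝ} (hc : 0 < c) (hη : 0 < η) :
    ∃ N : ℕ, 0 < N ∧ K * (N : ℝ) ^ (-c) < η := by
  have h : Tendsto (fun N : ℕ => K * (N : ℝ) ^ (-c)) atTop (𝓝 (K * 0)) :=
    ((tendsto_rpow_neg_atTop hc).comp tendsto_natCast_atTop_atTop).const_mul K
  rw [mul_zero] at h
  obtain ⟨N, h, h'⟩ := ((h.eventually_lt_const hη).and (eventually_gt_atTop 0)).exists
  exact ⟨N, h', h⟩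

lemma inv_rpow_mul_rpow_self {s c : ℝ} (hs : 0 < s) : s ^ c * s⁻¹ ^ c = 1 := by
  rw [← Real.mul_rpow hs.le (inv_nonneg.2 hs.le), mul_inv_cancel₀ hs.ne', Real.one_rpow]

/-- The dilates of a single function force the exponents at infinity on one side to dominate those
at the origin on the other side. -/
lemma exponents_le_of_scaling_bound (hA1 : 0 < A.1) (hB1 : 0 < B.1)
    (hK : ∀ r a b : ℝ, 0 < r → 0 ≤ a → 0 ≤ b →
      (∀ y : ℝ, 0 ≤ y → brokenPower A (r * y) ≤ a * powerSum A y) →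
      (∀ y : ℝ, 0 ≤ y → brokenPower B (r⁻¹ * y) ≤ b * powerSum B y) → 1 ≤ K * (a * b)) :
    A.1 ≤ B.2 ∧ B.1 ≤ A.2 := by
  constructor
  · by_contra! h
    obtain ⟨r, hr, hr1, hlt⟩ := exists_mul_rpow_lt K (sub_pos.2 h) one_pos
    refine hlt.not_ge ?_
    rw [Real.rpow_sub hr, div_eq_mul_inv, ← Real.inv_rpow hr.le]
    exact hK r _ _ hr (by positivity) (by positivity)
      (fun y hy => brokenPower_mul_le_of_le_one hr hr1 hy)
      fun y hy => brokenPower_mul_le_of_one_le hB1 ((one_le_inv₀ hr).2 hr1) hy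
  · by_contra! h
    obtain ⟨r, hr, hr1, hlt⟩ := exists_mul_rpow_lt K (sub_pos.2 h) one_pos
    refine hlt.not_ge ?_
    rw [Real.rpow_sub hr, div_eq_mul_inv, ← Real.inv_rpow hr.le, mul_comm (r ^ B.1)]
    refine hK r⁻¹ _ _ (inv_pos.2 hr) (by positivity) (by positivity)
      (fun y hy => brokenPower_mul_le_of_one_le hA1 ((one_le_inv₀ hr).2 hr1) hy) fun y hy => ?_
    rw [inv_inv]
    exact brokenPower_mul_le_of_le_one hr hr1 hy

lemma lt_of_lattice_bound (hA1 : 0 < A.1) (hq : 0 < δ → 0 < q) (hA2 : 0 < A.2)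
    (hK : ∀ (J : Finset ℕ) (ε l m : ℝ), J.Nonempty → 0 < ε → ε ≤ l → l ≤ 1 → 0 < m →
      (∀ j ∈ J, (2 ^ j : ℝ) ^ (-δ) * brokenPower A (l * 2 ^ j) ≤ m) →
      1 ≤ K * ((J.card : ℝ) ^ (-q) * m * ε⁻¹ ^ B.2 + ε ^ A.1 * l⁻¹ ^ B.2)) :
    δ < A.2 := by
  by_contra! h
  obtain ⟨ε, hε, hε1, hlt⟩ := exists_mul_rpow_lt K hA1 one_half_pos
  obtain ⟨N, hN, hlt'⟩ := exists_nat_mul_rpow_neg_lt (K * ε⁻¹ ^ B.2) (hq (hA2.trans_le h))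
    one_half_pos
  have := hK (Finset.range N) ε 1 1 (Finset.nonempty_range_iff.2 hN.ne') hε hε1 le_rfl one_pos ?_
  · rw [Finset.card_range, inv_one, Real.one_rpow] at this
    linarith
  · intro j _
    have h1 : (1 : ℝ) ≤ 2 ^ j := one_le_pow₀ one_le_two
    rw [one_mul, brokenPower_of_one_le h1, ← Real.rpow_add (by positivity)]
    exact Real.rpow_le_one_of_one_le_of_nonpos h1 (by linarith)

lemma mul_le_sq_of_lattice_bound (hA1 : 0 < A.1) (hB2 : 0 < B.2) (hAB : A.1 ≤ B.2)
    (hK : ∀ (J : Finset ℕ) (ε l m : ℝ), J.Nonempty → 0 < ε → ε ≤ l → l ≤ 1 → 0 < m →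
      (∀ j ∈ J, (2 ^ j : ℝ) ^ (-δ) * brokenPower A (l * 2 ^ j) ≤ m) →
      1 ≤ K * ((J.card : ℝ) ^ (-q) * m * ε⁻¹ ^ B.2 + ε ^ A.1 * l⁻¹ ^ B.2)) :
    δ * A.1 ≤ B.2 ^ 2 := by
  by_contra! h
  have hδ : B.2 < δ := by nlinarith
  obtain ⟨s, hs, -, hlt⟩ := exists_mul_rpow_lt K hB2 one_half_pos
  have hc1 : 0 < δ / B.2 - 1 := sub_pos.2 ((one_lt_div hB2).2 hδ)
  have hc2 : 0 < δ / B.2 * A.1 - B.2 := by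
    rw [sub_pos, div_mul_eq_mul_div, lt_div_iff₀ hB2]
    linarith
  have hlim : Tendsto (fun j : ℕ => ((2 : ℝ) ^ j)⁻¹) atTop (𝓝[>] 0) :=
    tendsto_inv_atTop_nhdsGT_zero.comp (tendsto_pow_atTop_atTop_of_one_lt one_lt_two)
  obtain ⟨j, hj1, hj2⟩ := ((hlim.eventually (eventually_mul_rpow_lt s⁻¹ hc1 one_pos)).and
    (hlim.eventually (eventually_mul_rpow_lt (K * s⁻¹ ^ A.1) hc2 one_half_pos))).exists
  set l : ℝ := ((2 : ℝ) ^ j)⁻¹ with hl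
  have hl0 : 0 < l := by positivity
  have hl1 : l ≤ 1 := inv_le_one_of_one_le₀ (one_le_pow₀ one_le_two)
  have hε : s⁻¹ * l ^ (δ / B.2) ≤ l := by
    have e : l ^ (δ / B.2) = l ^ (δ / B.2 - 1) * l := by
      rw [Real.rpow_sub hl0, Real.rpow_one, div_mul_cancel₀ _ hl0.ne']
    rw [e, ← mul_assoc]
    exact mul_le_of_le_one_left hl0.le hj1.le
  have := hK {j} (s⁻¹ * l ^ (δ / B.2)) l (l ^ δ) (Finset.singleton_nonempty j) (by positivity) hε
    hl1 (by positivity) ?_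
  · have e1 : l ^ δ * (s⁻¹ * l ^ (δ / B.2))⁻¹ ^ B.2 = s ^ B.2 := by
      rw [mul_inv, inv_inv, Real.mul_rpow hs.le (by positivity), ← Real.inv_rpow hl0.le,
        ← Real.rpow_mul (inv_nonneg.2 hl0.le), div_mul_cancel₀ _ hB2.ne', mul_left_comm,
        inv_rpow_mul_rpow_self hl0, mul_one]
    have e2 : (s⁻¹ * l ^ (δ / B.2)) ^ A.1 * l⁻¹ ^ B.2 =
        s⁻¹ ^ A.1 * l ^ (δ / B.2 * A.1 - B.2) := by
      rw [Real.mul_rpow (by positivity) (by positivity), ← Real.rpow_mul hl0.le, Real.rpow_sub hl0,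
        Real.inv_rpow hl0.le, mul_assoc, ← div_eq_mul_inv]
    rw [Finset.card_singleton, Nat.cast_one, Real.one_rpow, one_mul, e1, e2] at this
    linarith
  · intro i hi
    rw [Finset.mem_singleton.1 hi, hl, inv_mul_cancel₀ (by positivity),
      brokenPower_of_le_one le_rfl, Real.one_rpow, mul_one, Real.inv_rpow (by positivity),
      Real.rpow_neg (by positivity)]

lemma lt_of_lattice_bound_of_eq (hA1 : 0 < A.1) (hAB : A.1 ≤ B.2) (hAδ : A.1 = δ)
    (hq : 0 < δ → 0 < q)
    (hK : ∀ (J : Finset ℕ) (ε l m : ℝ), J.Nonempty → 0 < ε → ε ≤ l → l ≤ 1 → 0 < m →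
      (∀ j ∈ J, (2 ^ j : ℝ) ^ (-δ) * brokenPower A (l * 2 ^ j) ≤ m) →
      1 ≤ K * ((J.card : ℝ) ^ (-q) * m * ε⁻¹ ^ B.2 + ε ^ A.1 * l⁻¹ ^ B.2)) :
    A.1 < B.2 := by
  by_contra! h
  obtain ⟨hB, hδ⟩ : B.2 = δ ∧ 0 < δ := ⟨by linarith, by linarith⟩
  obtain ⟨s, hs, hs1, hlt⟩ := exists_mul_rpow_lt K hδ one_half_pos
  obtain ⟨N, hN, hlt'⟩ := exists_nat_mul_rpow_neg_lt (K * s⁻¹ ^ δ) (hq hδ) one_half_pos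
  set l : ℝ := ((2 : ℝ) ^ N)⁻¹ with hl
  have hl0 : 0 < l := by positivity
  have := hK (Finset.range N) (l * s) l (l ^ δ) (Finset.nonempty_range_iff.2 hN.ne')
    (by positivity) (mul_le_of_le_one_right hl0.le hs1)
    (inv_le_one_of_one_le₀ (one_le_pow₀ one_le_two)) (by positivity) ?_
  · have e1 : l ^ δ * (l * s)⁻¹ ^ δ = s⁻¹ ^ δ := by
      rw [mul_inv, Real.mul_rpow (by positivity) (by positivity), ← mul_assoc,
        inv_rpow_mul_rpow_self hl0, one_mul]
    have e2 : (l * s) ^ δ * l⁻¹ ^ δ = s ^ δ := by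
      rw [Real.mul_rpow hl0.le hs.le, mul_right_comm, inv_rpow_mul_rpow_self hl0, one_mul]
    rw [Finset.card_range, hB, hAδ, e2, mul_assoc _ (l ^ δ), e1] at this
    linarith
  · intro j hj
    have h2j : (0 : ℝ) < 2 ^ j := by positivity
    have hle : l * 2 ^ j ≤ 1 := by
      rw [hl, inv_mul_le_iff₀ (by positivity), mul_one]
      exact pow_le_pow_right₀ one_le_two (Finset.mem_range.1 hj).le
    rw [brokenPower_of_le_one hle, hAδ, Real.mul_rpow hl0.le h2j.le, mul_left_comm,
      ← Real.rpow_add h2j, neg_add_cancel, Real.rpow_zero, mul_one]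

end Exponents

theorem exponents_of_uncertainty {d : ℕ} (hd : 1 ≤ d) {p p' : ℝ≥0∞} (hp : 2 ≤ p)
    (hconj : 1 / p + 1 / p' = 1) {A B : ℝ × ℝ}
    (hA1 : 0 < A.1) (hA2 : 0 < A.2) (hB1 : 0 < B.1) (hB2 : 0 < B.2) {C : ℝ} (hC0 : 0 < C)
    (hC : ∀ f : SchwartzMap (EuclideanSpace ℝ (Fin d)) ℂ,
      eLpNorm (⇑f) p volume * eLpNorm (𝓕 (⇑f)) p' volume ≤ ENNReal.ofReal C *
        (eLpNorm (fun x => brokenWeight A x * ‖f x‖) p volume *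
          eLpNorm (fun ξ => brokenWeight B ξ * ‖𝓕 (⇑f) ξ‖) p' volume)) :
    A.1 ≤ B.2 ∧ B.1 ≤ A.2 ∧ (d : ℝ) * (1 / 2 - (1 / p).toReal) < A.2 ∧
      ((A.1 < (d : ℝ) * (1 / 2 - (1 / p).toReal) ∧
          (d : ℝ) * (1 / 2 - (1 / p).toReal) * A.1 ≤ B.2 ^ 2) ∨
        (d : ℝ) * (1 / 2 - (1 / p).toReal) < A.1 ∨
        (A.1 = (d : ℝ) * (1 / 2 - (1 / p).toReal) ∧ A.1 < B.2)) := by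
  obtain ⟨K, -, hK⟩ := exists_scaling_bound hconj hA1.le hA2.le hB1.le hB2.le hC0 hC
  obtain ⟨L, -, hL⟩ := exists_lattice_bound hd hp hconj hA1 hA2 hB1 hB2 hC0 hC
  have hq : 0 < (d : ℝ) * (1 / 2 - (1 / p).toReal) → 0 < 1 / 2 - (1 / p).toReal := fun h =>
    pos_of_mul_pos_right h (Nat.cast_nonneg d)
  obtain ⟨h12, h21⟩ := exponents_le_of_scaling_bound hA1 hB1 hK
  refine ⟨h12, h21, lt_of_lattice_bound hA1 hq hA2 hL, ?_⟩
  rcases lt_trichotomy A.1 ((d : ℝ) * (1 / 2 - (1 / p).toReal)) with h | h | h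
  · exact Or.inl ⟨h, mul_le_sq_of_lattice_bound hA1 hB2 h12 hL⟩
  · exact Or.inr (Or.inr ⟨h, lt_of_lattice_bound_of_eq hA1 h12 h hq hL⟩)
  · exact Or.inr (Or.inl h)

/-- Theorem 1.4: characterization of the symmetric Heisenberg uncertainty principle
with broken power weights. -/
theorem heisenberg_symmetric_broken_characterization
    (d : ℕ) (hd : 1 ≤ d) (p p' : ℝ≥0∞) (hp : 2 ≤ p) (hconj : 1/p + 1/p' = 1)
    (A B : ℝ × ℝ) (hA1 : 0 < A.1) (hA2 : 0 < A.2) (hB1 : 0 < B.1) (hB2 : 0 < B.2) :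
    (∃ C : ℝ, 0 < C ∧
      ∀ f : SchwartzMap (EuclideanSpace ℝ (Fin d)) ℂ,
        eLpNorm (⇑f) p volume * eLpNorm (𝓕 (⇑f)) p' volume ≤ ENNReal.ofReal C *
          (eLpNorm (fun x => brokenWeight A x * ‖f x‖) p volume *
            eLpNorm (fun ξ => brokenWeight B ξ * ‖𝓕 (⇑f) ξ‖) p' volume)) ↔
    (A.1 ≤ B.2 ∧ B.1 ≤ A.2 ∧ (d : ℝ) * (1/2 - (1/p).toReal) < A.2 ∧
      ((A.1 < (d : ℝ) * (1/2 - (1/p).toReal) ∧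
          (d : ℝ) * (1/2 - (1/p).toReal) * A.1 ≤ B.2 ^ 2) ∨
        (d : ℝ) * (1/2 - (1/p).toReal) < A.1 ∨
        (A.1 = (d : ℝ) * (1/2 - (1/p).toReal) ∧ A.1 < B.2))) := by
  exact ⟨fun ⟨_, hC0, hC⟩ => exponents_of_uncertainty hd hp hconj hA1 hA2 hB1 hB2 hC0 hC,
    fun ⟨h12, h21, hδA, h⟩ =>
      exists_uncertainty_constant hd hp hconj hA1 hA2 hB1 hB2 h12 h21 hδA h⟩
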